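/- Y is uniquely geodesic: for every pair of points x, y ∈ Y there is exactly one geodesic in Y from x to y. -/

import Mathlib

open Set Metric Filter

noncomputable section

namespace Cat2Cx

/-! ### Comparison angles -/

/-- Inverse hyperbolic cosine. -/
def arcosh (x : ℝ) : ℝ := Real.log (x + Real.sqrt (x ^ 2 - 1))

/-- The Euclidean comparison angle at the vertex of a (comparison) triangle whose adjacent
sides have lengths `a`, `b` and whose opposite side has length `c`, via the law of cosines. -/
def euclCompAngle (a b c : ℝ) : ℝ :=
  Real.arccos ((a ^ 2 + b ^ 2 - c ^ 2) / (2 * a * b))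

/-- The comparison angle in the model plane `M_κ²` of constant curvature `κ ≤ 0`, via the
(Euclidean or hyperbolic) law of cosines. -/
def compAngle (κ a b c : ℝ) : ℝ :=
  if κ = 0 then euclCompAngle a b c
  else
    Real.arccos
      ((Real.cosh (Real.sqrt (-κ) * a) * Real.cosh (Real.sqrt (-κ) * b) -
          Real.cosh (Real.sqrt (-κ) * c)) /
        (Real.sinh (Real.sqrt (-κ) * a) * Real.sinh (Real.sqrt (-κ) * b)))

variable {Z : Type*}

/-! ### Geodesics with respect to a distance function -/

/-- `f` restricted to `[a,b]` is a unit-speed geodesic for the distance function `d`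
(an isometric embedding of the compact interval `[a,b]`). -/
def IsGeodesicWrt (d : Z → Z → ℝ) (f : ℝ → Z) (a b : ℝ) : Prop :=
  a ≤ b ∧ ∀ s ∈ Icc a b, ∀ t ∈ Icc a b, d (f s) (f t) = |s - t|

/-- `f` is a unit-speed geodesic from `x` to `y` (for the distance function `d`),
staying inside `S`. -/
def IsGeodesicFromTo (d : Z → Z → ℝ) (S : Set Z) (f : ℝ → Z) (x y : Z) : Prop :=
  f 0 = x ∧ f (d x y) = y ∧ IsGeodesicWrt d f 0 (d x y) ∧ MapsTo f (Icc 0 (d x y)) S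

/-- `S`, with the distance function `d`, is a geodesic space. -/
def GeodesicSpaceWrt (d : Z → Z → ℝ) (S : Set Z) : Prop :=
  ∀ x ∈ S, ∀ y ∈ S, ∃ f, IsGeodesicFromTo d S f x y

/-- The geodesic segment `[x,y]`: the union of (the images of) all geodesics from `x` to `y`
inside `S`.  In a uniquely geodesic space this is the image of the unique geodesic. -/
def geodSeg (d : Z → Z → ℝ) (S : Set Z) (x y : Z) : Set Z :=
  ⋃ f ∈ {f : ℝ → Z | IsGeodesicFromTo d S f x y}, f '' Icc 0 (d x y)

/-- `C ⊆ S` is geodesically convex with respect to `d`: every geodesic (in `S`) between two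
points of `C` lies in `C`. -/
def ConvexWrtIn (d : Z → Z → ℝ) (S C : Set Z) : Prop :=
  ∀ x ∈ C, ∀ y ∈ C, geodSeg d S x y ⊆ C

/-- `C` is geodesically convex with respect to `d`. -/
abbrev ConvexWrt (d : Z → Z → ℝ) (C : Set Z) : Prop := ConvexWrtIn d univ C

/-- The geodesically convex hull of `A` with respect to `d`. -/
def convexHullWrt (d : Z → Z → ℝ) (A : Set Z) : Set Z :=
  ⋂₀ {C | ConvexWrt d C ∧ A ⊆ C}

/-- The Alexandrov (upper) angle at `p` between two paths `σ`, `τ` issuing from `p`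
(each parametrized so that `σ 0 = τ 0 = p`): the limit as `ε → 0⁺` (i.e. the infimum over
`ε > 0`) of the supremum over `0 < s, t < ε` of the Euclidean comparison angles. -/
def upperAngleWrt (d : Z → Z → ℝ) (p : Z) (σ τ : ℝ → Z) : ℝ :=
  sInf {a | ∃ ε > 0, a = sSup {b | ∃ s t : ℝ, 0 < s ∧ s < ε ∧ 0 < t ∧ t < ε ∧
      b = euclCompAngle (d p (σ s)) (d p (τ t)) (d (σ s) (τ t))}}

/-- The CAT(κ) condition (for `κ ≤ 0`), in the angle-comparison form
(Bridson–Haefliger II.1.7(4)): `S` is geodesic and for every triple of distinct points the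
Alexandrov angle between geodesics is at most the comparison angle in `M_κ²`. -/
def IsCATWrt (κ : ℝ) (d : Z → Z → ℝ) (S : Set Z) : Prop :=
  GeodesicSpaceWrt d S ∧
    ∀ p ∈ S, ∀ q ∈ S, ∀ r ∈ S, p ≠ q → p ≠ r → q ≠ r →
      ∀ σ τ : ℝ → Z, IsGeodesicFromTo d S σ p q → IsGeodesicFromTo d S τ p r →
        upperAngleWrt d p σ τ ≤ compAngle κ (d p q) (d p r) (d q r)

/-- Completeness of `S` with respect to the distance function `d`:
every Cauchy sequence converges. -/
def CompleteWrt (d : Z → Z → ℝ) (S : Set Z) : Prop :=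
  ∀ u : ℕ → Z, (∀ n, u n ∈ S) →
    (∀ ε > 0, ∃ N, ∀ m ≥ N, ∀ n ≥ N, d (u m) (u n) < ε) →
    ∃ x ∈ S, ∀ ε > 0, ∃ N, ∀ n ≥ N, d (u n) x < ε

variable {X : Type*} [MetricSpace X]

/-- `X` is a CAT(κ) metric space. -/
def IsCATSpace (κ : ℝ) (X : Type*) [MetricSpace X] : Prop :=
  IsCATWrt κ (fun x y : X => dist x y) univ

/-- The distance function of the metric space `X`. -/
abbrev xDist (X : Type*) [MetricSpace X] : X → X → ℝ := fun x y => dist x y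

/-! ### The model plane `M_κ²` and polyhedral 2-complexes -/

/-- The distance function of the model plane `M_κ²` of constant curvature `κ ≤ 0`, in global
coordinates `ℝ²`: the Euclidean distance for `κ = 0`, and for `κ < 0` the distance of the
hyperboloid model rescaled by `1/√(-κ)` (so that the curvature is `κ`). -/
def mDist (κ : ℝ) (u v : ℝ × ℝ) : ℝ :=
  if κ = 0 then Real.sqrt ((u.1 - v.1) ^ 2 + (u.2 - v.2) ^ 2)
  else
    (1 / Real.sqrt (-κ)) *
      arcosh (Real.sqrt (1 + u.1 ^ 2 + u.2 ^ 2) * Real.sqrt (1 + v.1 ^ 2 + v.2 ^ 2) -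
        u.1 * v.1 - u.2 * v.2)

/-- A convex polygonal 2-cell in `M_κ²`: the geodesically convex hull of a finite set of
points, with nonempty interior. -/
def IsPolygonalCell (κ : ℝ) (P : Set (ℝ × ℝ)) : Prop :=
  ∃ F : Finset (ℝ × ℝ), P = convexHullWrt (mDist κ) (F : Set (ℝ × ℝ)) ∧ (interior P).Nonempty

/-- The subset `S` of `X` embeds isometrically into the model plane `M_κ²`. -/
def IsomEmbedsInModelPlane (κ : ℝ) (S : Set X) : Prop :=
  ∃ f : X → ℝ × ℝ, ∀ x ∈ S, ∀ y ∈ S, mDist κ (f x) (f y) = dist x y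

/-- A locally finite `M_κ`-polyhedral 2-complex structure on the metric space `X`:
`X` is partitioned into open 2-cells (faces), open 1-cells (edges) and vertices; the closure of
each face is isometric to a compact convex polygon of the model plane `M_κ²` (so each face has
constant curvature `κ`), each edge is a geodesic arc, and the complex is locally finite. -/
structure PolyComplex2 (κ : ℝ) (X : Type*) [MetricSpace X] where
  faces : Set (Set X)
  edges : Set (Set X)
  vertices : Set X
  faces_open : ∀ F ∈ faces, IsOpen F
  cover : ⋃₀ faces ∪ ⋃₀ edges ∪ vertices = univ
  cells_disjoint : ∀ c ∈ faces ∪ edges, ∀ c' ∈ faces ∪ edges, c ≠ c' → c ∩ c' = ∅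
  cells_vertex_disjoint : ∀ c ∈ faces ∪ edges, c ∩ vertices = ∅
  face_chart : ∀ F ∈ faces, ∃ (f : X → ℝ × ℝ) (P : Set (ℝ × ℝ)),
    IsPolygonalCell κ P ∧ InjOn f (closure F) ∧ f '' closure F = P ∧ f '' F = interior P ∧
    ∀ x ∈ closure F, ∀ y ∈ closure F, mDist κ (f x) (f y) = dist x y
  edge_geodesic : ∀ e ∈ edges, ∃ (f : ℝ → X) (L : ℝ), 0 < L ∧
    IsGeodesicWrt (fun x y : X => dist x y) f 0 L ∧ f '' Ioo 0 L = e
  edge_closure : ∀ e ∈ edges, closure e \ e ⊆ vertices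
  face_closure : ∀ F ∈ faces, closure F \ F ⊆ ⋃₀ edges ∪ vertices
  locally_finite : ∀ x : X, ∃ ε > 0,
    {c | (c ∈ faces ∨ c ∈ edges) ∧ (c ∩ ball x ε).Nonempty}.Finite ∧
    (vertices ∩ ball x ε).Finite

/-! ### Simple closed curves, their interiors, and first homology -/

/-- A simple closed curve in `X` (identified with its image). -/
structure SCC (X : Type*) [TopologicalSpace X] where
  toFun : ℝ → X
  contOn : ContinuousOn toFun (Icc 0 1)
  loop : toFun 0 = toFun 1
  inj : InjOn toFun (Ico 0 1)

/-- The image of a simple closed curve. -/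
def SCC.img {X : Type*} [TopologicalSpace X] (γ : SCC X) : Set X := γ.toFun '' Icc 0 1

/-- The first singular homology class of a loop, via the Hurewicz isomorphism: the class of
the loop in the abelianization of the fundamental group (of its path component); the loop is
nullhomologous iff this class is trivial. -/
def loopClassH1 {B : Type*} [TopologicalSpace B] {x : B} (p : Path x x) :
    Abelianization (FundamentalGroup B x) :=
  Abelianization.of (FundamentalGroup.fromPath (X := TopCat.of B) ⟦p⟧)

/-- The basepoint of a simple closed curve, regarded in a subspace `B` containing it. -/
def SCC.basePoint {X : Type*} [TopologicalSpace X] (γ : SCC X) (B : Set X)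
    (h : γ.img ⊆ B) : B :=
  ⟨γ.toFun 0, h ⟨0, ⟨le_rfl, zero_le_one⟩, rfl⟩⟩

/-- The loop of a simple closed curve, as a `Path` in a subspace `B` containing it. -/
def SCC.pathIn {X : Type*} [TopologicalSpace X] (γ : SCC X) (B : Set X) (h : γ.img ⊆ B) :
    Path (γ.basePoint B h) (γ.basePoint B h) where
  toFun t := ⟨γ.toFun t, h ⟨(t : ℝ), t.2, rfl⟩⟩
  continuous_toFun := by
    apply Continuous.subtype_mk
    exact γ.contOn.comp_continuous continuous_subtype_val fun t => t.2
  source' := by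
    apply Subtype.ext
    rfl
  target' := by
    apply Subtype.ext
    exact γ.loop.symm

/-- The simple closed curve `γ` is nullhomologous in the subspace `B` of `X`:
its class in `H₁(B)` vanishes. -/
def SCC.NullhomologousIn {X : Type*} [TopologicalSpace X] (γ : SCC X) (B : Set X) : Prop :=
  ∀ h : γ.img ⊆ B, loopClassH1 (γ.pathIn B h) = 1

/-- The interior of a simple closed curve `γ`:
`Int γ = {x ∈ X \ γ | [γ] ≠ 0 ∈ H₁(X \ {x})}`. -/
def SCC.interiorSet {X : Type*} [TopologicalSpace X] (γ : SCC X) : Set X :=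
  {x | x ∉ γ.img ∧ ¬ γ.NullhomologousIn {x}ᶜ}

/-- The first singular homology of `B` vanishes: every loop in `B` is nullhomologous
(via the Hurewicz isomorphism on each path component). -/
def H1Trivial (B : Type*) [TopologicalSpace B] : Prop :=
  ∀ (x : B) (p : Path x x), loopClassH1 p = 1

/-! ### Rectifiable connectedness and the induced path metric -/

/-- `g` is a path from `x` to `y` (parametrized by `[0,1]`) inside `E`. -/
def IsPathIn {X : Type*} [TopologicalSpace X] (E : Set X) (g : ℝ → X) (x y : X) : Prop :=
  ContinuousOn g (Icc 0 1) ∧ g 0 = x ∧ g 1 = y ∧ MapsTo g (Icc 0 1) E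

/-- `E` is rectifiably connected: any two of its points are joined by a rectifiable
(finite length) path in `E`. -/
def RectConnected {X : Type*} [MetricSpace X] (E : Set X) : Prop :=
  ∀ x ∈ E, ∀ y ∈ E, ∃ g : ℝ → X, IsPathIn E g x y ∧ eVariationOn g (Icc 0 1) ≠ ⊤

/-- The induced path metric on `E`: the infimum of the lengths of rectifiable paths in `E`
joining the two points. -/
def pathDistIn {X : Type*} [MetricSpace X] (E : Set X) (x y : X) : ℝ :=
  (⨅ g : {g : ℝ → X // IsPathIn E g x y}, eVariationOn g.1 (Icc 0 1)).toReal


universe u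
/-! ### Conical neighborhoods -/


/-- The distance function of the `κ`-cone (κ ≤ 0) over a space with distance function `dL`:
a point is a pair (radius, link point), all points of radius `0` being identified (the cone
point); the distance is given by the law of cosines in curvature `κ`, with angle
`min π (dL ℓ ℓ')`. -/
def coneDist (κ : ℝ) {L : Type*} (dL : L → L → ℝ) (a b : ℝ × L) : ℝ :=
  if κ = 0 then
    Real.sqrt (a.1 ^ 2 + b.1 ^ 2 - 2 * a.1 * b.1 * Real.cos (min Real.pi (dL a.2 b.2)))
  else
    (1 / Real.sqrt (-κ)) *
      arcosh (Real.cosh (Real.sqrt (-κ) * a.1) * Real.cosh (Real.sqrt (-κ) * b.1) -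
        Real.sinh (Real.sqrt (-κ) * a.1) * Real.sinh (Real.sqrt (-κ) * b.1) *
          Real.cos (min Real.pi (dL a.2 b.2)))

/-- `V` is a conical neighborhood of `p` in `X`: an open neighborhood of `p` isometric to a
convex open subset of the `κ`-cone over a metric space (the link of `p`), the isometry taking
`p` to the cone point. -/
def IsConicalNbhd (κ : ℝ) (p : X) (V : Set X) : Prop :=
  IsOpen V ∧ p ∈ V ∧
    ∃ (L : Type u) (dL : L → L → ℝ) (f : X → ℝ × L),
      (∀ a, dL a a = 0) ∧ (∀ a b, 0 ≤ dL a b) ∧ (∀ a b, dL a b = dL b a) ∧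
      (∀ a b c, dL a c ≤ dL a b + dL b c) ∧
      (∀ x ∈ V, 0 ≤ (f x).1) ∧ (f p).1 = 0 ∧
      (∀ x ∈ V, ∀ y ∈ V, dist x y = coneDist κ dL (f x) (f y)) ∧
      (∀ x ∈ V, (f x).1 = 0 → x = p) ∧
      ConvexWrtIn (coneDist κ dL) {w : ℝ × L | 0 ≤ w.1} (f '' V) ∧
      (∀ z ∈ f '' V, ∃ ε > 0, ∀ w : ℝ × L, 0 ≤ w.1 → coneDist κ dL z w < ε → w ∈ f '' V)

/-! ### Geodesics, triangles, and limit segments in `Y = (E, induced path metric)` -/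

/-- The set `α` is (the image of) a geodesic arc of `Y = (E, pathDistIn E)`. -/
def IsYGeodesicArc (E : Set X) (α : Set X) : Prop :=
  ∃ (f : ℝ → X) (a b : ℝ), IsGeodesicWrt (pathDistIn E) f a b ∧
    MapsTo f (Icc a b) E ∧ f '' Icc a b = α

/-- `T` is a geodesic triangle of `Y = (E, pathDistIn E)` with vertices `p`, `q`, `r`:
the union of the three `Y`-geodesics joining the vertices. -/
def IsYTriangle (E : Set X) (T : Set X) (p q r : X) : Prop :=
  p ∈ E ∧ q ∈ E ∧ r ∈ E ∧
    T = geodSeg (pathDistIn E) E p q ∪ geodSeg (pathDistIn E) E q r ∪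
        geodSeg (pathDistIn E) E r p

/-- The set `γim` (a curve in `E`) is locally geodesic in `Y` at `p`: some subarc of `γim`
containing `p` in its relative interior is a geodesic of `Y`. -/
def LocallyYGeodesicAt (E γim : Set X) (p : X) : Prop :=
  ∃ (f : ℝ → X) (a b t : ℝ), t ∈ Ioo a b ∧ f t = p ∧
    IsGeodesicWrt (pathDistIn E) f a b ∧ MapsTo f (Icc a b) E ∧ f '' Icc a b ⊆ γim

/-- `f : [0,1] → E` is the constant-speed parametrization of the `Y`-geodesic
from `x` to `y`. -/
def IsConstSpeedYGeodesic (E : Set X) (f : ℝ → X) (x y : X) : Prop :=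
  f 0 = x ∧ f 1 = y ∧ MapsTo f (Icc 0 1) E ∧
    ∀ s ∈ Icc (0:ℝ) 1, ∀ t ∈ Icc (0:ℝ) 1,
      pathDistIn E (f s) (f t) = pathDistIn E x y * |s - t|

/-- `R` is the limit segment of length `ε` at `p` of the `Y`-geodesic side from `p` to `q`:
`R` is an `X`-geodesic of length `ε` issuing from `p`, and the `X`-geodesics of length `ε`
from `p` through `σ t` (σ the `Y`-geodesic from `p` to `q`) converge uniformly to `R`
as `t → 0⁺`. -/
def IsLimitSegment (E : Set X) (p q : X) (ε : ℝ) (R : ℝ → X) : Prop :=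
  0 < ε ∧ R 0 = p ∧ IsGeodesicWrt (fun x y : X => dist x y) R 0 ε ∧
    ∀ σ : ℝ → X, IsGeodesicFromTo (pathDistIn E) E σ p q →
      ∀ δ > 0, ∃ t₀ > 0, ∀ t, 0 < t → t ≤ t₀ → t ≤ pathDistIn E p q →
        ∀ g : ℝ → X, IsGeodesicWrt (fun x y : X => dist x y) g 0 ε → g 0 = p →
          g (dist p (σ t)) = σ t → ∀ s ∈ Icc 0 ε, dist (g s) (R s) ≤ δ


end Cat2Cx

end

noncomputable section

set_option linter.unusedSectionVars false

namespace Cat2Cx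

section

/-! ### From the angle condition to the CAT(0) inequality -/

/-- `cosh` is a convex function of the square of its argument. -/
lemma cosh_le_chord {a b c l : ℝ} (hl0 : 0 ≤ l) (hl1 : l ≤ 1)
    (h : c ^ 2 = (1 - l) * a ^ 2 + l * b ^ 2) :
    Real.cosh c ≤ (1 - l) * Real.cosh a + l * Real.cosh b := by
  refine hasSum_le (fun n => ?_) (Real.hasSum_cosh c)
    (((Real.hasSum_cosh a).mul_left (1 - l)).add ((Real.hasSum_cosh b).mul_left l))
  have h1 := (convexOn_pow (𝕜 := ℝ) n).2 (show a ^ 2 ∈ Ici 0 from sq_nonneg a)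
    (show b ^ 2 ∈ Ici 0 from sq_nonneg b) (show 0 ≤ 1 - l by linarith) hl0 (by ring)
  simp only [smul_eq_mul] at h1
  rw [← h] at h1
  have h2 : (0 : ℝ) < ((2 * n).factorial : ℝ) := by positivity
  rw [pow_mul, pow_mul, pow_mul, ← mul_div_assoc, ← mul_div_assoc, ← add_div]
  exact div_le_div_of_nonneg_right h1 h2.le

lemma eucl_ratio_le_hyp_ratio {a b c : ℝ} (ha : 0 < a) (hb : 0 < b)
    (h1 : |a - b| ≤ c) (h2 : c ≤ a + b) :
    (a ^ 2 + b ^ 2 - c ^ 2) / (2 * a * b) ≤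
      (Real.cosh a * Real.cosh b - Real.cosh c) / (Real.sinh a * Real.sinh b) := by
  have hab : 0 < a * b := mul_pos ha hb
  have hc : 0 ≤ c := le_trans (abs_nonneg _) h1
  have hsq1 : (a - b) ^ 2 ≤ c ^ 2 := by
    rw [← sq_abs (a - b)]; gcongr
  have hsq2 : c ^ 2 ≤ (a + b) ^ 2 := by gcongr
  have hl0 : 0 ≤ (c ^ 2 - (a - b) ^ 2) / (4 * (a * b)) := by
    apply div_nonneg <;> linarith
  have hl1 : (c ^ 2 - (a - b) ^ 2) / (4 * (a * b)) ≤ 1 := by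
    rw [div_le_one (by linarith)]; nlinarith
  have key := cosh_le_chord (a := a - b) (b := a + b) (c := c) hl0 hl1 (by field_simp; ring)
  have hsa : 0 < Real.sinh a := Real.sinh_pos_iff.2 ha
  have hsb : 0 < Real.sinh b := Real.sinh_pos_iff.2 hb
  rw [le_div_iff₀ (mul_pos hsa hsb)]
  rw [Real.cosh_sub, Real.cosh_add] at key
  have e : (a ^ 2 + b ^ 2 - c ^ 2) / (2 * a * b) =
      1 - 2 * ((c ^ 2 - (a - b) ^ 2) / (4 * (a * b))) := by
    field_simp; ring
  rw [e]
  nlinarith [key]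

lemma compAngle_le_euclCompAngle {κ a b c : ℝ} (hκ : κ ≤ 0) (ha : 0 < a) (hb : 0 < b)
    (h1 : |a - b| ≤ c) (h2 : c ≤ a + b) : compAngle κ a b c ≤ euclCompAngle a b c := by
  unfold compAngle
  split_ifs with h
  · exact le_rfl
  · have hk : 0 < Real.sqrt (-κ) := Real.sqrt_pos.2 (by
      rcases lt_or_eq_of_le hκ with h' | h'
      · linarith
      · exact absurd h' h)
    set k := Real.sqrt (-κ)
    have := eucl_ratio_le_hyp_ratio (a := k * a) (b := k * b) (c := k * c) (by positivity)
      (by positivity) (by rw [← mul_sub, abs_mul, abs_of_pos hk]; gcongr)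
      (by rw [← mul_add]; gcongr)
    refine Real.arccos_le_arccos (le_trans (le_of_eq ?_) this)
    field_simp

lemma exists_bound_of_upperAngle_le {Z : Type*} {d : Z → Z → ℝ} {p : Z} {σ τ : ℝ → Z} {A η : ℝ}
    (h : upperAngleWrt d p σ τ ≤ A) (hη : 0 < η) :
    ∃ ε > 0, ∀ s t : ℝ, 0 < s → s < ε → 0 < t → t < ε →
      euclCompAngle (d p (σ s)) (d p (τ t)) (d (σ s) (τ t)) ≤ A + η := by
  have hlt : upperAngleWrt d p σ τ < A + η := by linarith
  unfold upperAngleWrt at hlt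
  obtain ⟨a, ⟨ε, hε, rfl⟩, hlt'⟩ := exists_lt_of_csInf_lt (by exact ⟨_, 1, one_pos, rfl⟩) hlt
  refine ⟨ε, hε, fun s t hs hs' ht ht' => le_trans (le_csSup ?_ ?_) hlt'.le⟩
  · refine ⟨Real.pi, ?_⟩
    rintro b ⟨s, t, -, -, -, -, rfl⟩
    exact Real.arccos_le_pi _
  · exact ⟨s, t, hs, hs', ht, ht', rfl⟩

lemma sq_le_of_euclCompAngle_le {s t d θ : ℝ} (hs : 0 < s) (ht : 0 < t) (hd : d ≤ s + t)
    (hd0 : 0 ≤ d) (h : euclCompAngle s t d ≤ θ) :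
    d ^ 2 ≤ s ^ 2 + t ^ 2 - 2 * s * t * Real.cos (min θ Real.pi) := by
  have h1 : euclCompAngle s t d ≤ min θ Real.pi := le_min h (Real.arccos_le_pi _)
  have h2 := Real.cos_le_cos_of_nonneg_of_le_pi (Real.arccos_nonneg _) (min_le_right _ _) h1
  have hst : 0 < 2 * s * t := by positivity
  have h3 : Real.cos (min θ Real.pi) ≤ (s ^ 2 + t ^ 2 - d ^ 2) / (2 * s * t) := by
    refine h2.trans ?_
    change Real.cos (Real.arccos _) ≤ _
    rcases le_total ((s ^ 2 + t ^ 2 - d ^ 2) / (2 * s * t)) 1 with h4 | h4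
    · rw [Real.cos_arccos _ h4]
      rw [le_div_iff₀ hst]; nlinarith
    · rw [Real.arccos_of_one_le h4]; simpa using h4
  rw [le_div_iff₀ hst] at h3
  linarith

variable {X : Type*} [MetricSpace X]

/-- Adjacent angles at an interior point of a geodesic add up to at least `π`, in the form of
the cosines of any upper bounds of the angles. -/
lemma cos_add_cos_nonpos {m : X} {σ σ' τ : ℝ → X} {u v x A B : ℝ} (hu : 0 < u) (hv : 0 < v)
    (hx : 0 < x) (hσ : ∀ s, 0 < s → s < u → dist m (σ s) = s)
    (hσ' : ∀ s, 0 < s → s < v → dist m (σ' s) = s) (hτ : ∀ s, 0 < s → s < x → dist m (τ s) = s)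
    (hop : ∀ s, 0 < s → s < u → s < v → dist (σ s) (σ' s) = 2 * s)
    (hAπ : A ≤ Real.pi) (hBπ : B ≤ Real.pi)
    (hA : upperAngleWrt (fun x y : X => dist x y) m σ τ ≤ A)
    (hB : upperAngleWrt (fun x y : X => dist x y) m σ' τ ≤ B) :
    Real.cos A + Real.cos B ≤ 0 := by
  by_contra hcon
  push Not at hcon
  have hcont : Continuous fun η : ℝ =>
      Real.cos (min (A + η) Real.pi) + Real.cos (min (B + η) Real.pi) := by fun_prop
  have h0 : 0 < Real.cos (min (A + 0) Real.pi) + Real.cos (min (B + 0) Real.pi) := by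
    simpa [hAπ, hBπ] using hcon
  have hev : ∀ᶠ η in nhds (0 : ℝ),
      0 < Real.cos (min (A + η) Real.pi) + Real.cos (min (B + η) Real.pi) :=
    hcont.continuousAt.eventually (lt_mem_nhds h0)
  obtain ⟨δ, hδ, hδ'⟩ := Metric.eventually_nhds_iff.1 hev
  have hpos := hδ' (y := δ / 2) (by simp [abs_of_pos hδ]; linarith)
  obtain ⟨ε₁, hε₁, H₁⟩ := exists_bound_of_upperAngle_le hA (half_pos hδ)
  obtain ⟨ε₂, hε₂, H₂⟩ := exists_bound_of_upperAngle_le hB (half_pos hδ)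
  set p := Real.cos (min (A + δ / 2) Real.pi)
  set q := Real.cos (min (B + δ / 2) Real.pi)
  obtain ⟨s, hs0, hs⟩ := exists_between (show 0 < min (min ε₁ ε₂) (min u v) by
    simp [hε₁, hε₂, hu, hv])
  obtain ⟨t, ht0, ht⟩ := exists_between (show 0 < min (min ε₁ ε₂) (min x (s * (p + q))) by
    simp [hε₁, hε₂, hx, mul_pos hs0 hpos])
  simp only [lt_min_iff] at hs ht
  obtain ⟨⟨hs1, hs2⟩, hsu, hsv⟩ := hs
  obtain ⟨⟨ht1, ht2⟩, htx, htp⟩ := ht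
  have e1 := hσ s hs0 hsu
  have e2 := hσ' s hs0 hsv
  have e3 := hτ t ht0 htx
  have e4 := hop s hs0 hsu hsv
  have k1 := H₁ s t hs0 hs1 ht0 ht1
  have k2 := H₂ s t hs0 hs2 ht0 ht2
  simp only [e1, e2, e3] at k1 k2
  have l1 := sq_le_of_euclCompAngle_le hs0 ht0 (by
    have := dist_triangle (σ s) m (τ t); rw [dist_comm (σ s) m] at this; linarith) dist_nonneg k1
  have l2 := sq_le_of_euclCompAngle_le hs0 ht0 (by
    have := dist_triangle (σ' s) m (τ t); rw [dist_comm (σ' s) m] at this; linarith) dist_nonneg k2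
  have tri := dist_triangle (σ s) (τ t) (σ' s)
  rw [dist_comm (τ t), e4] at tri
  set a := dist (σ s) (τ t)
  set b := dist (σ' s) (τ t)
  have m1 : t * t < t * (s * (p + q)) := by gcongr
  nlinarith [sq_nonneg (a - s), sq_nonneg (b - s)]

/-- A geodesic metric space whose geodesics satisfy the CAT(0) inequality of Bruhat and Tits. -/
class Cat0 (X : Type*) [MetricSpace X] : Prop where
  exists_geodesic : ∀ q r : X, ∃ f : ℝ → X, f 0 = q ∧ f 1 = r ∧
    (∀ s ∈ Icc (0 : ℝ) 1, ∀ t ∈ Icc (0 : ℝ) 1, dist (f s) (f t) = |s - t| * dist q r) ∧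
    ∀ p, ∀ t ∈ Icc (0 : ℝ) 1, dist p (f t) ^ 2 ≤
      (1 - t) * dist p q ^ 2 + t * dist p r ^ 2 - t * (1 - t) * dist q r ^ 2

lemma cos_euclCompAngle {a b c : ℝ} (ha : 0 < a) (hb : 0 < b) (h1 : |a - b| ≤ c)
    (h2 : c ≤ a + b) : Real.cos (euclCompAngle a b c) = (a ^ 2 + b ^ 2 - c ^ 2) / (2 * a * b) := by
  have hc : 0 ≤ c := le_trans (abs_nonneg _) h1
  have hsq1 : (a - b) ^ 2 ≤ c ^ 2 := by
    rw [← sq_abs (a - b)]; gcongr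
  have hsq2 : c ^ 2 ≤ (a + b) ^ 2 := by gcongr
  apply Real.cos_arccos
  · rw [le_div_iff₀ (by positivity)]; nlinarith
  · rw [div_le_one (by positivity)]; nlinarith

lemma IsCATSpace.cat0 {κ : ℝ} (hκ : κ ≤ 0) (hX : IsCATSpace κ X) : Cat0 X := by
  obtain ⟨hgeo, hang⟩ := hX
  refine ⟨fun q r => ?_⟩
  obtain ⟨f, f0, f1, ⟨-, hf⟩, -⟩ := hgeo q trivial r trivial
  simp only at f1 hf
  set D := dist q r with hD
  have hD0 : 0 ≤ D := dist_nonneg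
  have hmem : ∀ s ∈ Icc (0 : ℝ) 1, D * s ∈ Icc 0 D := fun s hs =>
    ⟨mul_nonneg hD0 hs.1, mul_le_of_le_one_right hD0 hs.2⟩
  have hiso : ∀ s ∈ Icc (0 : ℝ) 1, ∀ t ∈ Icc (0 : ℝ) 1,
      dist (f (D * s)) (f (D * t)) = |s - t| * D := by
    intro s hs t ht
    have := hf _ (hmem s hs) _ (hmem t ht)
    rw [this, ← mul_sub, abs_mul, abs_of_nonneg hD0, mul_comm]
  refine ⟨fun s => f (D * s), by simpa using f0, by simpa using f1, hiso, ?_⟩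
  intro p t ht
  simp only
  have e1 : dist (f (D * t)) q = t * D := by
    have := hiso t ht 0 (by simp)
    simpa [f0, abs_of_nonneg ht.1] using this
  have e2 : dist (f (D * t)) r = (1 - t) * D := by
    have := hiso t ht 1 (by simp)
    simp only [mul_one, f1] at this
    rw [this, abs_sub_comm, abs_of_nonneg (by linarith [ht.2])]
  set m := f (D * t) with hm
  have degenerate : ∀ z, p = z → (z = m ∨ z = q ∨ z = r) → dist p m ^ 2 ≤
      (1 - t) * dist p q ^ 2 + t * dist p r ^ 2 - t * (1 - t) * D ^ 2 := by
    rintro z rfl (h | h | h)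
    · rw [h, e1, e2, dist_self]; nlinarith
    · rw [h, dist_comm, e1, dist_self, ← hD]; nlinarith
    · rw [h, dist_comm, e2, dist_self, dist_comm, ← hD]; nlinarith
  by_cases hpm : p = m
  · exact degenerate _ hpm (by simp)
  by_cases hpq : p = q
  · exact degenerate _ hpq (by simp)
  by_cases hpr : p = r
  · exact degenerate _ hpr (by simp)
  by_cases hmq : m = q
  · rw [hmq] at e1 ⊢
    rw [dist_self] at e1
    rcases mul_eq_zero.1 e1.symm with h | h
    · simp [h]
    · have : q = r := dist_eq_zero.1 h
      rw [h, ← this]; nlinarith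
  by_cases hmr : m = r
  · rw [hmr] at e2 ⊢
    rw [dist_self] at e2
    rcases mul_eq_zero.1 e2.symm with h | h
    · rw [show t = 1 by linarith]; simp
    · have : q = r := dist_eq_zero.1 h
      rw [h, ← this]; nlinarith
  have hu : 0 < t * D := by rw [← e1]; exact dist_pos.2 hmq
  have hv : 0 < (1 - t) * D := by rw [← e2]; exact dist_pos.2 hmr
  have hDpos : 0 < D := by nlinarith [ht.1, ht.2]
  have hqr : q ≠ r := dist_pos.1 hDpos
  obtain ⟨τ, τ0, τ1, hτ, -⟩ := hgeo m trivial p trivial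
  have hx : 0 < dist m p := dist_pos.2 (Ne.symm hpm)
  have hτ' : ∀ s, 0 < s → s < dist m p → dist m (τ s) = s := by
    intro s hs hs'
    have := hτ.2 0 ⟨le_rfl, hx.le⟩ s ⟨hs.le, hs'.le⟩
    simp only [τ0] at this
    rw [this, zero_sub, abs_neg, abs_of_pos hs]
  have hfm : ∀ s ∈ Icc 0 D, ∀ s' ∈ Icc 0 D, dist (f s) (f s') = |s - s'| := hf
  have htD : D * t ∈ Icc 0 D := hmem t ht
  have gσ : IsGeodesicFromTo (fun x y : X => dist x y) univ (fun s => f (D * t - s)) m q := by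
    refine ⟨by simp [hm], ?_, ⟨by positivity, ?_⟩, fun _ _ => trivial⟩
    · simp only [e1]; rw [show D * t - t * D = 0 by ring, f0]
    · intro s hs s' hs'
      simp only [e1] at hs hs' ⊢
      rw [hfm _ ⟨by nlinarith [hs.2], by nlinarith [hs.1, htD.2]⟩ _
        ⟨by nlinarith [hs'.2], by nlinarith [hs'.1, htD.2]⟩, abs_sub_comm]
      congr 1; ring
  have gσ' : IsGeodesicFromTo (fun x y : X => dist x y) univ (fun s => f (D * t + s)) m r := by
    refine ⟨by simp [hm], ?_, ⟨by positivity, ?_⟩, fun _ _ => trivial⟩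
    · simp only [e2]; rw [show D * t + (1 - t) * D = D by ring, f1]
    · intro s hs s' hs'
      simp only [e2] at hs hs' ⊢
      rw [hfm _ ⟨by nlinarith [hs.1, htD.1], by nlinarith [hs.2, htD.2]⟩ _
        ⟨by nlinarith [hs'.1, htD.1], by nlinarith [hs'.2, htD.2]⟩]
      congr 1; ring
  have A := hang m trivial q trivial p trivial hmq (Ne.symm hpm) (Ne.symm hpq) _ _ gσ
    ⟨τ0, τ1, hτ, fun _ _ => trivial⟩
  have B := hang m trivial r trivial p trivial hmr (Ne.symm hpm) (Ne.symm hpr) _ _ gσ'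
    ⟨τ0, τ1, hτ, fun _ _ => trivial⟩
  have tq1 : |dist m q - dist m p| ≤ dist q p := by
    rw [dist_comm m, dist_comm m]; exact abs_dist_sub_le _ _ _
  have tq2 : dist q p ≤ dist m q + dist m p := by
    rw [dist_comm m q]; exact dist_triangle _ _ _
  have tr1 : |dist m r - dist m p| ≤ dist r p := by
    rw [dist_comm m, dist_comm m]; exact abs_dist_sub_le _ _ _
  have tr2 : dist r p ≤ dist m r + dist m p := by
    rw [dist_comm m r]; exact dist_triangle _ _ _
  have A' := A.trans (compAngle_le_euclCompAngle hκ (dist_pos.2 hmq) hx tq1 tq2)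
  have B' := B.trans (compAngle_le_euclCompAngle hκ (dist_pos.2 hmr) hx tr1 tr2)
  have key := cos_add_cos_nonpos hu hv hx
    (fun s hs hs' => by
      have := gσ.2.2.1.2 0 (by simp) s ⟨hs.le, by simpa [e1] using hs'.le⟩
      simpa [abs_of_pos hs] using this)
    (fun s hs hs' => by
      have := gσ'.2.2.1.2 0 (by simp) s ⟨hs.le, by simpa [e2] using hs'.le⟩
      simpa [abs_of_pos hs] using this)
    hτ'
    (fun s hs hsu hsv => by
      rw [hfm _ ⟨by nlinarith, by nlinarith⟩ _ ⟨by nlinarith, by nlinarith⟩,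
        show D * t - s - (D * t + s) = -(2 * s) by ring, abs_neg, abs_of_pos (by linarith)])
    (Real.arccos_le_pi _) (Real.arccos_le_pi _) A' B'
  change Real.cos (euclCompAngle _ _ _) + Real.cos (euclCompAngle _ _ _) ≤ 0 at key
  rw [cos_euclCompAngle (dist_pos.2 hmq) hx tq1 tq2, cos_euclCompAngle (dist_pos.2 hmr) hx tr1 tr2,
    e1, e2, div_add_div _ _ (by positivity) (by positivity), dist_comm m p, dist_comm q p,
    dist_comm r p] at key
  rw [dist_comm m p] at hx
  have hden : 0 < 2 * (t * D) * dist p m * (2 * ((1 - t) * D) * dist p m) := by positivity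
  rw [div_le_iff₀ hden, zero_mul] at key
  have key2 : (2 * D * dist p m * D) * ((1 - t) * ((t * D) ^ 2 + dist p m ^ 2 - dist p q ^ 2) +
      t * (((1 - t) * D) ^ 2 + dist p m ^ 2 - dist p r ^ 2)) ≤ 0 := by
    nlinarith [key]
  have key3 := nonpos_of_mul_nonpos_right key2 (by positivity)
  nlinarith [key3]

end

section

/-! ### Geodesics of a CAT(0) space -/

section Cat0

variable {X : Type*} [MetricSpace X] [Cat0 X]

/-- The point at fraction `t` (clamped to `[0,1]`) of the geodesic from `q` to `r`. -/
def G (q r : X) (t : ℝ) : X :=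
  (Cat0.exists_geodesic q r).choose (projIcc (0 : ℝ) 1 zero_le_one t)

lemma G_eq_choose (q r : X) {t : ℝ} (ht : t ∈ Icc (0 : ℝ) 1) :
    G q r t = (Cat0.exists_geodesic q r).choose t := by
  rw [G, projIcc_of_mem _ ht]

@[simp] lemma G_zero (q r : X) : G q r 0 = q := by
  rw [G_eq_choose _ _ (by simp)]; exact (Cat0.exists_geodesic q r).choose_spec.1

@[simp] lemma G_one (q r : X) : G q r 1 = r := by
  rw [G_eq_choose _ _ (by simp)]; exact (Cat0.exists_geodesic q r).choose_spec.2.1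

lemma dist_G_G (q r : X) {s t : ℝ} (hs : s ∈ Icc (0 : ℝ) 1) (ht : t ∈ Icc (0 : ℝ) 1) :
    dist (G q r s) (G q r t) = |s - t| * dist q r := by
  rw [G_eq_choose _ _ hs, G_eq_choose _ _ ht]
  exact (Cat0.exists_geodesic q r).choose_spec.2.2.1 s hs t ht

lemma dist_left_G (q r : X) {t : ℝ} (ht : t ∈ Icc (0 : ℝ) 1) :
    dist q (G q r t) = t * dist q r := by
  have := dist_G_G q r (s := 0) (by simp) ht
  simpa [abs_of_nonneg ht.1] using this

lemma dist_G_right (q r : X) {t : ℝ} (ht : t ∈ Icc (0 : ℝ) 1) :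
    dist (G q r t) r = (1 - t) * dist q r := by
  have := dist_G_G q r ht (t := 1) (by simp)
  rwa [G_one, abs_sub_comm, abs_of_nonneg (by linarith [ht.2])] at this

lemma dist_G_sq_le (p q r : X) {t : ℝ} (ht : t ∈ Icc (0 : ℝ) 1) :
    dist p (G q r t) ^ 2 ≤
      (1 - t) * dist p q ^ 2 + t * dist p r ^ 2 - t * (1 - t) * dist q r ^ 2 := by
  rw [G_eq_choose _ _ ht]
  exact (Cat0.exists_geodesic q r).choose_spec.2.2.2 p t ht

lemma eq_G {q r m : X} {t : ℝ} (ht : t ∈ Icc (0 : ℝ) 1) (h1 : dist q m ≤ t * dist q r)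
    (h2 : dist m r ≤ (1 - t) * dist q r) : m = G q r t := by
  have h := dist_G_sq_le m q r ht
  have ht1 : 0 ≤ 1 - t := by linarith [ht.2]
  have k1 : dist m q ^ 2 ≤ (t * dist q r) ^ 2 := by
    rw [dist_comm]; gcongr
  have k2 : dist m r ^ 2 ≤ ((1 - t) * dist q r) ^ 2 := by gcongr
  have l1 := mul_le_mul_of_nonneg_left k1 ht1
  have l2 := mul_le_mul_of_nonneg_left k2 ht.1
  have : dist m (G q r t) ^ 2 ≤ 0 := by nlinarith
  have h0 : dist m (G q r t) = 0 := pow_eq_zero_iff (two_ne_zero) |>.1 (le_antisymm this (sq_nonneg _))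
  exact dist_eq_zero.1 h0

lemma G_symm (q r : X) {t : ℝ} (ht : t ∈ Icc (0 : ℝ) 1) : G q r t = G r q (1 - t) := by
  refine eq_G ⟨by linarith [ht.2], by linarith [ht.1]⟩ ?_ ?_
  · rw [dist_comm, dist_G_right _ _ ht, dist_comm q r]
  · rw [dist_comm, dist_left_G _ _ ht, dist_comm q r]; simp

@[simp] lemma G_self (q : X) (t : ℝ) : G q q t = q := by
  have h := dist_left_G q q (t := projIcc (0 : ℝ) 1 zero_le_one t) (Subtype.coe_prop _)
  rw [dist_self, mul_zero] at h
  have h2 := (dist_eq_zero.1 h).symm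
  rw [G, projIcc_of_mem _ (Subtype.coe_prop _)] at h2
  exact h2

lemma dist_G_le_left (p q r : X) {s : ℝ} (hs : s ∈ Icc (0 : ℝ) 1) :
    dist (G p q s) (G p r s) ≤ s * dist q r := by
  have h1 := dist_G_sq_le (G p q s) p r hs
  have h2 := dist_G_sq_le r p q hs
  rw [dist_comm (G p q s) p, dist_left_G _ _ hs, dist_comm (G p q s) r] at h1
  have hs1 : 0 ≤ 1 - s := by linarith [hs.2]
  have h3 := mul_le_mul_of_nonneg_left h2 hs.1
  rw [dist_comm r p, dist_comm r q] at h3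
  refine abs_le_of_sq_le_sq' ?_ (mul_nonneg hs.1 dist_nonneg) |>.2
  nlinarith

lemma dist_G_le (p p' q q' : X) {s : ℝ} (hs : s ∈ Icc (0 : ℝ) 1) :
    dist (G p q s) (G p' q' s) ≤ (1 - s) * dist p p' + s * dist q q' := by
  have h1 := dist_G_le_left p q q' hs
  have hs' : 1 - s ∈ Icc (0 : ℝ) 1 := ⟨by linarith [hs.2], by linarith [hs.1]⟩
  have h2 := dist_G_le_left q' p p' hs'
  rw [← G_symm p q' hs, ← G_symm p' q' hs] at h2
  linarith [dist_triangle (G p q s) (G p q' s) (G p' q' s)]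

lemma continuous_G : Continuous fun x : X × X × ℝ => G x.1 x.2.1 x.2.2 := by
  rw [continuous_iff_continuousAt]
  rintro ⟨p, q, t⟩
  rw [ContinuousAt, tendsto_iff_dist_tendsto_zero]
  have key : ∀ x : X × X × ℝ, dist (G x.1 x.2.1 x.2.2) (G p q t) ≤
      dist x.1 p + dist x.2.1 q + |(projIcc (0 : ℝ) 1 zero_le_one x.2.2 : ℝ) -
        projIcc (0 : ℝ) 1 zero_le_one t| * dist p q := by
    intro x
    set s := (projIcc (0 : ℝ) 1 zero_le_one x.2.2) with hs
    set t' := (projIcc (0 : ℝ) 1 zero_le_one t) with ht'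
    have e1 : G x.1 x.2.1 x.2.2 = G x.1 x.2.1 s := by rw [G, G, projIcc_val]
    have e2 : G p q t = G p q t' := by rw [G, G, projIcc_val]
    rw [e1, e2, ← dist_G_G p q s.2 t'.2]
    have h1 := dist_G_le x.1 p x.2.1 q s.2
    have h2 := dist_triangle (G x.1 x.2.1 s) (G p q s) (G p q t')
    have h3 : (1 - (s : ℝ)) * dist x.1 p ≤ dist x.1 p :=
      mul_le_of_le_one_left dist_nonneg (by linarith [s.2.1])
    have h4 : (s : ℝ) * dist x.2.1 q ≤ dist x.2.1 q :=
      mul_le_of_le_one_left dist_nonneg s.2.2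
    linarith
  have hc : Continuous fun x : X × X × ℝ => dist x.1 p + dist x.2.1 q +
      |(projIcc (0 : ℝ) 1 zero_le_one x.2.2 : ℝ) - projIcc (0 : ℝ) 1 zero_le_one t| * dist p q := by
    have : Continuous fun x : X × X × ℝ => (projIcc (0 : ℝ) 1 zero_le_one x.2.2 : ℝ) :=
      continuous_subtype_val.comp (continuous_projIcc.comp (by fun_prop))
    fun_prop
  have hc0 := hc.tendsto (p, q, t)
  simp only [dist_self, sub_self, abs_zero, zero_mul, add_zero] at hc0
  exact squeeze_zero (fun _ => dist_nonneg) key hc0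

lemma continuous_G_comp {T : Type*} [TopologicalSpace T] {a b : T → X} {c : T → ℝ}
    (ha : Continuous a) (hb : Continuous b) (hc : Continuous c) :
    Continuous fun t => G (a t) (b t) (c t) :=
  continuous_G.comp (ha.prodMk (hb.prodMk hc))

/-- The geodesic segment between two points, described by the betweenness relation. -/
def Seg (q r : X) : Set X := {m | dist q m + dist m r = dist q r}

lemma mem_Seg {q r m : X} : m ∈ Seg q r ↔ dist q m + dist m r = dist q r := Iff.rfl

lemma G_mem_Seg (q r : X) {t : ℝ} (ht : t ∈ Icc (0 : ℝ) 1) : G q r t ∈ Seg q r := by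
  rw [mem_Seg, dist_left_G _ _ ht, dist_G_right _ _ ht]; ring

lemma Seg_comm (q r : X) : Seg q r = Seg r q := by
  ext m
  rw [mem_Seg, mem_Seg, dist_comm q m, dist_comm m r, dist_comm q r, add_comm]

lemma left_mem_Seg (q r : X) : q ∈ Seg q r := by simp [mem_Seg]

lemma right_mem_Seg (q r : X) : r ∈ Seg q r := by simp [mem_Seg]

lemma eq_G_of_mem_Seg {q r m : X} (hm : m ∈ Seg q r) (hqr : q ≠ r) :
    dist q m / dist q r ∈ Icc (0 : ℝ) 1 ∧ m = G q r (dist q m / dist q r) := by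
  have hD : 0 < dist q r := dist_pos.2 hqr
  rw [mem_Seg] at hm
  have h : dist q m / dist q r ∈ Icc (0 : ℝ) 1 :=
    ⟨by positivity, by rw [div_le_one hD]; linarith [dist_nonneg (x := m) (y := r)]⟩
  refine ⟨h, eq_G h ?_ ?_⟩
  · rw [div_mul_cancel₀ _ hD.ne']
  · rw [sub_mul, div_mul_cancel₀ _ hD.ne']; linarith

lemma Seg_eq_image (q r : X) : Seg q r = G q r '' Icc 0 1 := by
  ext m
  constructor
  · intro hm
    by_cases hqr : q = r
    · subst hqr
      rw [mem_Seg, dist_self] at hm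
      refine ⟨0, by simp, ?_⟩
      rw [G_zero]
      exact dist_eq_zero.1 (by linarith [dist_nonneg (x := q) (y := m), dist_nonneg (x := m) (y := q)])
    · exact ⟨_, (eq_G_of_mem_Seg hm hqr).1, (eq_G_of_mem_Seg hm hqr).2.symm⟩
  · rintro ⟨t, ht, rfl⟩
    exact G_mem_Seg q r ht

lemma Seg_self (q : X) : Seg q q = {q} := by
  rw [Seg_eq_image]
  simp

lemma continuous_G_param (q r : X) : Continuous (G q r) :=
  continuous_G_comp continuous_const continuous_const continuous_id

lemma isCompact_Seg (q r : X) : IsCompact (Seg q r) := by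
  rw [Seg_eq_image]
  exact isCompact_Icc.image (continuous_G_param q r)

lemma isPreconnected_Seg (q r : X) : IsPreconnected (Seg q r) := by
  rw [Seg_eq_image]
  exact isPreconnected_Icc.image _ (continuous_G_param q r).continuousOn

/-- Two points of a segment at the same distance from its origin coincide. -/
lemma eq_of_mem_Seg_of_dist_eq {q r m m' : X} (hm : m ∈ Seg q r) (hm' : m' ∈ Seg q r)
    (h : dist q m = dist q m') : m = m' := by
  by_cases hqr : q = r
  · subst hqr
    rw [Seg_self] at hm hm'
    rw [hm, hm']
  · rw [(eq_G_of_mem_Seg hm hqr).2, (eq_G_of_mem_Seg hm' hqr).2, h]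

lemma Seg_trans {q r m m' : X} (hm : m ∈ Seg q r) (hm' : m' ∈ Seg q m) :
    m' ∈ Seg q r ∧ m ∈ Seg m' r := by
  simp only [mem_Seg] at *
  have h1 := dist_triangle q m' r
  have h2 := dist_triangle m' m r
  constructor <;> linarith

lemma Seg_subset_left {q r m : X} (hm : m ∈ Seg q r) : Seg q m ⊆ Seg q r :=
  fun _ h => (Seg_trans hm h).1

lemma Seg_subset_right {q r m : X} (hm : m ∈ Seg q r) : Seg m r ⊆ Seg q r := by
  rw [Seg_comm m r, Seg_comm q r] at *
  exact Seg_subset_left hm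

lemma mem_Seg_of_dist_le {q r m m' : X} (hm : m ∈ Seg q r) (hm' : m' ∈ Seg q r)
    (h : dist q m' ≤ dist q m) : m' ∈ Seg q m := by
  by_cases hqr : q = r
  · subst hqr
    rw [Seg_self] at hm hm'
    rw [hm, hm']; exact left_mem_Seg _ _
  · have k := eq_G_of_mem_Seg hm hqr
    have k' := eq_G_of_mem_Seg hm' hqr
    have hd : dist m' m = dist q m - dist q m' := by
      have hD : 0 < dist q r := dist_pos.2 hqr
      conv_lhs => rw [k.2, k'.2]
      rw [dist_G_G _ _ k'.1 k.1, ← sub_div, abs_div, abs_of_pos hD, div_mul_cancel₀ _ hD.ne',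
        abs_sub_comm, abs_of_nonneg (by linarith)]
    rw [mem_Seg, hd]; ring

lemma Seg_subset_of_mem {q r m m' : X} (hm : m ∈ Seg q r) (hm' : m' ∈ Seg q r) :
    Seg m m' ⊆ Seg q r := by
  rcases le_total (dist q m') (dist q m) with h | h
  · have h1 := mem_Seg_of_dist_le hm hm' h
    have := Seg_subset_right h1
    rw [Seg_comm]
    exact this.trans (Seg_subset_left hm)
  · have h1 := mem_Seg_of_dist_le hm' hm h
    exact (Seg_subset_right h1).trans (Seg_subset_left hm')

lemma dist_le_of_mem_Seg {p q r m : X} {R : ℝ} (hm : m ∈ Seg q r) (hq : dist p q ≤ R)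
    (hr : dist p r ≤ R) : dist p m ≤ R := by
  rw [Seg_eq_image] at hm
  obtain ⟨t, ht, rfl⟩ := hm
  have h := dist_G_sq_le p q r ht
  have ht1 : 0 ≤ 1 - t := by linarith [ht.2]
  have hR : 0 ≤ R := dist_nonneg.trans hq
  have k1 : dist p q ^ 2 ≤ R ^ 2 := by gcongr
  have k2 : dist p r ^ 2 ≤ R ^ 2 := by gcongr
  have l1 := mul_le_mul_of_nonneg_left k1 ht1
  have l2 := mul_le_mul_of_nonneg_left k2 ht.1
  have l3 : 0 ≤ t * (1 - t) * dist q r ^ 2 := mul_nonneg (mul_nonneg ht.1 ht1) (sq_nonneg _)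
  exact abs_le_of_sq_le_sq' (by nlinarith) hR |>.2

lemma Seg_subset_closedBall {p q r : X} {R : ℝ} (hq : q ∈ closedBall p R)
    (hr : r ∈ closedBall p R) : Seg q r ⊆ closedBall p R := by
  intro m hm
  rw [mem_closedBall'] at *
  exact dist_le_of_mem_Seg hm hq hr

lemma Seg_subset_ball {p q r : X} {R : ℝ} (hq : q ∈ ball p R) (hr : r ∈ ball p R) :
    Seg q r ⊆ ball p R := by
  intro m hm
  rw [mem_ball'] at *
  exact (dist_le_of_mem_Seg hm (le_max_left _ _) (le_max_right _ _)).trans_lt (max_lt hq hr)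

lemma mem_Seg_extend {w u u' v : X} (hu' : u' ∈ Seg w u) (hne : u' ≠ w) (hw : w ∈ Seg u' v) :
    w ∈ Seg u v := by
  have hwu : w ≠ u := by
    rintro rfl
    rw [Seg_self] at hu'
    exact hne hu'
  obtain ⟨ht, e⟩ := eq_G_of_mem_Seg hu' hwu
  have h := dist_G_sq_le v w u ht
  rw [← e] at h
  have hA : 0 < dist w u := dist_pos.2 hwu
  have ha : 0 < dist w u' := dist_pos.2 (Ne.symm hne)
  rw [mem_Seg] at hw ⊢
  rw [dist_comm v u', ← hw, dist_comm u' w] at h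
  set t := dist w u' / dist w u with htd
  have hta : t * dist w u = dist w u' := div_mul_cancel₀ _ hA.ne'
  have ht0 : 0 < t := by positivity
  rw [← hta, dist_comm v w, dist_comm v u] at h
  have h2 : t * (dist w u + dist w v) ^ 2 ≤ t * dist u v ^ 2 := by nlinarith
  have h3 := le_of_mul_le_mul_left h2 ht0
  have h4 := abs_le_of_sq_le_sq' h3 dist_nonneg |>.2
  rw [dist_comm u w]
  exact le_antisymm h4 (by simpa [dist_comm u w] using dist_triangle u w v)

/-- Local geodesics are geodesics, for paths made of two segments. -/
lemma mem_Seg_of_local {w u u' v v' : X} (hu' : u' ∈ Seg w u) (hune : u' ≠ w)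
    (hv' : v' ∈ Seg w v) (hvne : v' ≠ w) (hw : w ∈ Seg u' v') : w ∈ Seg u v := by
  have h1 := mem_Seg_extend hu' hune hw
  rw [Seg_comm] at h1 ⊢
  exact mem_Seg_extend hv' hvne h1

/-- The retraction onto the closed ball of radius `ρ` about `o` along geodesics. -/
def clamp (o : X) (ρ : ℝ) (x : X) : X := G o x (ρ / max ρ (dist o x))

section clamp

variable {o x : X} {ρ : ℝ}

lemma clamp_frac_mem (hρ : 0 < ρ) : ρ / max ρ (dist o x) ∈ Icc (0 : ℝ) 1 :=
  ⟨by positivity, (div_le_one (lt_max_of_lt_left hρ)).2 (le_max_left _ _)⟩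

lemma continuous_clamp (hρ : 0 < ρ) : Continuous (clamp o ρ) := by
  refine continuous_G_comp continuous_const continuous_id (continuous_const.div (by fun_prop) fun x => ?_)
  exact (lt_max_of_lt_left hρ).ne'

lemma clamp_mem_Seg (hρ : 0 < ρ) : clamp o ρ x ∈ Seg o x := G_mem_Seg _ _ (clamp_frac_mem hρ)

lemma clamp_of_dist_le (hρ : 0 < ρ) (h : dist o x ≤ ρ) : clamp o ρ x = x := by
  rw [clamp, max_eq_left h, div_self hρ.ne', G_one]

lemma dist_clamp (hρ : 0 < ρ) : dist o (clamp o ρ x) = min ρ (dist o x) := by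
  rw [clamp, dist_left_G _ _ (clamp_frac_mem hρ)]
  rcases le_total (dist o x) ρ with h | h
  · rw [max_eq_left h, min_eq_right h, div_self hρ.ne', one_mul]
  · rw [max_eq_right h, min_eq_left h, div_mul_cancel₀]
    linarith

lemma dist_clamp_le (hρ : 0 < ρ) : dist o (clamp o ρ x) ≤ ρ := by
  rw [dist_clamp hρ]; exact min_le_left _ _

lemma clamp_mem_closedBall (hρ : 0 < ρ) : clamp o ρ x ∈ closedBall o ρ := by
  rw [mem_closedBall']; exact dist_clamp_le hρ

lemma clamp_eq_self_iff (hρ : 0 < ρ) : clamp o ρ x = o ↔ x = o := by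
  constructor
  · intro h
    have := dist_clamp (o := o) (x := x) hρ
    rw [h, dist_self] at this
    rcases min_choice ρ (dist o x) with h' | h'
    · linarith
    · rw [h'] at this; exact (dist_eq_zero.1 this.symm).symm
  · rintro rfl
    rw [clamp, G_self]

end clamp

end Cat0

end

section

/-! ### Continuous logarithms -/

section HasLog

variable {T : Type*} [TopologicalSpace T]

/-- The complex-valued function `c` admits a continuous logarithm. -/
def HasLog (c : T → ℂ) : Prop := ∃ L : T → ℂ, Continuous L ∧ ∀ t, c t = Complex.exp (L t)

lemma HasLog.mul {c c' : T → ℂ} (h : HasLog c) (h' : HasLog c') :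
    HasLog fun t => c t * c' t := by
  obtain ⟨L, hL, e⟩ := h
  obtain ⟨L', hL', e'⟩ := h'
  exact ⟨fun t => L t + L' t, hL.add hL', fun t => by simp only [e, e', Complex.exp_add]⟩

lemma HasLog.inv {c : T → ℂ} (h : HasLog c) : HasLog fun t => (c t)⁻¹ := by
  obtain ⟨L, hL, e⟩ := h
  exact ⟨fun t => - L t, hL.neg, fun t => by simp only [e, Complex.exp_neg]⟩

lemma HasLog.ne_zero {c : T → ℂ} (h : HasLog c) (t : T) : c t ≠ 0 := by
  obtain ⟨L, hL, e⟩ := h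
  rw [e]; exact Complex.exp_ne_zero _

lemma HasLog.congr {c c' : T → ℂ} (h : HasLog c) (e : ∀ t, c' t = c t) : HasLog c' := by
  rwa [show c' = c from funext e]

lemma HasLog.of_mul_left {c c' : T → ℂ} (h : HasLog fun t => c t * c' t) (h' : HasLog c) :
    HasLog c' :=
  (h'.inv.mul h).congr fun t => by rw [← mul_assoc, inv_mul_cancel₀ (h'.ne_zero t), one_mul]

lemma hasLog_const {a : ℂ} (ha : a ≠ 0) : HasLog fun _ : T => a :=
  ⟨fun _ => Complex.log a, continuous_const, fun _ => (Complex.exp_log ha).symm⟩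

lemma HasLog.prod {ι : Type*} (s : Finset ι) {c : ι → T → ℂ} (h : ∀ i ∈ s, HasLog (c i)) :
    HasLog fun t => ∏ i ∈ s, c i t := by
  classical
  induction s using Finset.induction_on with
  | empty => simpa using hasLog_const (T := T) one_ne_zero
  | insert a s ha ih =>
    refine ((h a (by simp)).mul (ih fun i hi => h i (by simp [hi]))).congr fun t => ?_
    rw [Finset.prod_insert ha]

lemma HasLog.pow {c : T → ℂ} (h : HasLog c) (n : ℕ) : HasLog fun t => c t ^ n := by
  obtain ⟨L, hL, e⟩ := h
  exact ⟨fun t => n * L t, by fun_prop, fun t => by simp only [e, Complex.exp_nat_mul]⟩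

lemma HasLog.conj {c : T → ℂ} (h : HasLog c) : HasLog fun t => (starRingEnd ℂ) (c t) := by
  obtain ⟨L, hL, e⟩ := h
  exact ⟨fun t => (starRingEnd ℂ) (L t), Complex.continuous_conj.comp hL,
    fun t => by simp only [e, Complex.exp_conj]⟩

lemma hasLog_of_slitPlane {c : T → ℂ} (hc : Continuous c) (h : ∀ t, c t ∈ Complex.slitPlane) :
    HasLog c := by
  refine ⟨fun t => Complex.log (c t), ?_, fun t =>
    (Complex.exp_log (Complex.slitPlane_ne_zero (h t))).symm⟩
  exact hc.clog h

lemma hasLog_of_im_nonneg {c : T → ℂ} (hc : Continuous c) (h0 : ∀ t, c t ≠ 0)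
    (h : ∀ t, 0 ≤ (c t).im) : HasLog c := by
  have h1 : HasLog fun t => -Complex.I * c t := by
    refine hasLog_of_slitPlane (by fun_prop) fun t => ?_
    rw [Complex.mem_slitPlane_iff]
    simp only [neg_mul, Complex.neg_re, Complex.mul_re, Complex.I_re, zero_mul, Complex.I_im,
      one_mul, zero_sub, neg_neg, Complex.neg_im, Complex.mul_im, zero_add, ne_eq, neg_eq_zero]
    rcases (h t).lt_or_eq with h' | h'
    · exact Or.inl h'
    · right
      intro h2
      exact h0 t (Complex.ext h2 h'.symm)
  exact h1.of_mul_left (hasLog_const (by simp))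

lemma hasLog_of_im_nonpos {c : T → ℂ} (hc : Continuous c) (h0 : ∀ t, c t ≠ 0)
    (h : ∀ t, (c t).im ≤ 0) : HasLog c := by
  have := (hasLog_of_im_nonneg (c := fun t => (starRingEnd ℂ) (c t))
    (Complex.continuous_conj.comp hc) (fun t => by simpa using h0 t) (by simpa using h)).conj
  exact this.congr fun t => by simp

lemma ratio_mem_slitPlane {a b : ℂ} (h : ‖b - a‖ < ‖a‖) : b / a ∈ Complex.slitPlane := by
  have ha : a ≠ 0 := by
    rintro rfl; simp at h
    exact absurd h (not_lt.2 (norm_nonneg _))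
  refine Complex.ball_one_subset_slitPlane ?_
  rw [mem_ball, dist_eq_norm, show b / a - 1 = (b - a) / a by field_simp, norm_div,
    div_lt_one (norm_pos_iff.2 ha)]
  exact h

/-- A version of Rouché's theorem. -/
lemma hasLog_iff_of_near {c c' : T → ℂ} (hc : Continuous c) (hc' : Continuous c')
    (h : ∀ t, ‖c' t - c t‖ < ‖c t‖) : HasLog c ↔ HasLog c' := by
  have h0 : ∀ t, c t ≠ 0 := by
    intro t ht
    have := h t
    rw [ht, norm_zero] at this
    exact absurd this (not_lt.2 (norm_nonneg _))
  have hr : HasLog fun t => c' t / c t :=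
    hasLog_of_slitPlane (hc'.div hc h0) fun t => ratio_mem_slitPlane (h t)
  constructor
  · intro k
    refine (k.mul hr).congr fun t => ?_
    rw [mul_div_cancel₀ _ (h0 t)]
  · intro k
    have hk : HasLog fun t => (c' t / c t) * c t :=
      k.congr fun t => by rw [div_mul_cancel₀ _ (h0 t)]
    exact hk.of_mul_left hr

lemma hasLog_iff_of_homotopy [CompactSpace T] {S : Type*} [TopologicalSpace S]
    [PreconnectedSpace S] {H : S × T → ℂ} (hH : Continuous H) (h0 : ∀ x, H x ≠ 0) (s s' : S) :
    HasLog (fun t => H (s, t)) ↔ HasLog fun t => H (s', t) := by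
  have hloc : IsLocallyConstant fun s : S => HasLog fun t => H (s, t) := by
    rw [IsLocallyConstant.iff_eventually_eq]
    intro s
    have h := isCompact_univ.eventually_forall_of_forall_eventually
      (P := fun s' t => ‖H (s', t) - H (s, t)‖ < ‖H (s, t)‖) (x₀ := s)
      (fun t _ => by
        have c1 : Continuous fun z : S × T => ‖H (z.1, z.2) - H (s, z.2)‖ := by fun_prop
        have c2 : Continuous fun z : S × T => ‖H (s, z.2)‖ := by fun_prop
        exact c1.continuousAt.eventually_lt c2.continuousAt (by simpa using h0 _))
    filter_upwards [h] with s' hs'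
    exact propext (hasLog_iff_of_near (by fun_prop) (by fun_prop)
      (fun t => hs' t trivial)).symm
  have heq := hloc.apply_eq_of_preconnectedSpace s s'
  exact iff_of_eq heq

/-- Homotopy invariance along a real parameter in `[0,1]`. -/
lemma hasLog_iff_of_homotopy_Icc [CompactSpace T] {H : ℝ → T → ℂ}
    (hH : ContinuousOn (fun x : ℝ × T => H x.1 x.2) (Icc 0 1 ×ˢ univ))
    (h0 : ∀ s ∈ Icc (0 : ℝ) 1, ∀ t, H s t ≠ 0) : HasLog (H 0) ↔ HasLog (H 1) := by
  have := hasLog_iff_of_homotopy (T := T) (S := unitInterval) (H := fun x => H x.1 x.2)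
    (hH.comp_continuous (f := fun x : unitInterval × T => ((x.1 : ℝ), x.2)) (by fun_prop)
      fun x => ⟨x.1.2, trivial⟩) (fun x => h0 _ x.1.2 _) 0 1
  simpa using this

end HasLog

/-! ### Logarithms along paths and loops -/

section Loops

lemma hasLog_of_segment {c : unitInterval → ℂ} (hc : Continuous c) (h0 : ∀ t, c t ≠ 0) :
    HasLog c := by
  have := hasLog_iff_of_homotopy (T := unitInterval) (S := unitInterval)
    (H := fun x => c (x.1 * x.2)) (by fun_prop) (fun x => h0 _) 0 1
  simp only [zero_mul, one_mul] at this
  exact this.1 (hasLog_const (h0 _))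

lemma hasLog_of_square {c : unitInterval × unitInterval → ℂ} (hc : Continuous c)
    (h0 : ∀ t, c t ≠ 0) : HasLog c := by
  have := hasLog_iff_of_homotopy (T := unitInterval × unitInterval) (S := unitInterval)
    (H := fun x => c (x.1 * x.2.1, x.1 * x.2.2)) (by fun_prop) (fun x => h0 _) 0 1
  simp only [zero_mul, one_mul] at this
  exact this.1 (hasLog_const (h0 _))

/-- Two logarithms of the same function have the same increments. -/
lemma log_increment_eq {T : Type*} [TopologicalSpace T] [PreconnectedSpace T] {L L' : T → ℂ}
    (hL : Continuous L) (hL' : Continuous L')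
    (h : ∀ t, Complex.exp (L t) = Complex.exp (L' t)) (s t : T) : L s - L t = L' s - L' t := by
  have hdiff : ∀ t, ∃ n : ℤ, L t - L' t = n * (2 * Real.pi * Complex.I) := by
    intro t
    obtain ⟨n, hn⟩ := Complex.exp_eq_exp_iff_exists_int.1 (h t)
    exact ⟨n, by rw [hn]; ring⟩
  choose n hn using hdiff
  have hpi : (2 * Real.pi * Complex.I : ℂ) ≠ 0 := Complex.two_pi_I_ne_zero
  have hcont : Continuous fun t => ((n t : ℤ) : ℝ) := by
    have : (fun t => ((n t : ℤ) : ℝ)) = fun t => ((L t - L' t) / (2 * Real.pi * Complex.I)).re := by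
      funext t
      rw [hn t, mul_div_cancel_right₀ _ hpi]; simp
    rw [this]
    exact Complex.continuous_re.comp ((hL.sub hL').div_const _)
  have hcont' : Continuous n := Int.isClosedEmbedding_coe_real.continuous_iff.2 hcont
  have := (IsLocallyConstant.iff_continuous n).2 hcont' |>.apply_eq_of_preconnectedSpace s t
  have h1 := hn s
  have h2 := hn t
  rw [this] at h1
  linear_combination h1 - h2

variable {B : Type*} [TopologicalSpace B]

/-- The increment of a continuous logarithm of `u` along a path. -/
def logIncr (u : C(B, ℂ)) (h0 : ∀ b, u b ≠ 0) {x y : B} (p : Path x y) : ℂ :=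
  (hasLog_of_segment (c := fun t => u (p t)) (by fun_prop) fun t => h0 _).choose 1 -
    (hasLog_of_segment (c := fun t => u (p t)) (by fun_prop) fun t => h0 _).choose 0

lemma logIncr_eq (u : C(B, ℂ)) (h0 : ∀ b, u b ≠ 0) {x y : B} (p : Path x y)
    {L : unitInterval → ℂ} (hL : Continuous L) (h : ∀ t, u (p t) = Complex.exp (L t)) :
    logIncr u h0 p = L 1 - L 0 := by
  have hs := (hasLog_of_segment (c := fun t => u (p t)) (by fun_prop) fun t => h0 _).choose_spec
  exact log_increment_eq hs.1 hL (fun t => by rw [← hs.2]; exact h t) 1 0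

lemma logIncr_homotopic (u : C(B, ℂ)) (h0 : ∀ b, u b ≠ 0) {x y : B} {p q : Path x y}
    (h : p.Homotopic q) : logIncr u h0 p = logIncr u h0 q := by
  obtain ⟨H⟩ := h
  obtain ⟨L, hL, e⟩ := hasLog_of_square (c := fun z => u (H z)) (by fun_prop) fun t => h0 _
  rw [logIncr_eq u h0 p (L := fun t => L (0, t)) (by fun_prop) fun t => by rw [← e]; simp,
    logIncr_eq u h0 q (L := fun t => L (1, t)) (by fun_prop) fun t => by rw [← e]; simp]
  have e0 := log_increment_eq (T := unitInterval) (L := fun s => L (s, 0)) (L' := fun _ => L (0, 0))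
    (by fun_prop) (by fun_prop) (fun t => by rw [← e, ← e]; simp) 1 0
  have e1 := log_increment_eq (T := unitInterval) (L := fun s => L (s, 1)) (L' := fun _ => L (0, 1))
    (by fun_prop) (by fun_prop) (fun t => by rw [← e, ← e]; simp) 1 0
  simp only [sub_self] at e0 e1
  linear_combination e0 - e1

lemma logIncr_trans (u : C(B, ℂ)) (h0 : ∀ b, u b ≠ 0) {x y z : B} (p : Path x y) (q : Path y z) :
    logIncr u h0 (p.trans q) = logIncr u h0 p + logIncr u h0 q := by
  obtain ⟨L, hL, e⟩ := hasLog_of_segment (c := fun t => u (p.trans q t)) (by fun_prop) fun t => h0 _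
  have h1 : ∀ t : unitInterval, (t : ℝ) / 2 ∈ Icc (0 : ℝ) 1 := fun t =>
    ⟨by linarith [t.2.1], by linarith [t.2.2]⟩
  have h2 : ∀ t : unitInterval, (1 + (t : ℝ)) / 2 ∈ Icc (0 : ℝ) 1 := fun t =>
    ⟨by linarith [t.2.1], by linarith [t.2.2]⟩
  rw [logIncr_eq u h0 (p.trans q) hL e,
    logIncr_eq u h0 p (L := fun t => L ⟨(t : ℝ) / 2, h1 t⟩)
      (hL.comp (by fun_prop)) fun t => ?_,
    logIncr_eq u h0 q (L := fun t => L ⟨(1 + (t : ℝ)) / 2, h2 t⟩)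
      (hL.comp (by fun_prop)) fun t => ?_]
  · have a1 : (⟨((1 : unitInterval) : ℝ) / 2, h1 1⟩ : unitInterval) =
        ⟨(1 + ((0 : unitInterval) : ℝ)) / 2, h2 0⟩ := by
      ext; simp
    have a2 : (⟨((0 : unitInterval) : ℝ) / 2, h1 0⟩ : unitInterval) = 0 := by ext; simp
    have a3 : (⟨(1 + ((1 : unitInterval) : ℝ)) / 2, h2 1⟩ : unitInterval) = 1 := by
      ext; norm_num
    rw [a1, a2, a3]; ring
  · rw [← e]
    simp only [Path.trans_apply]
    split_ifs with hle
    · have ht0 : (t : ℝ) = 0 := by linarith [t.2.1]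
      have e1 : t = 0 := by ext; simpa using ht0
      subst e1
      simp
    · congr 2; ext; simp; ring
  · rw [← e]
    simp only [Path.trans_apply]
    rw [dif_pos (by linarith [t.2.2])]
    congr 2; ext; simp; ring

/-- The total increment of the logarithm of `u` as a homomorphism on the fundamental group. -/
def logIncrHom (u : C(B, ℂ)) (h0 : ∀ b, u b ≠ 0) (x : B) :
    FundamentalGroup B x →* Multiplicative ℂ where
  toFun g := Quotient.lift (fun p : Path x x => Multiplicative.ofAdd (logIncr u h0 p))
    (fun _ _ h => congrArg _ (logIncr_homotopic u h0 h)) (FundamentalGroup.toPath g)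
  map_one' := by
    change Multiplicative.ofAdd (logIncr u h0 (Path.refl x)) = 1
    rw [logIncr_eq u h0 (Path.refl x) (L := fun _ => Complex.log (u x)) continuous_const
      fun t => by rw [Complex.exp_log (h0 _)]; rfl]
    simp
  map_mul' := by
    intro a b
    induction a using Quotient.inductionOn with | _ p
    induction b using Quotient.inductionOn with | _ q
    change Multiplicative.ofAdd (logIncr u h0 (q.trans p)) =
      Multiplicative.ofAdd (logIncr u h0 p) * Multiplicative.ofAdd (logIncr u h0 q)
    rw [logIncr_trans, ← ofAdd_add, add_comm]

lemma logIncr_eq_zero_of_loopClassH1 (u : C(B, ℂ)) (h0 : ∀ b, u b ≠ 0) {x : B} (p : Path x x)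
    (h : loopClassH1 p = 1) : logIncr u h0 p = 0 := by
  have := congrArg (Abelianization.lift (logIncrHom u h0 x)) h
  rw [map_one] at this
  exact Multiplicative.ofAdd.injective this

variable {p : ℝ} [hp : Fact (0 < p)]

lemma AddCircle.exists_coe (y : AddCircle p) : ∃ x ∈ Ico 0 p, (x : AddCircle p) = y := by
  have h := (AddCircle.equivIco p 0 y).2
  exact ⟨_, ⟨h.1, by simpa using h.2⟩, AddCircle.coe_equivIco⟩

lemma hasLog_circle {c : AddCircle p → ℂ} {L : ℝ → ℂ} (hL : ContinuousOn L (Icc 0 p))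
    (h : ∀ t ∈ Icc 0 p, c t = Complex.exp (L t)) (hend : L 0 = L p) : HasLog c := by
  refine ⟨AddCircle.liftIco p 0 L, AddCircle.liftIco_zero_continuous hend hL, fun y => ?_⟩
  obtain ⟨x, hx, rfl⟩ := AddCircle.exists_coe y
  rw [AddCircle.liftIco_zero_coe_apply hx, h x ⟨hx.1, hx.2.le⟩]

/-- In a space with trivial first homology, nonvanishing functions have logarithms along
loops. -/
lemma hasLog_of_H1Trivial (hB : H1Trivial B) (u : C(B, ℂ)) (h0 : ∀ b, u b ≠ 0)
    (J : C(AddCircle p, B)) : HasLog fun t => u (J t) := by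
  have hp0 : (0 : ℝ) < p := hp.out
  let q : Path (J 0) (J 0) :=
    { toFun := fun t => J ((p * (t : ℝ) : ℝ) : AddCircle p)
      continuous_toFun := by
        have : Continuous fun t : unitInterval => ((p * (t : ℝ) : ℝ) : AddCircle p) :=
          (AddCircle.continuous_mk' p).comp (by fun_prop)
        exact J.continuous.comp this
      source' := by simp
      target' := by simp [AddCircle.coe_period] }
  obtain ⟨L, hL, e⟩ := hasLog_of_segment (c := fun t => u (q t)) (by fun_prop) fun t => h0 _
  have hz := logIncr_eq_zero_of_loopClassH1 u h0 q (hB _ q)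
  rw [logIncr_eq u h0 q hL e] at hz
  refine hasLog_circle (L := fun s => L (projIcc 0 1 zero_le_one (s / p))) ?_ ?_ ?_
  · exact (hL.comp (continuous_projIcc.comp (by fun_prop))).continuousOn
  · intro t ht
    have hmem : t / p ∈ Icc (0 : ℝ) 1 := ⟨div_nonneg ht.1 hp0.le, (div_le_one hp0).2 ht.2⟩
    rw [← e, projIcc_of_mem _ hmem]
    change u (J t) = u (J ((p * (t / p) : ℝ) : AddCircle p))
    rw [mul_div_cancel₀ _ hp0.ne']
  · rw [zero_div, div_self hp0.ne', projIcc_left, projIcc_right]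
    exact (sub_eq_zero.1 hz).symm

end Loops

end

section

/-! ### Points around which a closed curve winds -/

section Winds

variable {X : Type*} [MetricSpace X] {T : Type*} [TopologicalSpace T]

/-- Some nonvanishing function on the complement of `z` has no logarithm along `J`. -/
def Winds (J : C(T, X)) (z : X) : Prop :=
  ∃ h : X → ℂ, ContinuousOn h {z}ᶜ ∧ (∀ x, x ≠ z → h x ≠ 0) ∧ ¬ HasLog fun t => h (J t)

lemma not_winds_of_H1Trivial {p : ℝ} [Fact (0 < p)] {J : C(AddCircle p, X)} {E : Set X}
    (hJ : ∀ t, J t ∈ E) (hE : H1Trivial E) {z : X} (hz : z ∉ E) : ¬ Winds J z := by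
  rintro ⟨h, hc, h0, hlog⟩
  have hne : ∀ b : E, (b : X) ≠ z := fun b hb => hz (hb ▸ b.2)
  exact hlog (hasLog_of_H1Trivial hE
    ⟨fun b : E => h b, hc.comp_continuous continuous_subtype_val fun b => hne b⟩
    (fun b => h0 _ (hne b)) ⟨fun t => ⟨J t, hJ t⟩, by fun_prop⟩)

lemma hasLog_iff_of_moving [CompactSpace T] {h : X → ℂ} {z : X} (hc : ContinuousOn h {z}ᶜ)
    (h0 : ∀ x, x ≠ z → h x ≠ 0) {K : ℝ → T → X}
    (hK : ContinuousOn (fun x : ℝ × T => K x.1 x.2) (Icc 0 1 ×ˢ univ))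
    (hKz : ∀ s ∈ Icc (0 : ℝ) 1, ∀ t, K s t ≠ z) :
    HasLog (fun t => h (K 0 t)) ↔ HasLog fun t => h (K 1 t) := by
  refine hasLog_iff_of_homotopy_Icc (H := fun s t => h (K s t)) ?_ fun s hs t => h0 _ (hKz s hs t)
  exact hc.comp hK fun x hx => hKz _ hx.1 _

variable [Cat0 X]

lemma Winds.exists_mem_Seg [CompactSpace T] {J : C(T, X)} {z : X} (h : Winds J z) (o : X) :
    ∃ t, z ∈ Seg o (J t) := by
  obtain ⟨h, hc, h0, hlog⟩ := h
  by_contra hcon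
  push Not at hcon
  refine hlog ?_
  have key := hasLog_iff_of_moving (T := T) hc h0 (K := fun s t => G o (J t) s)
    (continuous_G_comp continuous_const (by fun_prop) (by fun_prop)).continuousOn
    (fun s hs t hst => hcon t (hst ▸ G_mem_Seg o (J t) hs))
  simp only [G_zero, G_one] at key
  refine key.1 ?_
  by_cases hoz : o = z
  · have : IsEmpty T := ⟨fun t => hcon t (hoz ▸ left_mem_Seg _ _)⟩
    exact ⟨fun _ => 0, continuous_const, fun t => this.elim t⟩
  · exact hasLog_const (h0 _ hoz)

lemma hasLog_clamp_iff [CompactSpace T] {J : C(T, X)} {z : X} (hz : z ∉ range J) {h : X → ℂ}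
    (hc : ContinuousOn h {z}ᶜ) (h0 : ∀ x, x ≠ z → h x ≠ 0) {ε : ℝ} (hε : 0 < ε) :
    HasLog (fun t => h (clamp z ε (J t))) ↔ HasLog fun t => h (J t) := by
  have hclc : Continuous (clamp z ε) := continuous_clamp hε
  have key := hasLog_iff_of_moving (T := T) hc h0 (K := fun s t => G (clamp z ε (J t)) (J t) s)
    (continuous_G_comp (by fun_prop) (by fun_prop) (by fun_prop)).continuousOn ?_
  · simpa only [G_zero, G_one] using key
  · intro s hs t hst
    have h1 := G_mem_Seg (clamp z ε (J t)) (J t) hs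
    rw [hst] at h1
    have h2 := clamp_mem_Seg (o := z) (x := J t) hε
    rw [mem_Seg] at h1 h2
    have h3 : dist z (clamp z ε (J t)) = 0 := by
      rw [dist_comm _ z] at h1
      linarith [dist_nonneg (x := z) (y := clamp z ε (J t))]
    have h4 := (clamp_eq_self_iff hε).1 (dist_eq_zero.1 h3).symm
    exact hz ⟨t, h4⟩

/-- If a function `P` vanishing only at `z` and invertible near `z` has a logarithm along `J`,
then `J` does not wind around `z`. -/
lemma not_winds_of_hasLog [CompactSpace T] {J : C(T, X)} {z : X} (hz : z ∉ range J) {P : X → ℂ}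
    (hP : Continuous P) (hPz : ∀ x, P x = 0 ↔ x = z) {ψ : ℂ → X} {r : ℝ} (hr : 0 < r)
    (hψ : ContinuousOn ψ (ball 0 r)) (hψz : ∀ ζ ∈ ball (0 : ℂ) r, ζ ≠ 0 → ψ ζ ≠ z)
    (hψP : ∀ᶠ x in nhds z, ψ (P x) = x) (hlog : HasLog fun t => P (J t)) : ¬ Winds J z := by
  rintro ⟨h, hc, h0, hno⟩
  apply hno
  have hPr : ∀ᶠ x in nhds z, P x ∈ ball (0 : ℂ) r :=
    hP.continuousAt.eventually (by rw [(hPz z).2 rfl]; exact ball_mem_nhds _ hr)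
  obtain ⟨ε₀, hε₀, hε⟩ := Metric.eventually_nhds_iff.1 (hψP.and hPr)
  have hε2 : 0 < ε₀ / 2 := half_pos hε₀
  have hcl : ∀ t, dist (clamp z (ε₀ / 2) (J t)) z < ε₀ := fun t => by
    rw [dist_comm]; linarith [dist_clamp_le (o := z) (x := J t) hε2]
  rw [← hasLog_clamp_iff hz hc h0 hε2]
  rw [← hasLog_clamp_iff hz hP.continuousOn (fun x hx => by rwa [ne_eq, hPz]) hε2] at hlog
  obtain ⟨L, hL, e⟩ := hlog
  set c : ℝ := Real.log (r / 2)
  have hexp : ∀ s ∈ Icc (0 : ℝ) 1, ∀ t,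
      Complex.exp ((1 - s) * L t + s * c) ∈ ball (0 : ℂ) r := by
    intro s hs t
    have h1 : Real.exp (L t).re < r := by
      have := (hε (hcl t)).2
      simp only [e] at this
      rwa [mem_ball_zero_iff, Complex.norm_exp] at this
    have h2 : Real.exp c < r := by
      rw [Real.exp_log (by positivity)]; linarith
    rw [mem_ball_zero_iff, Complex.norm_exp]
    have h3 : (L t).re < Real.log r := by rwa [Real.lt_log_iff_exp_lt hr]
    have h4 : c < Real.log r := by rwa [Real.lt_log_iff_exp_lt hr]
    rw [← Real.lt_log_iff_exp_lt hr]
    have e1 : ((1 - (s : ℂ)) * L t + s * c).re = (1 - s) * (L t).re + s * c := by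
      simp
    rw [e1]
    rcases hs.1.lt_or_eq with h' | h'
    · nlinarith [hs.2]
    · rw [← h']; simpa using h3
  have key := hasLog_iff_of_moving (T := T) hc h0
    (K := fun s t => ψ (Complex.exp ((1 - s) * L t + s * c))) ?_
    (fun s hs t => hψz _ (hexp s hs t) (Complex.exp_ne_zero _))
  · refine (key.2 ?_).congr fun t => ?_
    · simp only [Complex.ofReal_one, sub_self, zero_mul, one_mul, zero_add]
      by_cases hT : Nonempty T
      · obtain ⟨t⟩ := hT
        have := hexp 1 (by simp) t
        simp only [Complex.ofReal_one, sub_self, zero_mul, one_mul, zero_add] at this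
        exact hasLog_const (h0 _ (hψz _ this (Complex.exp_ne_zero _)))
      · exact ⟨fun _ => 0, continuous_const, fun t => (hT ⟨t⟩).elim⟩
    · simp only [Complex.ofReal_zero, sub_zero, zero_mul, one_mul, add_zero]
      rw [← e, (hε (hcl t)).1]
  · exact hψ.comp (by fun_prop) fun x hx => hexp _ hx.1 _

end Winds

end

section

/-! ### The model plane -/

section Model

/-- The time coordinate of a point of the hyperboloid. -/
def tm (u : ℝ × ℝ) : ℝ := Real.sqrt (1 + u.1 ^ 2 + u.2 ^ 2)

/-- The Lorentz product of two points of the hyperboloid. -/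
def bil (u v : ℝ × ℝ) : ℝ := tm u * tm v - u.1 * v.1 - u.2 * v.2

lemma tm_sq (u : ℝ × ℝ) : tm u ^ 2 = 1 + u.1 ^ 2 + u.2 ^ 2 := Real.sq_sqrt (by positivity)

lemma tm_pos (u : ℝ × ℝ) : 0 < tm u := Real.sqrt_pos.2 (by positivity)

lemma eq_tm {u : ℝ × ℝ} {a : ℝ} (ha : 0 ≤ a) (h : a ^ 2 = 1 + u.1 ^ 2 + u.2 ^ 2) : a = tm u := by
  rw [tm, ← h, Real.sqrt_sq ha]

@[fun_prop]
lemma continuous_tm : Continuous tm := by unfold tm; fun_prop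

lemma one_le_bil (u v : ℝ × ℝ) : 1 ≤ bil u v := by
  have h1 := tm_sq u
  have h2 := tm_sq v
  have h : 1 + u.1 * v.1 + u.2 * v.2 ≤ tm u * tm v := by
    refine abs_le_of_sq_le_sq' ?_ (by positivity [tm_pos u, tm_pos v]) |>.2
    rw [mul_pow, h1, h2]
    nlinarith [sq_nonneg (u.1 - v.1), sq_nonneg (u.2 - v.2), sq_nonneg (u.1 * v.2 - u.2 * v.1)]
  unfold bil; linarith

lemma cosh_arcosh {x : ℝ} (hx : 1 ≤ x) : Real.cosh (arcosh x) = x := by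
  have h1 : 0 ≤ x ^ 2 - 1 := by nlinarith
  have h2 : 0 < x + Real.sqrt (x ^ 2 - 1) := by positivity
  have h3 := Real.sq_sqrt h1
  rw [arcosh, Real.cosh_eq, Real.exp_neg, Real.exp_log h2]
  field_simp
  nlinarith

lemma arcosh_nonneg {x : ℝ} (hx : 1 ≤ x) : 0 ≤ arcosh x :=
  Real.log_nonneg (by linarith [Real.sqrt_nonneg (x ^ 2 - 1)])

variable {κ : ℝ}

lemma sqrt_neg_pos (hκ : κ < 0) : 0 < Real.sqrt (-κ) := Real.sqrt_pos.2 (by linarith)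

lemma mDist_of_neg (hκ : κ < 0) (u v : ℝ × ℝ) :
    mDist κ u v = (1 / Real.sqrt (-κ)) * arcosh (bil u v) := by
  rw [mDist, if_neg hκ.ne]; rfl

lemma mDist_nonneg (hκ : κ ≤ 0) (u v : ℝ × ℝ) : 0 ≤ mDist κ u v := by
  rcases hκ.lt_or_eq with h | h
  · rw [mDist_of_neg h]
    exact mul_nonneg (by positivity) (arcosh_nonneg (one_le_bil _ _))
  · rw [mDist, if_pos h]; positivity

lemma cosh_mDist (hκ : κ < 0) (u v : ℝ × ℝ) :
    Real.cosh (Real.sqrt (-κ) * mDist κ u v) = bil u v := by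
  rw [mDist_of_neg hκ, ← mul_assoc, mul_one_div_cancel (sqrt_neg_pos hκ).ne', one_mul,
    cosh_arcosh (one_le_bil _ _)]

lemma mDist_eq_of_cosh (hκ : κ < 0) {u v : ℝ × ℝ} {d : ℝ} (hd : 0 ≤ d)
    (h : Real.cosh (Real.sqrt (-κ) * d) = bil u v) : mDist κ u v = d := by
  have hk := sqrt_neg_pos hκ
  rw [← cosh_mDist hκ] at h
  have h1 := Real.cosh_injOn (x₁ := Real.sqrt (-κ) * d) (x₂ := Real.sqrt (-κ) * mDist κ u v)
    (by simp; positivity) (by simp; exact mul_nonneg hk.le (mDist_nonneg hκ.le _ _)) h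
  exact (mul_left_cancel₀ hk.ne' h1).symm

lemma mDist_sq_zero (u v : ℝ × ℝ) : mDist 0 u v ^ 2 = (u.1 - v.1) ^ 2 + (u.2 - v.2) ^ 2 := by
  rw [mDist, if_pos rfl, Real.sq_sqrt (by positivity)]

lemma continuous_mDist : Continuous fun x : (ℝ × ℝ) × (ℝ × ℝ) => mDist κ x.1 x.2 := by
  unfold mDist
  split_ifs with h
  · fun_prop
  · refine continuous_const.mul ?_
    unfold arcosh
    refine Continuous.log (by fun_prop) fun x => ?_
    have := one_le_bil x.1 x.2
    have h2 : 0 < bil x.1 x.2 + Real.sqrt (bil x.1 x.2 ^ 2 - 1) := by positivity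
    exact h2.ne'

/-- The identification of `ℝ²` with the complex plane. -/
def toC (u : ℝ × ℝ) : ℂ := ⟨u.1, u.2⟩

lemma norm_toC_sq (u : ℝ × ℝ) : ‖toC u‖ ^ 2 = u.1 ^ 2 + u.2 ^ 2 := by
  rw [← Complex.normSq_eq_norm_sq, Complex.normSq_apply, toC]; ring

/-- The radial coordinate of curvature `κ` as a function of the distance. -/
def mR (κ d : ℝ) : ℝ := if κ = 0 then d else Real.sinh (Real.sqrt (-κ) * d)

/-- The first coordinate in a frame, in terms of the distances `a`, `b` to the two points at
distance `ρ` of the origin on the first axis. -/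
def mU (κ ρ a b : ℝ) : ℝ :=
  if κ = 0 then (a ^ 2 - b ^ 2) / (4 * ρ)
  else (Real.cosh (Real.sqrt (-κ) * a) - Real.cosh (Real.sqrt (-κ) * b)) /
    (2 * Real.sinh (Real.sqrt (-κ) * ρ))

lemma mR_strictMono (hκ : κ ≤ 0) : StrictMono (mR κ) := by
  unfold mR
  split_ifs with h
  · exact strictMono_id
  · have hk := sqrt_neg_pos (hκ.lt_of_ne h)
    exact Real.sinh_strictMono.comp (strictMono_mul_left_of_pos hk)

@[simp] lemma mR_zero : mR κ 0 = 0 := by unfold mR; split_ifs <;> simp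

@[fun_prop]
lemma continuous_mR : Continuous (mR κ) := by unfold mR; split_ifs <;> fun_prop

lemma mR_pos (hκ : κ ≤ 0) {d : ℝ} (hd : 0 < d) : 0 < mR κ d := by
  have := mR_strictMono hκ hd
  rwa [mR_zero] at this

lemma continuous_mU (ρ : ℝ) : Continuous fun x : ℝ × ℝ => mU κ ρ x.1 x.2 := by
  unfold mU; split_ifs <;> fun_prop

/-- The Lorentz boost taking `w` to the origin. -/
def boost (w v : ℝ × ℝ) : ℝ × ℝ :=
  let c := (w.1 * v.1 + w.2 * v.2) / (1 + tm w) - tm v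
  (v.1 + c * w.1, v.2 + c * w.2)

lemma tm_neg (w : ℝ × ℝ) : tm (-w) = tm w := by simp [tm]

lemma tm_boost (w v : ℝ × ℝ) : tm (boost w v) = bil w v := by
  symm
  refine eq_tm (by linarith [one_le_bil w v]) ?_
  have h1 := tm_sq w
  have h2 := tm_sq v
  have h3 : (1 + tm w) ≠ 0 := by linarith [tm_pos w]
  obtain ⟨c, hc⟩ : ∃ c, c = (w.1 * v.1 + w.2 * v.2) / (1 + tm w) := ⟨_, rfl⟩
  have hc' : c * (1 + tm w) = w.1 * v.1 + w.2 * v.2 := by rw [hc, div_mul_cancel₀ _ h3]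
  simp only [boost, bil, ← hc]
  have h4 : c ^ 2 * (1 + tm w) * (tm w - 1) = c * (tm w - 1) * (w.1 * v.1 + w.2 * v.2) := by
    rw [← hc']; ring
  have h5 : (c + c * tm w) * (c + c * tm w) = (w.1 * v.1 + w.2 * v.2) ^ 2 := by
    rw [← hc']; ring
  have h6 : w.1 ^ 2 + w.2 ^ 2 = tm w ^ 2 - 1 := by linarith
  have e : 1 + (v.1 + (c - tm v) * w.1) ^ 2 + (v.2 + (c - tm v) * w.2) ^ 2 =
      (1 + v.1 ^ 2 + v.2 ^ 2) + 2 * (c - tm v) * (w.1 * v.1 + w.2 * v.2) +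
        (c - tm v) ^ 2 * (w.1 ^ 2 + w.2 ^ 2) := by ring
  rw [e, h6, ← h2, sub_sub, ← hc']
  ring

lemma boost_neg_boost (w v : ℝ × ℝ) : boost (-w) (boost w v) = v := by
  have h1 := tm_sq w
  have h3 : (1 + tm w) ≠ 0 := by linarith [tm_pos w]
  obtain ⟨c, hc⟩ : ∃ c, c = (w.1 * v.1 + w.2 * v.2) / (1 + tm w) := ⟨_, rfl⟩
  have hc' : c * (1 + tm w) = w.1 * v.1 + w.2 * v.2 := by rw [hc, div_mul_cancel₀ _ h3]
  have hb : boost w v = (v.1 + (c - tm v) * w.1, v.2 + (c - tm v) * w.2) := by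
    simp only [boost, hc]
  have key : ((-w).1 * (boost w v).1 + (-w).2 * (boost w v).2) / (1 + tm (-w)) - tm (boost w v)
      = c - tm v := by
    rw [tm_boost, tm_neg, div_sub' h3, div_eq_iff h3, hb, bil]
    simp only [Prod.fst_neg, Prod.snd_neg]
    have e : -w.1 * (v.1 + (c - tm v) * w.1) + -w.2 * (v.2 + (c - tm v) * w.2) =
        -(w.1 * v.1 + w.2 * v.2) - (c - tm v) * (w.1 ^ 2 + w.2 ^ 2) := by ring
    have h6 : w.1 ^ 2 + w.2 ^ 2 = tm w ^ 2 - 1 := by linarith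
    rw [e, h6, sub_sub, ← hc']
    linear_combination (-(1 + tm w)) * hc'
  ext
  · simp only [boost] at key ⊢
    rw [key]
    simp only [Prod.fst_neg]
    rw [← hc]; ring
  · simp only [boost] at key ⊢
    rw [key]
    simp only [Prod.snd_neg]
    rw [← hc]; ring

lemma bil_boost (w u v : ℝ × ℝ) : bil (boost w u) (boost w v) = bil u v := by
  have h1 := tm_sq w
  have h3 : (1 + tm w) ≠ 0 := by linarith [tm_pos w]
  have e : bil (boost w u) (boost w v) = tm (boost w u) * tm (boost w v) -
    (boost w u).1 * (boost w v).1 - (boost w u).2 * (boost w v).2 := rfl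
  rw [e, tm_boost, tm_boost]
  obtain ⟨c, hc⟩ : ∃ c, c = (w.1 * v.1 + w.2 * v.2) / (1 + tm w) := ⟨_, rfl⟩
  have hc' : c * (1 + tm w) = w.1 * v.1 + w.2 * v.2 := by rw [hc, div_mul_cancel₀ _ h3]
  obtain ⟨b, hb⟩ : ∃ b, b = (w.1 * u.1 + w.2 * u.2) / (1 + tm w) := ⟨_, rfl⟩
  have hb' : b * (1 + tm w) = w.1 * u.1 + w.2 * u.2 := by rw [hb, div_mul_cancel₀ _ h3]
  simp only [boost, bil, ← hc, ← hb]
  have h6 : w.1 ^ 2 + w.2 ^ 2 = tm w ^ 2 - 1 := by linarith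
  have e : (tm w * tm u - w.1 * u.1 - w.2 * u.2) * (tm w * tm v - w.1 * v.1 - w.2 * v.2) -
      (u.1 + (b - tm u) * w.1) * (v.1 + (c - tm v) * w.1) -
      (u.2 + (b - tm u) * w.2) * (v.2 + (c - tm v) * w.2) =
      (tm w * tm u - (w.1 * u.1 + w.2 * u.2)) * (tm w * tm v - (w.1 * v.1 + w.2 * v.2)) -
      u.1 * v.1 - u.2 * v.2 - (c - tm v) * (w.1 * u.1 + w.2 * u.2)
      - (b - tm u) * (w.1 * v.1 + w.2 * v.2) - (b - tm u) * (c - tm v) * (w.1 ^ 2 + w.2 ^ 2) := by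
    ring
  rw [e, h6, ← hc', ← hb']
  ring

lemma boost_self (w : ℝ × ℝ) : boost w w = 0 := by
  have h1 := tm_sq w
  have h3 : (1 + tm w) ≠ 0 := by linarith [tm_pos w]
  have : (w.1 * w.1 + w.2 * w.2) / (1 + tm w) - tm w = -1 := by
    rw [div_sub' h3, div_eq_iff h3]; nlinarith
  simp only [boost, this]
  ext <;> simp

lemma continuous_boost (w : ℝ × ℝ) : Continuous (boost w) := by
  unfold boost; fun_prop

/-- The Lorentz boost as a homeomorphism. -/
def boostHomeo (w : ℝ × ℝ) : (ℝ × ℝ) ≃ₜ (ℝ × ℝ) where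
  toFun := boost w
  invFun := boost (-w)
  left_inv := boost_neg_boost w
  right_inv v := by simpa using boost_neg_boost (-w) v
  continuous_toFun := continuous_boost w
  continuous_invFun := continuous_boost (-w)

/-- Every point of the model plane can be moved to the origin. -/
lemma exists_isometry_to_zero (hκ : κ ≤ 0) (p : ℝ × ℝ) : ∃ Φ : (ℝ × ℝ) ≃ₜ (ℝ × ℝ),
    Φ p = 0 ∧ ∀ u v, mDist κ (Φ u) (Φ v) = mDist κ u v := by
  rcases hκ.lt_or_eq with h | h
  · refine ⟨boostHomeo p, boost_self p, fun u v => ?_⟩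
    refine mDist_eq_of_cosh h (mDist_nonneg hκ _ _) ?_
    rw [cosh_mDist h]
    exact (bil_boost p u v).symm
  · refine ⟨Homeomorph.subRight p, by simp, fun u v => ?_⟩
    simp [mDist, h]

/-- The rotation-homothety identification of the plane with `ℂ` by a unit vector. -/
def rotHomeo (a : ℂ) (ha : ‖a‖ = 1) : (ℝ × ℝ) ≃ₜ ℂ :=
  Complex.equivRealProdCLM.symm.toHomeomorph.trans
    (Homeomorph.mulLeft₀ a (norm_ne_zero_iff.1 (by rw [ha]; exact one_ne_zero)))

lemma rotHomeo_apply (a : ℂ) (ha : ‖a‖ = 1) (u : ℝ × ℝ) : rotHomeo a ha u = a * toC u := rfl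

lemma mDist_zero_right (hκ : κ ≤ 0) (u : ℝ × ℝ) : mR κ (mDist κ u 0) = ‖toC u‖ := by
  unfold mR
  split_ifs with h
  · subst h
    rw [← abs_of_nonneg (mDist_nonneg le_rfl u 0), ← abs_of_nonneg (norm_nonneg (toC u)),
      ← sq_eq_sq_iff_abs_eq_abs, mDist_sq_zero, norm_toC_sq]
    simp
  · have hκ' := hκ.lt_of_ne h
    have h1 := cosh_mDist hκ' u 0
    have h2 := Real.cosh_sq (Real.sqrt (-κ) * mDist κ u 0)
    have h3 : 0 ≤ Real.sinh (Real.sqrt (-κ) * mDist κ u 0) :=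
      Real.sinh_nonneg_iff.2 (mul_nonneg (Real.sqrt_nonneg _) (mDist_nonneg hκ _ _))
    rw [← abs_of_nonneg h3, ← abs_of_nonneg (norm_nonneg (toC u)),
      ← sq_eq_sq_iff_abs_eq_abs, norm_toC_sq]
    have h4 : bil u 0 = tm u := by simp [bil, tm]
    rw [h1, h4, tm_sq] at h2
    linarith

/-- The inner product at the origin, in terms of distances. -/
lemma mDist_neg_sub (hκ : κ ≤ 0) {ρ : ℝ} (hρ : 0 < ρ) (q c : ℝ × ℝ) (hc : mDist κ c 0 = ρ) :
    mU κ ρ (mDist κ q (-c)) (mDist κ q c) = (q.1 * c.1 + q.2 * c.2) / mR κ ρ := by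
  unfold mU mR
  split_ifs with h
  · subst h
    rw [mDist_sq_zero, mDist_sq_zero]
    simp only [Prod.fst_neg, Prod.snd_neg]
    field_simp; ring
  · have hκ' := hκ.lt_of_ne h
    rw [cosh_mDist hκ', cosh_mDist hκ']
    have : 0 < Real.sinh (Real.sqrt (-κ) * ρ) :=
      Real.sinh_pos_iff.2 (mul_pos (sqrt_neg_pos hκ') hρ)
    simp only [bil, tm_neg, Prod.fst_neg, Prod.snd_neg]
    field_simp; ring

lemma mDist_antipode (hκ : κ ≤ 0) (c : ℝ × ℝ) : mDist κ c (-c) = 2 * mDist κ c 0 := by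
  rcases hκ.lt_or_eq with h | h
  · refine mDist_eq_of_cosh h (by linarith [mDist_nonneg hκ c 0]) ?_
    rw [mul_left_comm, Real.cosh_two_mul, Real.sinh_sq, cosh_mDist h]
    simp only [bil, tm_neg, Prod.fst_neg, Prod.snd_neg, Prod.fst_zero, Prod.snd_zero]
    have h0 : tm 0 = 1 := by simp [tm]
    rw [h0]
    nlinarith [tm_sq c]
  · subst h
    have h1 := mDist_nonneg le_rfl c (-c)
    have h2 := mDist_nonneg le_rfl c 0
    rw [← abs_of_nonneg h1, ← abs_of_nonneg (show 0 ≤ 2 * mDist 0 c 0 by linarith),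
      ← sq_eq_sq_iff_abs_eq_abs, mul_pow, mDist_sq_zero, mDist_sq_zero]
    simp; ring

/-- The point opposite to `c` with respect to the origin is determined by its distances. -/
lemma eq_neg_of_mDist (hκ : κ ≤ 0) {c c' : ℝ × ℝ} (h0 : mDist κ c' 0 = mDist κ c 0)
    (h : mDist κ c' c = 2 * mDist κ c 0) : c' = -c := by
  have hn : ‖toC c'‖ ^ 2 = ‖toC c‖ ^ 2 := by
    rw [← mDist_zero_right hκ, ← mDist_zero_right hκ, h0]
  rw [norm_toC_sq, norm_toC_sq] at hn
  have hdot : c'.1 * c.1 + c'.2 * c.2 = -(c.1 ^ 2 + c.2 ^ 2) := by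
    have h' : mDist κ c' c = mDist κ c (-c) := by rw [h, mDist_antipode hκ]
    rcases hκ.lt_or_eq with hk | hk
    · have := congrArg (fun x => Real.cosh (Real.sqrt (-κ) * x)) h'
      simp only [cosh_mDist hk] at this
      have e : tm c' = tm c := by
        refine (eq_tm (tm_pos _).le ?_).symm
        rw [tm_sq]; linarith
      simp only [bil, tm_neg, Prod.fst_neg, Prod.snd_neg, e] at this
      linarith
    · subst hk
      have := congrArg (fun x => x ^ 2) h'
      simp only [mDist_sq_zero, Prod.fst_neg, Prod.snd_neg] at this
      linarith
  have hz : (c'.1 + c.1) ^ 2 + (c'.2 + c.2) ^ 2 = 0 := by linear_combination hn + 2 * hdot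
  have h1 : c'.1 + c.1 = 0 := by nlinarith [sq_nonneg (c'.1 + c.1), sq_nonneg (c'.2 + c.2)]
  have h2 : c'.2 + c.2 = 0 := by nlinarith [sq_nonneg (c'.1 + c.1), sq_nonneg (c'.2 + c.2)]
  ext
  · simp; linarith
  · simp; linarith

/-- Polar-type coordinates adapted to a triple `c₋, c₀, c₊` with midpoint `c₀`. -/
lemma exists_frame (hκ : κ ≤ 0) {c₀ c₁ c₂ : ℝ × ℝ} {ρ : ℝ} (hρ : 0 < ρ) (h1 : mDist κ c₁ c₀ = ρ)
    (h2 : mDist κ c₂ c₀ = ρ) (h12 : mDist κ c₁ c₂ = 2 * ρ) : ∃ Θ : (ℝ × ℝ) ≃ₜ ℂ,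
    ∀ q, (Θ q).re = mU κ ρ (mDist κ q c₁) (mDist κ q c₂) ∧ ‖Θ q‖ = mR κ (mDist κ q c₀) := by
  obtain ⟨Φ, hΦ0, hΦ⟩ := exists_isometry_to_zero hκ c₀
  set c := Φ c₂ with hc
  have hcρ : mDist κ c 0 = ρ := by rw [← hΦ0, hΦ, h2]
  have hc1 : Φ c₁ = -c := by
    apply eq_neg_of_mDist hκ
    · rw [hcρ, ← hΦ0, hΦ, h1]
    · rw [hcρ, hΦ, h12]
  have hnc : ‖toC c‖ = mR κ ρ := by rw [← mDist_zero_right hκ, hcρ]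
  have hpos : 0 < mR κ ρ := mR_pos hκ hρ
  have ha : ‖(starRingEnd ℂ) (toC c) / (mR κ ρ : ℂ)‖ = 1 := by
    rw [norm_div, RCLike.norm_conj, hnc, Complex.norm_real, Real.norm_of_nonneg hpos.le,
      div_self hpos.ne']
  refine ⟨Φ.trans (rotHomeo _ ha), fun q => ⟨?_, ?_⟩⟩
  · have e := mDist_neg_sub hκ hρ (Φ q) c hcρ
    rw [← hc1, hΦ, hΦ] at e
    rw [e, Homeomorph.trans_apply, rotHomeo_apply, div_mul_eq_mul_div, Complex.div_ofReal_re]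
    congr 1
    simp only [Complex.mul_re, Complex.conj_re, Complex.conj_im, toC]
    ring
  · rw [Homeomorph.trans_apply, rotHomeo_apply, norm_mul, ha, one_mul, ← mDist_zero_right hκ,
      ← hΦ0, hΦ]

/-- Polar-type coordinates centred at a point. -/
lemma exists_polar (hκ : κ ≤ 0) (c₀ : ℝ × ℝ) : ∃ Θ : (ℝ × ℝ) ≃ₜ ℂ, Θ c₀ = 0 ∧
    (∀ q, ‖Θ q‖ = mR κ (mDist κ q c₀)) ∧
    ∀ ζ, mDist κ (Θ.symm ζ) (Θ.symm (-ζ)) = 2 * mDist κ (Θ.symm ζ) c₀ := by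
  obtain ⟨Φ, hΦ0, hΦ⟩ := exists_isometry_to_zero hκ c₀
  have h1 : ‖(1 : ℂ)‖ = 1 := by simp
  have key : ∀ q, (Φ.trans (rotHomeo 1 h1)) q = toC (Φ q) := fun q => by
    rw [Homeomorph.trans_apply, rotHomeo_apply, one_mul]
  refine ⟨Φ.trans (rotHomeo 1 h1), ?_, fun q => ?_, fun ζ => ?_⟩
  · rw [key, hΦ0]; rfl
  · rw [key, ← mDist_zero_right hκ, ← hΦ0, hΦ]
  · set Θ := Φ.trans (rotHomeo 1 h1)
    have e1 : toC (Φ (Θ.symm ζ)) = ζ := by rw [← key]; exact Θ.apply_symm_apply _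
    have e2 : toC (Φ (Θ.symm (-ζ))) = -ζ := by rw [← key]; exact Θ.apply_symm_apply _
    have e3 : Φ (Θ.symm (-ζ)) = - Φ (Θ.symm ζ) := by
      have e2 := e2.trans (congrArg Neg.neg e1.symm)
      have h3 := congrArg Complex.re e2
      have h4 := congrArg Complex.im e2
      ext
      · simpa [toC] using h3
      · simpa [toC] using h4
    rw [← hΦ, e3, mDist_antipode hκ, ← hΦ (Θ.symm ζ) c₀, hΦ0]

end Model

end

section

/-! ### The projective model -/

section Klein

variable {κ : ℝ}

/-- The projective (Klein) chart of the model plane. -/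
def kl (κ : ℝ) (u : ℝ × ℝ) : ℂ := if κ = 0 then toC u else (tm u)⁻¹ • toC u

lemma isHomeomorph_toC : IsHomeomorph toC := Complex.equivRealProdCLM.symm.toHomeomorph.isHomeomorph

lemma isOpenEmbedding_kl : Topology.IsOpenEmbedding (kl κ) := by
  unfold kl
  split_ifs with h
  · exact isHomeomorph_toC.isOpenEmbedding
  · have h1 := (OpenPartialHomeomorph.univUnitBall (E := ℂ)).isOpenEmbedding rfl
    convert h1.comp isHomeomorph_toC.isOpenEmbedding using 1
    funext u
    simp only [Function.comp_apply, OpenPartialHomeomorph.univUnitBall_apply, norm_toC_sq, tm,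
      add_assoc]

@[simp] lemma mDist_self (hκ : κ ≤ 0) (u : ℝ × ℝ) : mDist κ u u = 0 := by
  rcases hκ.lt_or_eq with h | h
  · refine mDist_eq_of_cosh h le_rfl ?_
    simp only [bil, mul_zero, Real.cosh_zero]
    linarith [tm_sq u]
  · simp [mDist, h]

lemma eq_of_mDist_eq_zero (hκ : κ ≤ 0) {u v : ℝ × ℝ} (h : mDist κ u v = 0) : u = v := by
  obtain ⟨Θ, h0, h1, -⟩ := exists_polar hκ v
  have := h1 u
  rw [h, mR_zero, norm_eq_zero, ← h0] at this
  exact Θ.injective this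

lemma mDist_pos (hκ : κ ≤ 0) {u v : ℝ × ℝ} (h : u ≠ v) : 0 < mDist κ u v :=
  (mDist_nonneg hκ u v).lt_of_ne fun h' => h (eq_of_mDist_eq_zero hκ h'.symm)

lemma mDist_zero_eq (u v : ℝ × ℝ) : mDist 0 u v = dist (toC u) (toC v) := by
  rw [← abs_of_nonneg (mDist_nonneg le_rfl u v), ← abs_of_nonneg (dist_nonneg (x := toC u)),
    ← sq_eq_sq_iff_abs_eq_abs, mDist_sq_zero, dist_eq_norm, ← Complex.normSq_eq_norm_sq,
    Complex.normSq_apply]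
  simp [toC]; ring

/-- A null vector orthogonal to a timelike vector vanishes. -/
lemma eq_zero_of_null_of_orthogonal {T r₁ r₂ x y z : ℝ} (hT : T ^ 2 = 1 + r₁ ^ 2 + r₂ ^ 2)
    (h : x * T = y * r₁ + z * r₂) (h' : x ^ 2 = y ^ 2 + z ^ 2) : x = 0 ∧ y = 0 ∧ z = 0 := by
  have h5 : (x * T) ^ 2 + (y * r₂ - z * r₁) ^ 2 = (y ^ 2 + z ^ 2) * (r₁ ^ 2 + r₂ ^ 2) := by
    rw [h]; ring
  rw [← h', mul_pow, hT] at h5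
  have hx : x ^ 2 = 0 := by nlinarith [sq_nonneg x, sq_nonneg (y * r₂ - z * r₁)]
  refine ⟨by simpa using hx, ?_, ?_⟩ <;> nlinarith [sq_nonneg y, sq_nonneg z]

lemma kl_mem_segment (hκ : κ ≤ 0) {p q r : ℝ × ℝ}
    (h : mDist κ p r + mDist κ r q = mDist κ p q) : kl κ r ∈ segment ℝ (kl κ p) (kl κ q) := by
  rcases hκ.lt_or_eq with hk | hk
  · have ha := mDist_nonneg hκ p r
    have hb := mDist_nonneg hκ r q
    set a := mDist κ p r
    set b := mDist κ r q
    set k := Real.sqrt (-κ)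
    have hkp : 0 < k := sqrt_neg_pos hk
    have e1 : Real.cosh (k * a) = bil p r := cosh_mDist hk p r
    have e2 : Real.cosh (k * b) = bil r q := cosh_mDist hk r q
    have e3 : Real.cosh (k * (a + b)) = bil p q := by rw [h]; exact cosh_mDist hk p q
    rcases (add_nonneg ha hb).eq_or_lt with h0 | h0
    · have : a = 0 := by linarith
      rw [eq_of_mDist_eq_zero hκ this]
      exact left_mem_segment ℝ _ _
    have hα : 0 ≤ Real.sinh (k * a) := Real.sinh_nonneg_iff.2 (by positivity)
    have hβ : 0 ≤ Real.sinh (k * b) := Real.sinh_nonneg_iff.2 (by positivity)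
    have hγ : 0 < Real.sinh (k * (a + b)) := Real.sinh_pos_iff.2 (by positivity)
    rw [mul_add] at hγ e3
    rw [Real.cosh_add] at e3
    rw [Real.sinh_add] at hγ
    have c1 := Real.cosh_sq (k * a)
    have c2 := Real.cosh_sq (k * b)
    set α := Real.sinh (k * a)
    set β := Real.sinh (k * b)
    set ca := Real.cosh (k * a)
    set cb := Real.cosh (k * b)
    have tp := tm_sq p
    have tq := tm_sq q
    have tr := tm_sq r
    obtain ⟨D0, hD0⟩ : ∃ x, x = β * tm p + α * tm q - (α * cb + ca * β) * tm r := ⟨_, rfl⟩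
    obtain ⟨D1, hD1⟩ : ∃ x, x = β * p.1 + α * q.1 - (α * cb + ca * β) * r.1 := ⟨_, rfl⟩
    obtain ⟨D2, hD2⟩ : ∃ x, x = β * p.2 + α * q.2 - (α * cb + ca * β) * r.2 := ⟨_, rfl⟩
    unfold bil at e1 e2 e3
    have hDR : D0 * tm r = D1 * r.1 + D2 * r.2 := by
      rw [hD0, hD1, hD2]
      linear_combination (-β) * e1 - α * e2 - (α * cb + ca * β) * tr
    have hDD : D0 ^ 2 = D1 ^ 2 + D2 ^ 2 := by
      rw [hD0, hD1, hD2]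
      linear_combination β ^ 2 * tp + α ^ 2 * tq + (α * cb + ca * β) ^ 2 * tr
        - 2 * α * β * e3 + 2 * β * (α * cb + ca * β) * e1 + 2 * α * (α * cb + ca * β) * e2
        - β ^ 2 * c1 - α ^ 2 * c2
    obtain ⟨z0, z1, z2⟩ := eq_zero_of_null_of_orthogonal tr hDR hDD
    clear hDR hDD e1 e2 e3 c1 c2 tp tq tr
    have hp := tm_pos p
    have hq := tm_pos q
    have hr := tm_pos r
    set γ := α * cb + ca * β
    have hden : β * tm p + α * tm q = γ * tm r := by linarith
    have hpos : 0 < γ * tm r := by positivity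
    refine ⟨β * tm p / (γ * tm r), α * tm q / (γ * tm r), by positivity, by positivity, ?_, ?_⟩
    · rw [← add_div, hden, div_self hpos.ne']
    · simp only [kl, if_neg hk.ne, smul_smul]
      have i1 : γ * r.1 = β * p.1 + α * q.1 := by linarith
      have i2 : γ * r.2 = β * p.2 + α * q.2 := by linarith
      apply Complex.ext
      · simp only [toC, Complex.add_re, Complex.smul_re, smul_eq_mul]
        field_simp
        linarith
      · simp only [toC, Complex.add_im, Complex.smul_im, smul_eq_mul]
        field_simp
        linarith
  · subst hk
    simp only [mDist_zero_eq, kl, if_true] at h ⊢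
    have := dist_add_dist_eq_iff.1 h
    exact mem_segment_iff_wbtw.2 this

/-- Geodesics of the model plane, in the projective model. -/
lemma exists_model_geodesic (hκ : κ ≤ 0) {p q : ℝ × ℝ} (hpq : p ≠ q) :
    ∃ (m : ℝ → ℝ × ℝ) (w : ℝ → ℝ), IsGeodesicFromTo (mDist κ) univ m p q ∧
      ContinuousOn w (Icc 0 (mDist κ p q)) ∧ w 0 = 0 ∧ w (mDist κ p q) = 1 ∧
      ∀ s ∈ Icc 0 (mDist κ p q), kl κ (m s) = (1 - w s) • kl κ p + w s • kl κ q := by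
  have hD := mDist_pos hκ hpq
  set D := mDist κ p q with hDdef
  rcases hκ.lt_or_eq with hk | hk
  · set k := Real.sqrt (-κ)
    have hkp : 0 < k := sqrt_neg_pos hk
    have hS : 0 < Real.sinh (k * D) := Real.sinh_pos_iff.2 (by positivity)
    have hbil : bil p q = Real.cosh (k * D) := (cosh_mDist hk p q).symm
    have hp := tm_pos p
    have hq := tm_pos q
    have tp := tm_sq p
    have tq := tm_sq q
    let A : ℝ → ℝ := fun s => Real.sinh (k * (D - s)) / Real.sinh (k * D)
    let B : ℝ → ℝ := fun s => Real.sinh (k * s) / Real.sinh (k * D)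
    have hA : ∀ s ∈ Icc 0 D, 0 ≤ A s := fun s hs =>
      div_nonneg (Real.sinh_nonneg_iff.2 (mul_nonneg hkp.le (by linarith [hs.2]))) hS.le
    have hB : ∀ s ∈ Icc 0 D, 0 ≤ B s := fun s hs =>
      div_nonneg (Real.sinh_nonneg_iff.2 (mul_nonneg hkp.le hs.1)) hS.le
    have key : ∀ s t, A s * A t + B s * B t + (A s * B t + B s * A t) * bil p q =
        Real.cosh (k * (s - t)) := by
      intro s t
      simp only [A, B, hbil]
      field_simp
      rw [mul_sub, mul_sub, mul_sub, Real.sinh_sub, Real.sinh_sub, Real.cosh_sub]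
      have c1 := Real.cosh_sq (k * D)
      have c2 := Real.cosh_sq (k * s)
      have c3 := Real.cosh_sq (k * t)
      linear_combination (- Real.cosh (k * s) * Real.cosh (k * t) * 0 -
        Real.sinh (k * s) * Real.sinh (k * t)) * c1
    have hpos : ∀ s ∈ Icc 0 D, 0 < A s * tm p + B s * tm q := by
      intro s hs
      have h1 := hA s hs
      have h2 := hB s hs
      rcases hs.1.eq_or_lt with h | h
      · have : A s = 1 := by simp only [A, ← h, sub_zero]; exact div_self hS.ne'
        rw [this]; positivity
      · have : 0 < B s := div_pos (Real.sinh_pos_iff.2 (by positivity)) hS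
        positivity
    let m : ℝ → ℝ × ℝ := fun s => (A s * p.1 + B s * q.1, A s * p.2 + B s * q.2)
    have hm : ∀ s ∈ Icc 0 D, tm (m s) = A s * tm p + B s * tm q := by
      intro s hs
      refine (eq_tm (hpos s hs).le ?_).symm
      have := key s s
      rw [sub_self, mul_zero, Real.cosh_zero] at this
      simp only [m]
      unfold bil at this
      linear_combination A s ^ 2 * tp + B s ^ 2 * tq + this
    have hbm : ∀ s ∈ Icc 0 D, ∀ t ∈ Icc 0 D, bil (m s) (m t) = Real.cosh (k * (s - t)) := by
      intro s hs t ht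
      rw [← key]
      conv_lhs => rw [bil, hm s hs, hm t ht]
      simp only [m, bil]
      linear_combination A s * A t * tp + B s * B t * tq
    have hA0 : A 0 = 1 := by simp only [A, sub_zero]; exact div_self hS.ne'
    have hB0 : B 0 = 0 := by simp [B]
    have hAD : A D = 0 := by simp [A]
    have hBD : B D = 1 := div_self hS.ne'
    have hm0 : m 0 = p := by simp [m, hA0, hB0]
    have hmD : m D = q := by simp [m, hAD, hBD]
    refine ⟨m, fun s => B s * tm q / (A s * tm p + B s * tm q), ⟨hm0, hmD, ⟨hD.le, ?_⟩,
      fun _ _ => mem_univ _⟩, ?_, ?_, ?_, ?_⟩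
    · intro s hs t ht
      refine mDist_eq_of_cosh hk (abs_nonneg _) ?_
      rw [hbm s hs t ht, ← Real.cosh_abs (k * (s - t)), abs_mul, abs_of_pos hkp]
    · refine ContinuousOn.div ?_ ?_ fun s hs => (hpos s hs).ne'
      · simp only [B]; fun_prop
      · simp only [A, B]; fun_prop
    · simp [hB0]
    · simp only [hBD, hAD]; field_simp; ring
    · intro s hs
      have h1 := hpos s hs
      simp only [kl, if_neg hk.ne, hm s hs]
      apply Complex.ext
      · simp only [m, toC, Complex.add_re, Complex.smul_re, smul_eq_mul]
        field_simp
        ring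
      · simp only [m, toC, Complex.add_im, Complex.smul_im, smul_eq_mul]
        field_simp
        ring
  · subst hk
    let m : ℝ → ℝ × ℝ := fun s => (1 - s / D) • p + (s / D) • q
    have hm : ∀ s, toC (m s) = (1 - s / D) • toC p + (s / D) • toC q := by
      intro s
      apply Complex.ext <;> simp [m, toC]
    refine ⟨m, fun s => s / D, ⟨by simp [m], by simp only [m]; rw [div_self hD.ne']; simp,
      ⟨hD.le, fun s _ t _ => ?_⟩, fun _ _ => mem_univ _⟩, by fun_prop, by simp,
      div_self hD.ne', fun s _ => ?_⟩
    · rw [mDist_zero_eq, hm, hm, dist_eq_norm]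
      have : (1 - s / D) • toC p + (s / D) • toC q - ((1 - t / D) • toC p + (t / D) • toC q) =
          ((s - t) / D) • (toC q - toC p) := by
        rw [sub_div]; module
      rw [this, norm_smul, ← dist_eq_norm, dist_comm, ← mDist_zero_eq, ← hDdef, Real.norm_eq_abs,
        abs_div, abs_of_pos hD, div_mul_cancel₀ _ hD.ne']
    · simp only [kl, if_true]; exact hm s

lemma exists_geodSeg_of_mem_segment (hκ : κ ≤ 0) {p q : ℝ × ℝ} {z : ℂ}
    (hz : z ∈ segment ℝ (kl κ p) (kl κ q)) :
    ∃ r ∈ geodSeg (mDist κ) univ p q, kl κ r = z := by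
  by_cases hpq : p = q
  · subst hpq
    rw [segment_same] at hz
    refine ⟨p, ?_, hz.symm⟩
    refine mem_biUnion (x := fun _ => p) ?_ ⟨0, ?_, rfl⟩
    · refine ⟨rfl, rfl, ⟨mDist_nonneg hκ _ _, fun s hs t ht => ?_⟩, fun _ _ => mem_univ _⟩
      rw [mDist_self hκ] at hs ht ⊢
      have h1 := hs.1; have h2 := hs.2; have h3 := ht.1; have h4 := ht.2
      rw [le_antisymm h2 h1, le_antisymm h4 h3]; simp
    · rw [mDist_self hκ]; simp
  · obtain ⟨m, w, hm, hw, hw0, hw1, h⟩ := exists_model_geodesic hκ hpq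
    obtain ⟨a, b, ha, hb, hab, rfl⟩ := hz
    have hD := mDist_nonneg hκ p q
    have hbm : b ∈ Icc (w 0) (w (mDist κ p q)) := by rw [hw0, hw1]; constructor <;> linarith
    obtain ⟨s, hs, rfl⟩ := intermediate_value_Icc hD hw hbm
    refine ⟨m s, mem_biUnion (x := m) hm ⟨s, hs, rfl⟩, ?_⟩
    rw [h s hs]
    congr 2; linarith

lemma mDist_add_of_mem_geodSeg (hκ : κ ≤ 0) {p q r : ℝ × ℝ}
    (h : r ∈ geodSeg (mDist κ) univ p q) : mDist κ p r + mDist κ r q = mDist κ p q := by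
  simp only [geodSeg, mem_iUnion] at h
  obtain ⟨f, ⟨h0, h1, h2, -⟩, s, hs, rfl⟩ := h
  have hD := mDist_nonneg hκ p q
  have e1 := h2.2 0 (left_mem_Icc.2 hD) s hs
  have e2 := h2.2 s hs _ (right_mem_Icc.2 hD)
  rw [h0] at e1
  rw [h1] at e2
  rw [e1, e2, zero_sub, abs_neg, abs_of_nonneg hs.1, abs_of_nonpos (by linarith [hs.2])]
  ring

lemma convexWrt_convexHullWrt (A : Set (ℝ × ℝ)) :
    ConvexWrt (mDist κ) (convexHullWrt (mDist κ) A) := by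
  intro x hx y hy z hz C hC
  exact hC.1 x (hx C hC) y (hy C hC) hz

lemma IsPolygonalCell.convexWrt {P : Set (ℝ × ℝ)} (hP : IsPolygonalCell κ P) :
    ConvexWrt (mDist κ) P := by
  obtain ⟨F, rfl, -⟩ := hP
  exact convexWrt_convexHullWrt _

lemma IsPolygonalCell.convex_image (hκ : κ ≤ 0) {P : Set (ℝ × ℝ)} (hP : IsPolygonalCell κ P) :
    Convex ℝ (kl κ '' P) := by
  rw [convex_iff_segment_subset]
  rintro _ ⟨p, hp, rfl⟩ _ ⟨q, hq, rfl⟩ z hz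
  obtain ⟨r, hr, rfl⟩ := exists_geodSeg_of_mem_segment hκ hz
  exact ⟨r, hP.convexWrt p hp q hq hr, rfl⟩

lemma IsPolygonalCell.isCompact_image (hκ : κ ≤ 0) {P : Set (ℝ × ℝ)} (hP : IsPolygonalCell κ P) :
    IsCompact (kl κ '' P) := by
  have hc := hP.convex_image hκ
  obtain ⟨F, rfl, -⟩ := hP
  have hF : (F : Set (ℝ × ℝ)) ⊆ convexHullWrt (mDist κ) F := fun x hx C hC => hC.2 hx
  have e : kl κ '' convexHullWrt (mDist κ) F = convexHull ℝ (kl κ '' F) := by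
    refine Subset.antisymm ?_ (convexHull_min (image_mono hF) hc)
    rw [image_subset_iff]
    intro x hx
    refine hx (kl κ ⁻¹' convexHull ℝ (kl κ '' F)) ⟨?_, ?_⟩
    · intro p hp q hq r hr
      exact (convex_convexHull ℝ _).segment_subset hp hq
        (kl_mem_segment hκ (mDist_add_of_mem_geodSeg hκ hr))
    · rw [← image_subset_iff]; exact subset_convexHull ℝ _
  rw [e]
  exact (F.finite_toSet.image _).isCompact_convexHull (𝕜 := ℝ)

end Klein

end

section

/-! ### Planar disc functions -/

section Disc

variable {X : Type*} [MetricSpace X]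

/-- `Φ` is a planar chart on the open set `U`, extended to `X` without new values in `Φ '' U`. -/
structure IsDisc (Φ : X → ℂ) (U : Set X) : Prop where
  cont : Continuous Φ
  isOpen : IsOpen U
  inj : ∀ z ∈ U, ∀ x, Φ x = Φ z → x = z
  openMap : ∀ V ⊆ U, IsOpen V → IsOpen (Φ '' V)

variable [Cat0 X] {T : Type*} [TopologicalSpace T] [CompactSpace T] {J : C(T, X)}
  {Φ : X → ℂ} {U : Set X}

lemma IsDisc.winds_iff (hd : IsDisc Φ U) {z : X} (hz : z ∈ U) (hzJ : z ∉ range J) :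
    Winds J z ↔ ¬ HasLog fun t => Φ (J t) - Φ z := by
  constructor
  · intro hw hlog
    obtain ⟨r, hr, hrU⟩ := Metric.isOpen_iff.1 (hd.openMap U Subset.rfl hd.isOpen) (Φ z) ⟨z, hz, rfl⟩
    have hex : ∀ ζ : ball (0 : ℂ) r, ∃ x ∈ U, Φ x = ζ + Φ z := fun ζ =>
      hrU (by have := ζ.2; rw [mem_ball_zero_iff] at this; simpa [mem_ball, dist_eq_norm] using this)
    choose ψ hψU hψ using hex
    have hψc : Continuous ψ := by
      rw [continuous_iff_continuousAt]
      intro ζ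
      rw [ContinuousAt, Filter.tendsto_def]
      intro s hs
      obtain ⟨V, hVs, hVo, hV⟩ := _root_.mem_nhds_iff.1 hs
      have ho := hd.openMap (V ∩ U) inter_subset_right (hVo.inter hd.isOpen)
      have hc : Continuous fun ζ : ball (0 : ℂ) r => (ζ : ℂ) + Φ z := by fun_prop
      refine Filter.mem_of_superset
        ((ho.preimage hc).mem_nhds ⟨ψ ζ, ⟨hV, hψU ζ⟩, hψ ζ⟩) ?_
      rintro ζ' ⟨x, ⟨hxV, hxU⟩, hx⟩
      have : ψ ζ' = x := hd.inj x hxU _ (by rw [hψ, hx])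
      exact hVs (this ▸ hxV)
    classical
    refine not_winds_of_hasLog hzJ (P := fun x => Φ x - Φ z) (hd.cont.sub continuous_const)
      (fun x => ⟨fun h => hd.inj z hz x (sub_eq_zero.1 h), fun h => by simp [h]⟩)
      (ψ := fun ζ => if h : ζ ∈ ball (0 : ℂ) r then ψ ⟨ζ, h⟩ else z) hr ?_ ?_ ?_ hlog hw
    · rw [continuousOn_iff_continuous_domRestrict]
      convert hψc using 1
      funext ζ
      simp only [domRestrict_apply, ζ.2, dite_true]
    · intro ζ hζ h0 h
      simp only [hζ, dite_true] at h
      have := hψ ⟨ζ, hζ⟩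
      rw [h] at this
      exact h0 (by simpa using this.symm)
    · have h1 : ∀ᶠ x in nhds z, Φ x - Φ z ∈ ball (0 : ℂ) r := by
        have : Tendsto (fun x => Φ x - Φ z) (nhds z) (nhds (Φ z - Φ z)) :=
          (hd.cont.sub continuous_const).tendsto z
        rw [sub_self] at this
        exact this (ball_mem_nhds _ hr)
      filter_upwards [h1, hd.isOpen.mem_nhds hz] with x hx hxU
      simp only [hx, dite_true]
      exact hd.inj x hxU _ (by rw [hψ]; simp)
  · intro h
    exact ⟨fun x => Φ x - Φ z, (hd.cont.sub continuous_const).continuousOn,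
      fun x hx h => hx (hd.inj z hz x (sub_eq_zero.1 h)), h⟩

lemma hasLog_sub_iff {c : T → ℂ} (hc : Continuous c) (h0 : ∀ t, c t ≠ 0) :
    ∃ δ > 0, ∀ a : ℂ, ‖a‖ < δ → (HasLog c ↔ HasLog fun t => c t - a) := by
  rcases isEmpty_or_nonempty T with hT | hT
  · refine ⟨1, one_pos, fun a _ => ?_⟩
    have : c = fun t => c t - a := funext fun t => (IsEmpty.false t).elim
    rw [← this]
  · obtain ⟨t0, -, ht0⟩ := isCompact_univ.exists_isMinOn univ_nonempty hc.norm.continuousOn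
    refine ⟨‖c t0‖, norm_pos_iff.2 (h0 t0), fun a ha => ?_⟩
    refine hasLog_iff_of_near hc (by fun_prop) fun t => ?_
    have := ht0 (mem_univ t)
    simp only [sub_sub_cancel_left, norm_neg]
    exact ha.trans_le this

lemma IsDisc.eventually_winds_iff (hd : IsDisc Φ U) {z : X} (hz : z ∈ U) (hzJ : z ∉ range J) :
    ∀ᶠ z' in nhds z, (Winds J z' ↔ Winds J z) := by
  have hcl : IsClosed (range J) := (isCompact_range J.continuous).isClosed
  have hc : Continuous fun t => Φ (J t) - Φ z :=
    (hd.cont.comp J.continuous).sub continuous_const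
  obtain ⟨δ, hδ, h⟩ := hasLog_sub_iff hc fun t ht =>
    hzJ ⟨t, hd.inj z hz _ (sub_eq_zero.1 ht)⟩
  have h1 : ∀ᶠ x in nhds z, Φ x ∈ ball (Φ z) δ := hd.cont.tendsto z (ball_mem_nhds _ hδ)
  filter_upwards [h1, hd.isOpen.mem_nhds hz, hcl.isOpen_compl.mem_nhds hzJ] with x hx hxU hxJ
  rw [hd.winds_iff hz hzJ, hd.winds_iff hxU hxJ, h (Φ x - Φ z) (by rwa [← dist_eq_norm])]
  simp only [sub_sub_sub_cancel_right]

end Disc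

/-! ### Charts of faces -/

lemma continuous_mDist_left {κ : ℝ} (p : ℝ × ℝ) : Continuous fun q => mDist κ q p := by
  have h : Continuous fun q : ℝ × ℝ => (q, p) := by fun_prop
  have h' := (continuous_mDist (κ := κ)).comp h
  simp only [Function.comp_def] at h'
  exact h'

section Faces

variable {κ : ℝ} {X : Type*} [MetricSpace X]

lemma image_interior_kl (P : Set (ℝ × ℝ)) : interior (kl κ '' P) = kl κ '' interior P := by
  refine Subset.antisymm ?_ (isOpenEmbedding_kl.isOpenMap.image_interior_subset P)
  intro z hz
  obtain ⟨p, hp, rfl⟩ := interior_subset hz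
  refine ⟨p, ?_, rfl⟩
  refine interior_maximal (t := kl κ ⁻¹' interior (kl κ '' P)) ?_
    (isOpen_interior.preimage isOpenEmbedding_kl.continuous) hz
  intro q hq
  obtain ⟨q', hq', h⟩ := interior_subset hq
  exact isOpenEmbedding_kl.injective h ▸ hq'

/-- A metric chart `f` and the corresponding projective chart `kl κ ∘ f` of a convex set `F`. -/
structure FaceChart (κ : ℝ) (F : Set X) (f : X → ℝ × ℝ) : Prop where
  isOpen : IsOpen F
  isom : ∀ x ∈ closure F, ∀ y ∈ closure F, mDist κ (f x) (f y) = dist x y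
  image_interior : f '' F = interior (f '' closure F)
  nonempty : F.Nonempty
  closed : IsClosed ((fun x => kl κ (f x)) '' closure F)
  convex : Convex ℝ ((fun x => kl κ (f x)) '' closure F)
  convexWrt : ConvexWrt (mDist κ) (f '' closure F)

lemma PolyComplex2.exists_faceChart (hκ : κ ≤ 0) (PC : PolyComplex2 κ X) {F : Set X}
    (hF : F ∈ PC.faces) : ∃ f, FaceChart κ F f := by
  obtain ⟨f, P, hP, -, rfl, h2, h3⟩ := PC.face_chart F hF
  refine ⟨f, PC.faces_open F hF, h3, h2, ?_, ?_, ?_, hP.convexWrt⟩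
  · obtain ⟨F0, -, x, hx⟩ := hP
    rw [← h2] at hx
    obtain ⟨y, hy, -⟩ := hx
    exact ⟨y, hy⟩
  · have := (hP.isCompact_image hκ).isClosed
    rwa [image_image] at this
  · have := hP.convex_image hκ
    rwa [image_image] at this

namespace FaceChart

variable {F : Set X} {f : X → ℝ × ℝ} (hκ : κ ≤ 0) (hf : FaceChart κ F f)
include hκ hf

lemma injOn : InjOn f (closure F) := fun x hx y hy h => by
  rw [← dist_eq_zero, ← hf.isom x hx y hy, h, mDist_self hκ]

lemma exists_dist_lt {x : X} (hx : x ∈ closure F) {ε : ℝ} (hε : 0 < ε) :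
    ∃ V, IsOpen V ∧ f x ∈ V ∧ ∀ y ∈ closure F, f y ∈ V → dist y x < ε := by
  refine ⟨{q | mDist κ q (f x) < ε}, ?_, ?_, ?_⟩
  · exact isOpen_lt (continuous_mDist_left (f x)) continuous_const
  · rw [mem_ofPred_eq, mDist_self hκ]; exact hε
  · intro y hy h
    rwa [← hf.isom y hy x hx]

lemma continuousOn : ContinuousOn f (closure F) := by
  intro x hx
  obtain ⟨Θ, h0, h1, -⟩ := exists_polar hκ (f x)
  have hlim : Tendsto (fun y => Θ (f y)) (nhdsWithin x (closure F)) (nhds 0) := by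
    rw [tendsto_zero_iff_norm_tendsto_zero]
    have h2 : Tendsto (fun y => mR κ (dist y x)) (nhdsWithin x (closure F)) (nhds 0) := by
      have : Continuous fun y => mR κ (dist y x) := continuous_mR.comp (by fun_prop)
      have := this.tendsto x
      rw [dist_self, mR_zero] at this
      exact this.mono_left nhdsWithin_le_nhds
    refine h2.congr' ?_
    filter_upwards [self_mem_nhdsWithin] with y hy
    rw [h1, hf.isom y hy x hx]
  have := (Θ.symm.continuous.tendsto 0).comp hlim
  rw [← h0, Θ.symm_apply_apply] at this
  refine this.congr fun y => ?_
  simp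

lemma isOpen_image {V : Set X} (hV : V ⊆ F) (hVo : IsOpen V) : IsOpen (f '' V) := by
  rw [isOpen_iff_mem_nhds]
  rintro _ ⟨x, hx, rfl⟩
  obtain ⟨ε, hε, hεV⟩ := Metric.isOpen_iff.1 hVo x hx
  obtain ⟨W, hW, hxW, h⟩ := hf.exists_dist_lt hκ (subset_closure (hV hx)) hε
  have h2 : f x ∈ interior (f '' closure F) := hf.image_interior ▸ ⟨x, hV hx, rfl⟩
  filter_upwards [hW.mem_nhds hxW, isOpen_interior.mem_nhds h2] with q hq hq2
  rw [← hf.image_interior] at hq2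
  obtain ⟨y, hy, rfl⟩ := hq2
  exact ⟨y, hεV (h y (subset_closure hy) hq), rfl⟩

lemma kl_injOn : InjOn (fun x => kl κ (f x)) (closure F) := fun _ hx _ hy h =>
  hf.injOn hκ hx hy (isOpenEmbedding_kl.injective h)

lemma kl_image_interior :
    (fun x => kl κ (f x)) '' F = interior ((fun x => kl κ (f x)) '' closure F) := by
  rw [← image_image (kl κ) f F, hf.image_interior, ← image_image (kl κ) f (closure F),
    ← image_interior_kl]

lemma kl_exists_dist_lt {x : X} (hx : x ∈ closure F) {ε : ℝ} (hε : 0 < ε) :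
    ∃ δ > 0, ∀ y ∈ closure F, dist (kl κ (f y)) (kl κ (f x)) < δ → dist y x < ε := by
  obtain ⟨V, hV, hxV, h⟩ := hf.exists_dist_lt hκ hx hε
  obtain ⟨δ, hδ, hδV⟩ := Metric.isOpen_iff.1 (isOpenEmbedding_kl.isOpenMap V hV) _ ⟨f x, hxV, rfl⟩
  refine ⟨δ, hδ, fun y hy hyd => h y hy ?_⟩
  obtain ⟨q, hq, hqy⟩ := hδV hyd
  rwa [← isOpenEmbedding_kl.injective hqy]

lemma kl_mem_segment {x y z : X} (hx : x ∈ closure F) (hy : y ∈ closure F) (hz : z ∈ closure F)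
    (h : z ∈ Seg x y) : kl κ (f z) ∈ segment ℝ (kl κ (f x)) (kl κ (f y)) := by
  apply Cat2Cx.kl_mem_segment hκ
  rw [hf.isom x hx z hz, hf.isom z hz y hy, hf.isom x hx y hy]
  exact h

variable [Cat0 X]

lemma Seg_subset {x y : X} (hx : x ∈ closure F) (hy : y ∈ closure F) : Seg x y ⊆ closure F := by
  intro m hm
  by_cases hxy : x = y
  · subst hxy
    rw [Seg_self] at hm
    rw [hm]; exact hx
  · have hne : f x ≠ f y := fun h => hxy (hf.injOn hκ hx hy h)
    obtain ⟨γ, w, hγ, -⟩ := exists_model_geodesic hκ hne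
    have hm' := mem_Seg.1 hm
    have hD : mDist κ (f x) (f y) = dist x y := hf.isom x hx y hy
    have hs : dist x m ∈ Icc 0 (mDist κ (f x) (f y)) := by
      rw [hD]; exact ⟨dist_nonneg, by linarith [dist_nonneg (x := m) (y := y)]⟩
    have hmem : γ (dist x m) ∈ geodSeg (mDist κ) univ (f x) (f y) :=
      mem_biUnion (x := γ) hγ ⟨_, hs, rfl⟩
    have hadd := mDist_add_of_mem_geodSeg hκ hmem
    obtain ⟨z, hz, hzγ⟩ := hf.convexWrt _ ⟨x, hx, rfl⟩ _ ⟨y, hy, rfl⟩ hmem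
    rw [← hzγ, hf.isom x hx z hz, hf.isom z hz y hy, hD] at hadd
    have hxz : dist x z = dist x m := by
      rw [← hf.isom x hx z hz, hzγ]
      have := hγ.2.2.1.2 0 (left_mem_Icc.2 (hs.1.trans hs.2)) _ hs
      rw [hγ.1, zero_sub, abs_neg, abs_of_nonneg dist_nonneg] at this
      exact this
    have : z = m := eq_of_mem_Seg_of_dist_eq (q := x) (r := y) hadd hm hxz
    exact this ▸ hz

lemma mem_of_mem_Seg {x y z : X} (hx : x ∈ F) (hy : y ∈ closure F) (hz : z ∈ Seg x y)
    (hzy : z ≠ y) : z ∈ F := by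
  have hx' := subset_closure hx
  have hzc := hf.Seg_subset hκ hx' hy hz
  have hseg := hf.kl_mem_segment hκ hx' hy hzc hz
  obtain ⟨a, b, ha, hb, hab, hz'⟩ := hseg
  have ha' : 0 < a := by
    refine ha.lt_of_ne fun h => hzy ?_
    rw [← h, zero_smul, zero_add] at hz'
    have : b = 1 := by linarith
    rw [this, one_smul] at hz'
    exact (hf.kl_injOn hκ hy hzc hz').symm
  have hxi : kl κ (f x) ∈ interior ((fun x => kl κ (f x)) '' closure F) := by
    rw [← hf.kl_image_interior hκ]; exact ⟨x, hx, rfl⟩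
  have := hf.convex.combo_interior_self_mem_interior hxi ⟨y, hy, rfl⟩ ha' hb hab
  rw [hz', ← hf.kl_image_interior hκ] at this
  obtain ⟨z', hz'F, he⟩ := this
  exact hf.kl_injOn hκ (subset_closure hz'F) hzc he ▸ hz'F

lemma Seg_subset_face {x y : X} (hx : x ∈ F) (hy : y ∈ F) : Seg x y ⊆ F := by
  intro z hz
  by_cases h : z = y
  · exact h ▸ hy
  · exact hf.mem_of_mem_Seg hκ hx (subset_closure hy) hz h

/-- Every point of a face is the centre of a planar disc. -/
lemma exists_isDisc (Θ : (ℝ × ℝ) ≃ₜ ℂ) {z : X} {r : ℝ} (hr : 0 < r) (hrF : closedBall z r ⊆ F) :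
    IsDisc (fun x => Θ (f (clamp z r x))) (ball z r) := by
  have hcl : ∀ x, clamp z r x ∈ F := fun x => hrF (clamp_mem_closedBall hr)
  have key : ∀ x ∈ ball z r, clamp z r x = x := fun x hx =>
    clamp_of_dist_le hr (mem_ball'.1 hx).le
  refine ⟨Θ.continuous.comp ((hf.continuousOn hκ).comp_continuous (continuous_clamp hr)
    fun x => subset_closure (hcl x)), isOpen_ball, ?_, ?_⟩
  · intro x hx y h
    have := hf.injOn hκ (subset_closure (hcl _)) (subset_closure (hcl _)) (Θ.injective h)
    rw [key x hx] at this
    have hd := dist_clamp (o := z) (x := y) hr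
    rw [this] at hd
    have hx' := mem_ball'.1 hx
    rw [← clamp_of_dist_le hr (x := y) (o := z), this]
    by_contra hcon
    rw [min_eq_left (not_le.1 hcon).le] at hd
    linarith
  · intro V hV hVo
    have : (fun x => Θ (f (clamp z r x))) '' V = Θ '' (f '' V) := by
      rw [image_image]
      exact image_congr fun x hx => by rw [key x (hV hx)]
    rw [this]
    exact Θ.isOpenMap _ (hf.isOpen_image hκ (fun x hx => hrF (ball_subset_closedBall (hV hx))) hVo)

lemma eventually_winds_iff {T : Type*} [TopologicalSpace T] [CompactSpace T] {J : C(T, X)} {z : X}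
    (hz : z ∈ F) (hzJ : z ∉ range J) : ∀ᶠ z' in nhds z, (Winds J z' ↔ Winds J z) := by
  obtain ⟨r, hr, hrF⟩ := Metric.nhds_basis_closedBall.mem_iff.1 (hf.isOpen.mem_nhds hz)
  obtain ⟨Θ, -⟩ := exists_polar hκ (f z)
  exact (hf.exists_isDisc hκ Θ hr hrF).eventually_winds_iff (mem_ball_self hr) hzJ

end FaceChart

end Faces

end

section

section Planar

lemma exists_frontier_pair {C : Set ℂ} (hC : IsClosed C) (hconv : Convex ℝ C) {c p : ℂ}
    (hc : c ∈ C) (hci : c ∉ interior C) (hp : p ∈ interior C) {δ : ℝ} (hδ : 0 < δ) :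
    ∃ τ > (0 : ℝ), ∀ σ : ℝ, |σ| = τ → ∃ l : ℝ, c + (l + σ * Complex.I) * (p - c) ∈ C \ interior C ∧
      dist (c + (l + σ * Complex.I) * (p - c)) c < δ := by
  have hv : p - c ≠ 0 := fun h => hci (sub_eq_zero.1 h ▸ hp)
  set v := p - c with hvdef
  have hvn : 0 < ‖v‖ := norm_pos_iff.2 hv
  obtain ⟨η, hη0, hη1, hηδ⟩ : ∃ η : ℝ, 0 < η ∧ η ≤ 1 ∧ 2 * η * ‖v‖ < δ := by
    refine ⟨min 1 (δ / (4 * ‖v‖)), by positivity, min_le_left _ _, ?_⟩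
    have : min 1 (δ / (4 * ‖v‖)) ≤ δ / (4 * ‖v‖) := min_le_right _ _
    calc 2 * min 1 (δ / (4 * ‖v‖)) * ‖v‖ ≤ 2 * (δ / (4 * ‖v‖)) * ‖v‖ := by gcongr
      _ = δ / 2 := by field_simp; ring
      _ < δ := by linarith
  have h1 : c + (η : ℂ) * v ∈ interior C := by
    have := hconv.combo_interior_self_mem_interior hp hc hη0 (sub_nonneg.2 hη1) (by ring)
    convert this using 1
    simp only [Complex.real_smul, hvdef]; push_cast; ring
  have h2 : c - (η : ℂ) * v ∉ C := by
    intro h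
    apply hci
    have h3 : (0 : ℝ) < η / (1 + η) := by positivity
    have := hconv.combo_interior_self_mem_interior hp h h3
      (show (0 : ℝ) ≤ 1 / (1 + η) by positivity) (by field_simp; ring)
    convert this using 1
    simp only [Complex.real_smul, hvdef]
    have : ((1 : ℂ) + η) ≠ 0 := by exact_mod_cast (by positivity : (1 + η) ≠ 0)
    push_cast
    field_simp; ring
  have hcont : ∀ a : ℂ, Continuous fun σ : ℝ => a + σ * Complex.I * v := fun a => by fun_prop
  have e1 : ∀ᶠ σ : ℝ in nhds 0, c + (η : ℂ) * v + σ * Complex.I * v ∈ interior C :=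
    (hcont _).continuousAt (isOpen_interior.mem_nhds (by simpa using h1))
  have e2 : ∀ᶠ σ : ℝ in nhds 0, c - (η : ℂ) * v + σ * Complex.I * v ∈ Cᶜ :=
    (hcont _).continuousAt (hC.isOpen_compl.mem_nhds (by simpa using h2))
  obtain ⟨ε, hε, hball⟩ := Metric.eventually_nhds_iff.1 (e1.and e2)
  refine ⟨min (ε / 2) η, by positivity, fun σ hσ => ?_⟩
  have hσε : |σ| < ε := by rw [hσ]; exact (min_le_left _ _).trans_lt (by linarith)
  have hση : |σ| ≤ η := by rw [hσ]; exact min_le_right _ _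
  obtain ⟨k1, k2⟩ := hball (y := σ) (by rwa [Real.dist_eq, sub_zero])
  let γ : ℝ → ℂ := fun l => c + (l + σ * Complex.I) * v
  have hγ : Continuous γ := by simp only [γ]; fun_prop
  have hpre : IsPreconnected (γ '' Icc (-η) η) := isPreconnected_Icc.image _ hγ.continuousOn
  have m1 : γ η ∈ interior C := by convert k1 using 1; simp only [γ]; ring
  have m2 : γ (-η) ∈ Cᶜ := by convert k2 using 1; simp only [γ]; push_cast; ring
  by_contra hcon
  push Not at hcon
  have hsub : γ '' Icc (-η) η ⊆ interior C ∪ Cᶜ := by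
    rintro _ ⟨l, hl, rfl⟩
    by_contra hne
    rw [mem_union, not_or] at hne
    have := hcon l ⟨not_not.1 hne.2, hne.1⟩
    refine this.not_gt ?_
    have hn : ‖(l : ℂ) + σ * Complex.I‖ ≤ 2 * η := by
      refine (norm_add_le _ _).trans ?_
      rw [norm_mul, Complex.norm_I, mul_one, Complex.norm_real, Complex.norm_real,
        Real.norm_eq_abs, Real.norm_eq_abs]
      have := abs_le.2 hl
      linarith
    rw [dist_eq_norm, add_sub_cancel_left, norm_mul]
    calc _ ≤ 2 * η * ‖v‖ := by gcongr
      _ < δ := hηδ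
  obtain ⟨x, -, hx1, hx2⟩ := hpre _ _ isOpen_interior hC.isOpen_compl hsub
    ⟨γ η, mem_image_of_mem _ ⟨by linarith, le_rfl⟩, m1⟩
    ⟨γ (-η), mem_image_of_mem _ ⟨le_rfl, by linarith⟩, m2⟩
  exact hx2 (interior_subset hx1)

end Planar

section LocalStructure

variable {κ : ℝ} {X : Type*} [MetricSpace X] (PC : PolyComplex2 κ X)

namespace PolyComplex2

lemma exists_local_cells (b : X) : ∃ ρ > 0,
    (∀ c ∈ PC.faces ∪ PC.edges, (c ∩ ball b ρ).Nonempty → b ∈ closure c) ∧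
      ∀ v ∈ PC.vertices, v ∈ ball b ρ → v = b := by
  obtain ⟨ε, hε, hfin, hvfin⟩ := PC.locally_finite b
  set S := {c | (c ∈ PC.faces ∨ c ∈ PC.edges) ∧ (c ∩ ball b ε).Nonempty}
  have h1 : ∀ᶠ x in nhds b, ∀ c ∈ S, b ∉ closure c → x ∉ closure c := by
    rw [hfin.eventually_all]
    intro c _
    by_cases hb : b ∈ closure c
    · exact Eventually.of_forall fun x h => (h hb).elim
    · filter_upwards [isClosed_closure.isOpen_compl.mem_nhds hb] with x hx _ using hx
  have h2 : ∀ᶠ x in nhds b, ∀ v ∈ PC.vertices ∩ ball b ε, b ≠ v → x ≠ v := by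
    rw [hvfin.eventually_all]
    intro v _
    by_cases hb : b = v
    · exact Eventually.of_forall fun x h => (h hb).elim
    · filter_upwards [isOpen_ne.mem_nhds hb] with x hx _ using hx
  obtain ⟨ρ, hρ, hball⟩ := Metric.eventually_nhds_iff.1
    ((h1.and h2).and (ball_mem_nhds b hε))
  refine ⟨ρ, hρ, ?_, ?_⟩
  · rintro c hc ⟨x, hxc, hx⟩
    by_contra hb
    exact (hball hx).1.1 c ⟨hc, x, hxc, (hball hx).2⟩ hb (subset_closure hxc)
  · intro v hv hvb
    by_contra hb
    exact (hball hvb).1.2 v ⟨hv, (hball hvb).2⟩ (Ne.symm hb) rfl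

lemma isClosed_vertices : IsClosed PC.vertices := by
  rw [← isOpen_compl_iff, Metric.isOpen_iff]
  intro b hb
  obtain ⟨ρ, hρ, -, h⟩ := PC.exists_local_cells b
  exact ⟨ρ, hρ, fun v hv hv' => hb (h v hv' hv ▸ hv')⟩

lemma finite_vertices_inter {K : Set X} (hK : IsCompact K) : (PC.vertices ∩ K).Finite := by
  choose ρ hρ _ h using fun b => PC.exists_local_cells b
  obtain ⟨t, -, ht⟩ := hK.elim_nhds_subcover (fun b => ball b (ρ b))
    fun b _ => ball_mem_nhds b (hρ b)
  refine t.finite_toSet.subset fun v hv => ?_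
  obtain ⟨b, hb, hvb⟩ := mem_iUnion₂.1 (ht hv.2)
  exact h b v hv.1 hvb ▸ hb

lemma finite_pages (b : X) : {F | F ∈ PC.faces ∧ b ∈ closure F}.Finite := by
  obtain ⟨ε, hε, hfin, -⟩ := PC.locally_finite b
  refine hfin.subset fun F hF => ⟨Or.inl hF.1, ?_⟩
  obtain ⟨x, hx, hxF⟩ := mem_closure_iff.1 hF.2 (ball b ε) isOpen_ball (mem_ball_self hε)
  exact ⟨x, hxF, hx⟩

lemma cases (x : X) : (∃ F ∈ PC.faces, x ∈ F) ∨ (∃ e ∈ PC.edges, x ∈ e) ∨ x ∈ PC.vertices := by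
  have h : x ∈ ⋃₀ PC.faces ∪ ⋃₀ PC.edges ∪ PC.vertices := by rw [PC.cover]; trivial
  rcases h with (⟨F, hF, hx⟩ | ⟨e, he, hx⟩) | h
  · exact Or.inl ⟨F, hF, hx⟩
  · exact Or.inr (Or.inl ⟨e, he, hx⟩)
  · exact Or.inr (Or.inr h)

variable {PC}

lemma cell_eq {c c' : Set X} (hc : c ∈ PC.faces ∪ PC.edges) (hc' : c' ∈ PC.faces ∪ PC.edges)
    {x : X} (hx : x ∈ c) (hx' : x ∈ c') : c = c' := by
  by_contra h
  have := PC.cells_disjoint c hc c' hc' h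
  exact (this ▸ (⟨hx, hx'⟩ : x ∈ c ∩ c') : x ∈ (∅ : Set X))

lemma face_eq {c c' : Set X} (hc : c ∈ PC.faces) (hc' : c' ∈ PC.faces)
    {x : X} (hx : x ∈ c) (hx' : x ∈ c') : c = c' := cell_eq (.inl hc) (.inl hc') hx hx'

lemma not_mem_vertices {c : Set X} (hc : c ∈ PC.faces ∪ PC.edges) {x : X} (hx : x ∈ c) :
    x ∉ PC.vertices := fun h => by
  have := PC.cells_vertex_disjoint c hc
  exact (this ▸ (⟨hx, h⟩ : x ∈ c ∩ PC.vertices) : x ∈ (∅ : Set X))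

end PolyComplex2

/-- `ε` is a unit speed parametrization of the open edge `e`. -/
structure EdgeParam (PC : PolyComplex2 κ X) (e : Set X) (ε : ℝ → X) (L : ℝ) : Prop where
  mem : e ∈ PC.edges
  pos : 0 < L
  geod : IsGeodesicWrt (fun x y => dist x y) ε 0 L
  image : ε '' Ioo 0 L = e

lemma PolyComplex2.exists_edgeParam {e : Set X} (he : e ∈ PC.edges) :
    ∃ ε L, EdgeParam PC e ε L := by
  obtain ⟨f, L, hL, h, h'⟩ := PC.edge_geodesic e he
  exact ⟨f, L, he, hL, h, h'⟩

variable {PC} {e : Set X} {ε : ℝ → X} {L : ℝ}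

namespace EdgeParam

variable (he : EdgeParam PC e ε L)
include he

lemma dist_eq {s t : ℝ} (hs : s ∈ Ioo 0 L) (ht : t ∈ Ioo 0 L) : dist (ε s) (ε t) = |s - t| :=
  he.geod.2 s (Ioo_subset_Icc_self hs) t (Ioo_subset_Icc_self ht)

lemma mem_edge {s : ℝ} (hs : s ∈ Ioo 0 L) : ε s ∈ e := he.image ▸ mem_image_of_mem _ hs

lemma face_ne (hκ : κ ≤ 0) {F : Set X} (hF : F ∈ PC.faces) : F ≠ e := by
  rintro rfl
  obtain ⟨f, hf⟩ := PC.exists_faceChart hκ hF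
  obtain ⟨x, hx⟩ := hf.nonempty
  obtain ⟨Θ, h0, h1, -⟩ := exists_polar hκ (f x)
  have ho := hf.isOpen_image hκ Subset.rfl hf.isOpen
  obtain ⟨r, hr, hrF⟩ := Metric.isOpen_iff.1 (Θ.isOpenMap _ ho) 0 ⟨f x, ⟨x, hx, rfl⟩, h0⟩
  have hex : ∀ ζ : ℂ, ‖ζ‖ < r → ∃ s ∈ Ioo 0 L, Θ (f (ε s)) = ζ := by
    intro ζ hζ
    obtain ⟨_, ⟨y, hy, rfl⟩, hyζ⟩ := hrF (mem_ball_zero_iff.2 hζ)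
    obtain ⟨s, hs, rfl⟩ := he.image.symm ▸ hy
    exact ⟨s, hs, hyζ⟩
  obtain ⟨s0, hs0, rfl⟩ := he.image.symm ▸ hx
  have hη : (0 : ℝ) < r / 2 := by positivity
  set η : ℝ := r / 2 with hηdef
  have hnorm : ∀ s ∈ Ioo 0 L, ‖Θ (f (ε s))‖ = mR κ |s - s0| := fun s hs => by
    rw [h1, hf.isom _ (subset_closure (he.mem_edge hs)) _ (subset_closure (he.mem_edge hs0)),
      he.dist_eq hs hs0]
  obtain ⟨s1, hs1, e1⟩ := hex (η : ℂ) (by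
    rw [Complex.norm_real, Real.norm_of_nonneg hη.le, hηdef]; linarith)
  obtain ⟨s2, hs2, e2⟩ := hex (-η : ℂ) (by
    rw [norm_neg, Complex.norm_real, Real.norm_of_nonneg hη.le, hηdef]; linarith)
  obtain ⟨s3, hs3, e3⟩ := hex (η * Complex.I) (by
    rw [norm_mul, Complex.norm_I, mul_one, Complex.norm_real, Real.norm_of_nonneg hη.le, hηdef]
    linarith)
  have k1 := hnorm s1 hs1
  have k2 := hnorm s2 hs2
  have k3 := hnorm s3 hs3
  rw [e1] at k1
  rw [e2, norm_neg, k1] at k2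
  rw [e3, norm_mul, Complex.norm_I, mul_one, k1] at k3
  have l2 := (mR_strictMono hκ).injective k2
  have l3 := (mR_strictMono hκ).injective k3
  have n12 : s1 ≠ s2 := by
    rintro rfl
    have := congrArg Complex.re (e1.symm.trans e2)
    simp at this; linarith
  have n13 : s1 ≠ s3 := by
    rintro rfl
    have := congrArg Complex.re (e1.symm.trans e3)
    simp at this; linarith
  have n23 : s2 ≠ s3 := by
    rintro rfl
    have := congrArg Complex.re (e2.symm.trans e3)
    simp at this; linarith
  rcases abs_eq_abs.1 l2 with m | m <;> rcases abs_eq_abs.1 l3 with m' | m'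
  · exact n12 (by linarith)
  · exact n12 (by linarith)
  · exact n13 (by linarith)
  · exact n23 (by linarith)

lemma not_mem_face (hκ : κ ≤ 0) {F : Set X} (hF : F ∈ PC.faces) {x : X} (hx : x ∈ e) : x ∉ F :=
  fun hxF => he.face_ne hκ hF (PolyComplex2.cell_eq (.inl hF) (.inr he.mem) hxF hx)

lemma not_mem_vertices {x : X} (hx : x ∈ e) : x ∉ PC.vertices :=
  PolyComplex2.not_mem_vertices (.inr he.mem) hx

lemma edge_eq {b : X} (hb : b ∈ e) {e' : Set X} (he' : e' ∈ PC.edges) (h : b ∈ closure e') :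
    e' = e := by
  by_cases hbe : b ∈ e'
  · exact PolyComplex2.cell_eq (.inr he') (.inr he.mem) hbe hb
  · exact (he.not_mem_vertices hb (PC.edge_closure e' he' ⟨h, hbe⟩)).elim

lemma mem_Seg_of_le [Cat0 X] {s t u : ℝ} (hs : s ∈ Ioo 0 L) (hu : u ∈ Ioo 0 L) (hst : s ≤ t)
    (htu : t ≤ u) : ε t ∈ Seg (ε s) (ε u) := by
  have ht : t ∈ Ioo 0 L := ⟨hs.1.trans_le hst, htu.trans_lt hu.2⟩
  rw [mem_Seg, he.dist_eq hs ht, he.dist_eq ht hu, he.dist_eq hs hu, abs_of_nonpos (by linarith),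
    abs_of_nonpos (by linarith), abs_of_nonpos (by linarith)]
  ring

lemma exists_local {s₀ : ℝ} (hs₀ : s₀ ∈ Ioo 0 L) : ∃ ρ > 0, ∀ x ∈ ball (ε s₀) ρ,
    x ∈ e ∨ ∃ F ∈ PC.faces, ε s₀ ∈ closure F ∧ x ∈ F := by
  have hb := he.mem_edge hs₀
  obtain ⟨ρ, hρ, h1, h2⟩ := PC.exists_local_cells (ε s₀)
  refine ⟨ρ, hρ, fun x hx => ?_⟩
  rcases PC.cases x with ⟨F, hF, hxF⟩ | ⟨e', he', hxe⟩ | hv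
  · exact Or.inr ⟨F, hF, h1 F (.inl hF) ⟨x, hxF, hx⟩, hxF⟩
  · exact Or.inl (he.edge_eq hb he' (h1 e' (.inr he') ⟨x, hxe, hx⟩) ▸ hxe)
  · exact (he.not_mem_vertices hb (h2 x hv hx ▸ hv)).elim

lemma exists_closure_nhds [Cat0 X] (hκ : κ ≤ 0) {s₀ : ℝ} (hs₀ : s₀ ∈ Ioo 0 L) {F : Set X}
    (hF : F ∈ PC.faces) (hb : ε s₀ ∈ closure F) :
    ∃ r > 0, ∀ s, |s - s₀| ≤ r → ε s ∈ closure F := by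
  have hbe := he.mem_edge hs₀
  have hbF := he.not_mem_face hκ hF hbe
  obtain ⟨f, hf⟩ := PC.exists_faceChart hκ hF
  obtain ⟨x, hx⟩ := hf.nonempty
  obtain ⟨ρ, hρ, hloc⟩ := he.exists_local hs₀
  obtain ⟨δ, hδ, hδρ⟩ := hf.kl_exists_dist_lt hκ hb hρ
  set g : X → ℂ := fun x => kl κ (f x) with hg
  have himage := hf.kl_image_interior hκ
  have hmemF : ∀ y ∈ closure F, g y ∈ interior (g '' closure F) → y ∈ F := by
    intro y hy h
    rw [← himage] at h
    obtain ⟨y', hy', e⟩ := h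
    exact hf.kl_injOn hκ (subset_closure hy') hy e ▸ hy'
  obtain ⟨τ, hτ, hpair⟩ := exists_frontier_pair hf.closed hf.convex (c := g (ε s₀)) (p := g x)
    ⟨_, hb, rfl⟩ (fun h => hbF (hmemF _ hb h)) (by rw [← himage]; exact ⟨x, hx, rfl⟩) hδ
  have hv : g x - g (ε s₀) ≠ 0 := fun h => hbF
    (hf.kl_injOn hκ (subset_closure hx) hb (sub_eq_zero.1 h) ▸ hx)
  have hex : ∀ σ : ℝ, |σ| = τ → ∃ s ∈ Ioo 0 L, ε s ∈ closure F ∧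
      ((g (ε s) - g (ε s₀)) / (g x - g (ε s₀))).im = σ := by
    intro σ hσ
    obtain ⟨l, ⟨⟨y, hy, hyl⟩, hni⟩, hd⟩ := hpair σ hσ
    simp only at hyl
    rw [← hyl] at hni hd
    have hyF : y ∉ F := fun h => hni (by rw [← himage]; exact ⟨y, h, rfl⟩)
    have hye : y ∈ e := by
      rcases hloc y (hδρ y hy hd) with h | ⟨F', hF', -, hyF'⟩
      · exact h
      · obtain ⟨z, hz, hzF⟩ := mem_closure_iff.1 hy F' (PC.faces_open F' hF') hyF'
        exact (hyF (PolyComplex2.face_eq hF hF' hzF hz ▸ hyF')).elim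
    obtain ⟨s, hs, rfl⟩ := he.image.symm ▸ hye
    refine ⟨s, hs, hy, ?_⟩
    have : g (ε s) - g (ε s₀) = (l + σ * Complex.I) * (g x - g (ε s₀)) := by
      simp only [hg]; rw [hyl]; ring
    rw [this, mul_div_cancel_right₀ _ hv]
    simp
  have hbad : ∀ s s' σ, |σ| = τ → ε s ∈ closure F → ε s' ∈ closure F →
      ε s ∈ Seg (ε s₀) (ε s') → ((g (ε s) - g (ε s₀)) / (g x - g (ε s₀))).im = σ →
      ((g (ε s') - g (ε s₀)) / (g x - g (ε s₀))).im = -σ → False := by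
    intro s s' σ hσ h1 h2 h3 h4 h5
    obtain ⟨a, b, ha, hb', hab, h6⟩ := hf.kl_mem_segment hκ hb h2 h1 h3
    have h7 : (g (ε s) - g (ε s₀)) / (g x - g (ε s₀)) =
        b * ((g (ε s') - g (ε s₀)) / (g x - g (ε s₀))) := by
      have ha' : a = 1 - b := by linarith
      simp only [hg]
      rw [← h6, ha', mul_div_assoc', Complex.real_smul, Complex.real_smul]
      congr 1; push_cast; ring
    rw [h7, Complex.im_ofReal_mul, h5] at h4
    have : σ * (1 + b) = 0 := by linarith
    rcases mul_eq_zero.1 this with h | h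
    · rw [h, abs_zero] at hσ; linarith
    · linarith
  obtain ⟨s, hs, hsF, hsi⟩ := hex τ (abs_of_pos hτ)
  obtain ⟨s', hs', hsF', hsi'⟩ := hex (-τ) (by rw [abs_neg, abs_of_pos hτ])
  have hττ : |τ| = τ := abs_of_pos hτ
  have hττ' : |-τ| = τ := by rw [abs_neg, hττ]
  have hmain : ∀ a b, a ∈ Ioo 0 L → b ∈ Ioo 0 L → ε a ∈ closure F → ε b ∈ closure F → a < s₀ →
      s₀ < b → ∃ r > 0, ∀ s, |s - s₀| ≤ r → ε s ∈ closure F := by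
    intro a b ha hb' haF hbF' h1 h2
    refine ⟨min (s₀ - a) (b - s₀), lt_min (by linarith) (by linarith), fun t ht => ?_⟩
    have h3 := abs_le.1 (ht.trans (min_le_left _ _))
    have h4 := abs_le.1 (ht.trans (min_le_right _ _))
    exact hf.Seg_subset hκ haF hbF' (he.mem_Seg_of_le ha hb' (by linarith) (by linarith))
  rcases lt_or_ge s s₀ with h | h <;> rcases lt_or_ge s' s₀ with h' | h'
  · exfalso
    rcases le_total s s' with h2 | h2
    · refine hbad s' s (-τ) hττ' hsF' hsF ?_ hsi' (by rw [neg_neg]; exact hsi)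
      rw [Seg_comm]; exact he.mem_Seg_of_le hs hs₀ h2 h'.le
    · refine hbad s s' τ hττ hsF hsF' ?_ hsi hsi'
      rw [Seg_comm]; exact he.mem_Seg_of_le hs' hs₀ h2 h.le
  · rcases h'.eq_or_lt with h2 | h2
    · exfalso
      rw [← h2, sub_self, zero_div, Complex.zero_im] at hsi'
      linarith
    · exact hmain s s' hs hs' hsF hsF' h h2
  · rcases h.eq_or_lt with h2 | h2
    · exfalso
      rw [← h2, sub_self, zero_div, Complex.zero_im] at hsi
      linarith
    · exact hmain s' s hs' hs hsF' hsF h' h2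
  · exfalso
    rcases le_total s s' with h2 | h2
    · exact hbad s s' τ hττ hsF hsF' (he.mem_Seg_of_le hs₀ hs' h h2) hsi hsi'
    · exact hbad s' s (-τ) hττ' hsF' hsF (he.mem_Seg_of_le hs₀ hs h' h2) hsi'
        (by rw [neg_neg]; exact hsi)

end EdgeParam

end LocalStructure

end

section

variable {X : Type*} [MetricSpace X] [Cat0 X]

/-- The set of endpoints `z` such that the segment from `w` to `z` meets a closed set is closed. -/
lemma isClosed_Seg_meets (w : X) {D : Set X} (hD : IsClosed D) :
    IsClosed {z | (Seg w z ∩ D).Nonempty} := by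
  have h : {z | (Seg w z ∩ D).Nonempty} =
      Prod.snd '' {x : Icc (0 : ℝ) 1 × X | G w x.2 x.1 ∈ D} := by
    ext z
    constructor
    · rintro ⟨m, hm, hmD⟩
      rw [Seg_eq_image] at hm
      obtain ⟨t, ht, rfl⟩ := hm
      exact ⟨(⟨t, ht⟩, z), hmD, rfl⟩
    · rintro ⟨⟨⟨t, ht⟩, z'⟩, h, rfl⟩
      exact ⟨_, G_mem_Seg _ _ ht, h⟩
  rw [h]
  refine isClosedMap_snd_of_compactSpace _ (hD.preimage ?_)
  exact continuous_G_comp continuous_const continuous_snd (continuous_subtype_val.comp continuous_fst)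

section EdgeCrossing

variable {κ : ℝ} {PC : PolyComplex2 κ X} {e : Set X} {ε : ℝ → X} {L : ℝ}

lemma EdgeParam.Seg_eq (he : EdgeParam PC e ε L) {s t : ℝ} (hs : s ∈ Ioo 0 L) (ht : t ∈ Ioo 0 L)
    (hst : s ≤ t) : Seg (ε s) (ε t) = ε '' Icc s t := by
  ext x
  constructor
  · intro hx
    have h1 : dist (ε s) x ≤ t - s := by
      have h2 := hx
      rw [mem_Seg, he.dist_eq hs ht, abs_of_nonpos (by linarith)] at h2
      linarith [dist_nonneg (x := x) (y := ε t)]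
    have h2 : s ≤ s + dist (ε s) x := by linarith [dist_nonneg (x := ε s) (y := x)]
    refine ⟨s + dist (ε s) x, ⟨h2, by linarith⟩, ?_⟩
    refine eq_of_mem_Seg_of_dist_eq (he.mem_Seg_of_le hs ht h2 (by linarith)) hx ?_
    rw [he.dist_eq hs ⟨hs.1.trans_le h2, by linarith [ht.2]⟩, abs_of_nonpos (by linarith)]
    ring
  · rintro ⟨r, hr, rfl⟩
    exact he.mem_Seg_of_le hs ht hr.1 hr.2

/-- The closed ball of radius `ρ` about the edge point `ε s₀` is a union of half-disc pages
glued along a subsegment of the edge. -/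
structure EdgeNbhd (PC : PolyComplex2 κ X) (e : Set X) (ε : ℝ → X) (L s₀ ρ : ℝ) : Prop where
  param : EdgeParam PC e ε L
  pos : 0 < ρ
  sub : Icc (s₀ - ρ) (s₀ + ρ) ⊆ Ioo 0 L
  cases : ∀ x ∈ closedBall (ε s₀) ρ, x ∈ e ∨ ∃ F ∈ PC.faces, ε s₀ ∈ closure F ∧ x ∈ F
  pages : ∀ F ∈ PC.faces, ε s₀ ∈ closure F → ∀ s, |s - s₀| ≤ ρ → ε s ∈ closure F

lemma EdgeParam.exists_edgeNbhd (hκ : κ ≤ 0) (he : EdgeParam PC e ε L) {s₀ : ℝ}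
    (hs₀ : s₀ ∈ Ioo 0 L) : ∃ R > 0, ∀ ρ, 0 < ρ → ρ ≤ R → EdgeNbhd PC e ε L s₀ ρ := by
  obtain ⟨ρ₁, hρ₁, h1⟩ := he.exists_local hs₀
  have h2 : ∃ R > 0, ∀ F ∈ {F | F ∈ PC.faces ∧ ε s₀ ∈ closure F}, ∀ s, |s - s₀| ≤ R →
      ε s ∈ closure F := by
    have hfin := PC.finite_pages (ε s₀)
    have h3 : ∀ F : Set X, ∃ r > 0, F ∈ {F | F ∈ PC.faces ∧ ε s₀ ∈ closure F} →
        ∀ s, |s - s₀| ≤ r → ε s ∈ closure F := by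
      intro F
      by_cases hF : F ∈ {F | F ∈ PC.faces ∧ ε s₀ ∈ closure F}
      · obtain ⟨r, hr, h⟩ := he.exists_closure_nhds hκ hs₀ hF.1 hF.2
        exact ⟨r, hr, fun _ => h⟩
      · exact ⟨1, one_pos, fun h => (hF h).elim⟩
    choose r hr hrF using h3
    obtain ⟨R, hR, h⟩ : ∃ R > 0, ∀ F ∈ {F | F ∈ PC.faces ∧ ε s₀ ∈ closure F}, R ≤ r F := by
      rcases {F | F ∈ PC.faces ∧ ε s₀ ∈ closure F}.eq_empty_or_nonempty with h | h
      · exact ⟨1, one_pos, fun F hF => by rw [h] at hF; exact hF.elim⟩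
      · obtain ⟨F₀, -, h0⟩ := exists_min_image _ r hfin h
        exact ⟨r F₀, hr _, h0⟩
    exact ⟨R, hR, fun F hF s hs => hrF F hF s (hs.trans (h F hF))⟩
  obtain ⟨ρ₂, hρ₂, h2⟩ := h2
  have hpos : 0 < min (min (ρ₁ / 2) ρ₂) (min (s₀ / 2) ((L - s₀) / 2)) := by
    have := hs₀.1; have := hs₀.2
    refine lt_min (lt_min (by linarith) hρ₂) (lt_min (by linarith) (by linarith))
  refine ⟨_, hpos, fun ρ hρ hle => ⟨he, hρ, ?_, ?_, ?_⟩⟩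
  · have h3 := hle.trans ((min_le_right _ _).trans (min_le_left _ _))
    have h4 := hle.trans ((min_le_right _ _).trans (min_le_right _ _))
    have := hs₀.1; have := hs₀.2
    exact fun s hs => ⟨by linarith [hs.1], by linarith [hs.2]⟩
  · intro x hx
    have h3 := hle.trans ((min_le_left _ _).trans (min_le_left _ _))
    exact h1 x ((mem_closedBall.1 hx).trans_lt (by linarith))
  · intro F hF hb s hs
    exact h2 F ⟨hF, hb⟩ s (hs.trans (hle.trans ((min_le_left _ _).trans (min_le_right _ _))))

namespace EdgeNbhd

variable {s₀ ρ : ℝ} (hn : EdgeNbhd PC e ε L s₀ ρ)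
include hn

lemma mem_Ioo {s : ℝ} (hs : |s - s₀| ≤ ρ) : s ∈ Ioo 0 L := by
  have := abs_le.1 hs
  exact hn.sub ⟨by linarith, by linarith⟩

lemma mem_Ioo_self : s₀ ∈ Ioo 0 L := hn.mem_Ioo (by simpa using hn.pos.le)

lemma exists_param {x : X} (hx : x ∈ e) (hd : x ∈ closedBall (ε s₀) ρ) :
    ∃ s, |s - s₀| ≤ ρ ∧ ε s = x := by
  obtain ⟨s, hs, rfl⟩ := hn.param.image.symm ▸ hx
  rw [mem_closedBall, hn.param.dist_eq hs hn.mem_Ioo_self] at hd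
  exact ⟨s, hd, rfl⟩

lemma page {F : Set X} (hF : F ∈ PC.faces) (hκ : κ ≤ 0) {x : X} (hxF : x ∈ F)
    (hx : x ∈ closedBall (ε s₀) ρ) : ε s₀ ∈ closure F := by
  rcases hn.cases x hx with h | ⟨F', hF', hb, hxF'⟩
  · exact (hn.param.not_mem_face hκ hF h hxF).elim
  · exact PolyComplex2.face_eq hF hF' hxF hxF' ▸ hb

/-- A segment inside the neighbourhood joining different faces meets the edge. -/
lemma exists_mem_edge {F F' : Set X} (hF : F ∈ PC.faces) (hF' : F' ∈ PC.faces) (hne : F ≠ F')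
    {x y : X} (hx : x ∈ F) (hy : y ∈ F') (hxb : x ∈ closedBall (ε s₀) ρ)
    (hyb : y ∈ closedBall (ε s₀) ρ) : ∃ s, |s - s₀| ≤ ρ ∧ ε s ∈ Seg x y := by
  by_contra hcon
  push Not at hcon
  have hsub : Seg x y ⊆ closedBall (ε s₀) ρ := Seg_subset_closedBall hxb hyb
  have hcov : Seg x y ⊆ F ∪ ⋃₀ {c | c ∈ PC.faces ∧ c ≠ F} := by
    intro z hz
    rcases hn.cases z (hsub hz) with h | ⟨F'', hF'', -, hzF⟩
    · obtain ⟨s, hs, rfl⟩ := hn.exists_param h (hsub hz)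
      exact (hcon s hs hz).elim
    · by_cases h : F'' = F
      · exact Or.inl (h ▸ hzF)
      · exact Or.inr ⟨F'', ⟨hF'', h⟩, hzF⟩
  obtain ⟨z, -, hzF, F'', ⟨hF'', hne'⟩, hzF''⟩ := isPreconnected_Seg x y _ _ (PC.faces_open F hF)
    (isOpen_sUnion fun c hc => PC.faces_open c hc.1) hcov ⟨x, left_mem_Seg _ _, hx⟩
    ⟨y, right_mem_Seg _ _, F', ⟨hF', hne.symm⟩, hy⟩
  exact hne' (PolyComplex2.face_eq hF'' hF hzF'' hzF)

end EdgeNbhd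

namespace EdgeParam

variable (he : EdgeParam PC e ε L)
include he

/-- A vertex-free segment which starts off an edge `e` and ends on `e` arrives through a face and
meets `e` only at its endpoint. -/
lemma arrival (hκ : κ ≤ 0) {w b : X} (hw : w ∉ e) (hb : b ∈ e)
    (hv : ∀ x ∈ Seg w b, x ∉ PC.vertices) :
    (∀ x ∈ Seg w b, x ∈ e → x = b) ∧
      ∃ F ∈ PC.faces, b ∈ closure F ∧ ∃ w' ∈ Seg w b, w' ≠ b ∧ w' ∈ F := by
  have hwb : w ≠ b := fun h => hw (h ▸ hb)
  have hmem : ∀ x ∈ Seg w b, x ∈ closure e → x ∈ e := fun x hx hxe => by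
    by_contra h
    exact hv x hx (PC.edge_closure e he.mem ⟨hxe, h⟩)
  have hcpt : IsCompact (Icc (0 : ℝ) 1 ∩ G w b ⁻¹' closure e) :=
    isCompact_Icc.inter_right (isClosed_closure.preimage (continuous_G_param w b))
  obtain ⟨t, ⟨ht, hte⟩, hmin⟩ := hcpt.exists_isLeast
    ⟨1, by simp, by rw [mem_preimage, G_one]; exact subset_closure hb⟩
  have hbS := G_mem_Seg w b ht
  have hbe := hmem _ hbS hte
  have ht0 : 0 < t := by
    rcases ht.1.eq_or_lt with h | h
    · rw [← h, G_zero] at hbe; exact (hw hbe).elim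
    · exact h
  obtain ⟨s, hs, hsb⟩ := he.image.symm ▸ hbe
  obtain ⟨ρ, hρ, hloc⟩ := he.exists_local hs
  obtain ⟨t', ht't, hball⟩ : ∃ t' ∈ Ico 0 t, G w b t' ∈ ball (ε s) ρ := by
    have h1 : G w b ⁻¹' ball (ε s) ρ ∈ nhds t :=
      (isOpen_ball.preimage (continuous_G_param w b)).mem_nhds
        (by rw [mem_preimage, hsb]; exact mem_ball_self hρ)
    obtain ⟨a, ha, hat⟩ := exists_Ioc_subset_of_mem_nhds h1 ⟨0, ht0⟩
    refine ⟨max 0 ((a + t) / 2), ⟨le_max_left _ _, max_lt ht0 (by linarith)⟩, ?_⟩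
    refine hat ⟨lt_max_of_lt_right (by linarith), (max_lt ht0 (by linarith)).le⟩
  have ht' : t' ∈ Icc (0 : ℝ) 1 := ⟨ht't.1, ht't.2.le.trans ht.2⟩
  have hw'S := G_mem_Seg w b ht'
  have hw'e : G w b t' ∉ e := fun h =>
    absurd (hmin ⟨ht', subset_closure h⟩) (not_le.2 ht't.2)
  rcases hloc _ hball with h | ⟨F, hF, hbF, hw'F⟩
  · exact (hw'e h).elim
  have heq : G w b t = b := by
    by_contra hne
    obtain ⟨f, hf⟩ := PC.exists_faceChart hκ hF
    obtain ⟨s', hs', hsb'⟩ := he.image.symm ▸ hb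
    have hss : s ≠ s' := by rintro rfl; exact hne (hsb.symm.trans hsb')
    obtain ⟨r, hr, hrF⟩ := he.exists_closure_nhds hκ hs hF hbF
    have hbS' : G w b t ∈ Seg (G w b t') b := by
      refine (Seg_trans hbS (mem_Seg_of_dist_le hbS hw'S ?_)).2
      rw [dist_left_G _ _ ht', dist_left_G _ _ ht]
      exact mul_le_mul_of_nonneg_right ht't.2.le dist_nonneg
    obtain ⟨s₁, hs₁I, hs₁r, hs₁s, hs₁⟩ : ∃ s₁ ∈ Ioo 0 L, |s₁ - s| ≤ r ∧ s₁ ≠ s ∧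
        ε s₁ ∈ Seg (ε s) (ε s') := by
      rcases lt_or_gt_of_ne hss with h | h
      · refine ⟨min (s + r) s', ⟨lt_min (by linarith [hs.1]) hs'.1, (min_le_right _ _).trans_lt hs'.2⟩,
          ?_, (lt_min (by linarith) h).ne', ?_⟩
        · rw [abs_of_nonneg (sub_nonneg.2 (le_min (by linarith) h.le))]
          linarith [min_le_left (s + r) s']
        · exact he.mem_Seg_of_le hs hs' (le_min (by linarith) h.le) (min_le_right _ _)
      · refine ⟨max (s - r) s', ⟨lt_max_of_lt_right hs'.1, max_lt (by linarith [hs.2]) hs'.2⟩,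
          ?_, (max_lt (by linarith) h).ne, ?_⟩
        · rw [abs_of_nonpos (sub_nonpos.2 (max_le (by linarith) h.le))]
          linarith [le_max_left (s - r) s']
        · rw [Seg_comm]
          exact he.mem_Seg_of_le hs' hs (le_max_right _ _) (max_le (by linarith) h.le)
    rw [hsb, hsb'] at hs₁
    have h1 : G w b t ∈ Seg (G w b t') (ε s₁) := by
      rw [Seg_comm] at hbS' hs₁ ⊢
      exact (Seg_trans hbS' hs₁).2
    have h2 := hf.mem_of_mem_Seg hκ hw'F (hrF s₁ hs₁r) h1 (by
      intro h
      have h4 := he.dist_eq hs₁I hs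
      rw [hsb, ← h, dist_self] at h4
      exact hs₁s (sub_eq_zero.1 (abs_eq_zero.1 h4.symm)))
    exact he.not_mem_face hκ hF hbe h2
  refine ⟨fun x hx hxe => ?_, F, hF, by rwa [hsb, heq] at hbF, _, hw'S, ?_, hw'F⟩
  · obtain ⟨h1, h2⟩ := eq_G_of_mem_Seg hx hwb
    have ht1 : t = 1 := by
      have := dist_left_G w b ht
      rw [heq] at this
      have hD := dist_pos.2 hwb
      nlinarith
    have h3 : t ≤ _ := hmin ⟨h1, by rw [mem_preimage, ← h2]; exact subset_closure hxe⟩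
    rw [h2, le_antisymm h1.2 (ht1 ▸ h3), G_one]
  · intro h
    exact hw'e (by rw [h]; exact hb)

/-- Near an edge point `b`, the segments from `w` through `b` can be continued into every page
other than the arrival page. -/
lemma exists_continuation (hκ : κ ≤ 0) {w b : X} (hw : w ∉ e) (hb : b ∈ e)
    (hv : ∀ x ∈ Seg w b, x ∉ PC.vertices) {F F' : Set X} (hF : F ∈ PC.faces)
    (hF' : F' ∈ PC.faces) (hne : F ≠ F') (hbF : b ∈ closure F) (hbF' : b ∈ closure F') {w' : X}
    (hw' : w' ∈ Seg w b) (hw'b : w' ≠ b) (hw'F : w' ∈ F) {δ : ℝ} (hδ : 0 < δ) :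
    ∃ z ∈ F', z ∈ ball b δ ∧ b ∈ Seg w z := by
  have hwb : w ≠ b := fun h => hw (h ▸ hb)
  obtain ⟨s, hs, rfl⟩ := he.image.symm ▸ hb
  obtain ⟨R, hR, hnb⟩ := he.exists_edgeNbhd hκ hs
  have hn := hnb R hR le_rfl
  obtain ⟨f, hf⟩ := PC.exists_faceChart hκ hF
  obtain ⟨f', hf'⟩ := PC.exists_faceChart hκ hF'
  obtain ⟨t, ht, htF, htb⟩ : ∃ t ∈ Icc (0 : ℝ) 1, G w (ε s) t ∈ F ∧ G w (ε s) t ∈ ball (ε s) R := by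
    set w'' := G w' (ε s) (1 - min (1 / 2) (R / (2 * dist w' (ε s)))) with hw''
    have hD := dist_pos.2 hw'b
    have hm : 0 < min (1 / 2) (R / (2 * dist w' (ε s))) := by positivity
    have hm1 : min (1 / 2) (R / (2 * dist w' (ε s))) ≤ 1 / 2 := min_le_left _ _
    have hm2 : min (1 / 2) (R / (2 * dist w' (ε s))) ≤ R / (2 * dist w' (ε s)) := min_le_right _ _
    have hI : 1 - min (1 / 2) (R / (2 * dist w' (ε s))) ∈ Icc (0 : ℝ) 1 :=
      ⟨by linarith, by linarith⟩
    have hS : w'' ∈ Seg w' (ε s) := G_mem_Seg _ _ hI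
    have hd := dist_G_right w' (ε s) hI
    rw [← hw''] at hd
    have h1 := eq_G_of_mem_Seg (Seg_subset_right hw' hS) hwb
    refine ⟨_, h1.1, ?_, ?_⟩
    · rw [← h1.2]
      refine hf.mem_of_mem_Seg hκ hw'F hbF hS fun h => ?_
      rw [h, dist_self] at hd
      nlinarith
    · rw [← h1.2, mem_ball, hd]
      calc (1 - (1 - min (1 / 2) (R / (2 * dist w' (ε s))))) * dist w' (ε s)
          = min (1 / 2) (R / (2 * dist w' (ε s))) * dist w' (ε s) := by ring
        _ ≤ R / (2 * dist w' (ε s)) * dist w' (ε s) := by gcongr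
        _ = R / 2 := by field_simp
        _ < R := by linarith
  have hgood : ∀ᶠ z in nhds (ε s), z ∈ ball (ε s) R ∧ z ∈ ball (ε s) δ ∧ G w z t ∈ F ∧
      G w z t ∈ ball (ε s) R ∧ ∀ x ∈ Seg w z, x ∉ PC.vertices := by
    have hc : Continuous fun z => G w z t :=
      continuous_G_comp continuous_const continuous_id continuous_const
    have := (isClosed_Seg_meets w PC.isClosed_vertices).isOpen_compl.mem_nhds
      (x := ε s) (fun ⟨x, hx, hx'⟩ => hv x hx hx')
    filter_upwards [this, ball_mem_nhds _ hR, ball_mem_nhds _ hδ,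
      hc.continuousAt.eventually_mem ((PC.faces_open F hF).mem_nhds htF),
      hc.continuousAt.eventually_mem (isOpen_ball.mem_nhds htb)] with z hz h1 h2 h3 h4
    exact ⟨h1, h2, h3, h4, fun x hx hx' => hz ⟨x, hx, hx'⟩⟩
  obtain ⟨δ₁, hδ₁, hgood⟩ := Metric.eventually_nhds_iff_ball.1 hgood
  set η := min R (δ₁ / 2) with hη
  have hη0 : 0 < η := by positivity
  have hηR : η ≤ R := min_le_left _ _
  have hηδ : η < δ₁ := (min_le_right _ _).trans_lt (by linarith)
  have iR : s + R ∈ Ioo 0 L := hn.mem_Ioo (by simp [abs_of_pos hR])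
  have iR' : s - R ∈ Ioo 0 L := hn.mem_Ioo (by simp [abs_of_pos hR])
  have iη : s + η ∈ Ioo 0 L := hn.mem_Ioo (by simpa [abs_of_pos hη0])
  have iη' : s - η ∈ Ioo 0 L := hn.mem_Ioo (by simpa [abs_of_pos hη0])
  have hside : ∀ a c σ, a ∈ Ioo 0 L → c ∈ Ioo 0 L → a ≤ c → |σ - s| = η → σ ∉ Icc a c →
      ∃ z ∈ F', z ∈ ball (ε s) δ₁ ∧ ¬ (Seg w z ∩ Seg (ε a) (ε c)).Nonempty := by
    intro a c σ ha hc hac hσ hσac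
    have hσI : σ ∈ Ioo 0 L := hn.mem_Ioo (hσ.le.trans hηR)
    have hσb : ε σ ∈ ball (ε s) δ₁ := by
      rw [mem_ball, he.dist_eq hσI hs, hσ]; exact hηδ
    have h1 : ¬ (Seg w (ε σ) ∩ Seg (ε a) (ε c)).Nonempty := by
      rintro ⟨x, hx, hx'⟩
      rw [he.Seg_eq ha hc hac] at hx'
      obtain ⟨r, hr, rfl⟩ := hx'
      have hrI : r ∈ Ioo 0 L := ⟨ha.1.trans_le hr.1, hr.2.trans_lt hc.2⟩
      have h2 := (he.arrival hκ hw (he.mem_edge hσI) (hgood _ hσb).2.2.2.2).1 _ hx (he.mem_edge hrI)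
      have h3 := he.dist_eq hrI hσI
      rw [h2, dist_self] at h3
      exact hσac (sub_eq_zero.1 (abs_eq_zero.1 h3.symm) ▸ hr)
    have h2 := (isClosed_Seg_meets w (isCompact_Seg (ε a) (ε c)).isClosed).isOpen_compl
    obtain ⟨z, ⟨hz1, hz2⟩, hz3⟩ := mem_closure_iff.1 (hn.pages F' hF' hbF' σ (hσ.le.trans hηR)) _
      (h2.inter isOpen_ball) ⟨h1, hσb⟩
    exact ⟨z, hz3, hz2, hz1⟩
  obtain ⟨z₁, hz₁F, hz₁b, hz₁⟩ := hside s (s + R) (s - η) hs iR (by linarith)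
    (by simp [abs_of_pos hη0]) (fun h => by linarith [h.1])
  obtain ⟨z₂, hz₂F, hz₂b, hz₂⟩ := hside (s - R) s (s + η) iR' hs (by linarith)
    (by simp [abs_of_pos hη0]) (fun h => by linarith [h.2])
  have hcov : Seg z₁ z₂ ⊆ {z | (Seg w z ∩ Seg (ε (s - R)) (ε s)).Nonempty} ∪
      {z | (Seg w z ∩ Seg (ε s) (ε (s + R))).Nonempty} := by
    intro z hz
    have hzF := hf'.Seg_subset_face hκ hz₁F hz₂F hz
    have hzb := hgood z (Seg_subset_ball hz₁b hz₂b hz)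
    obtain ⟨r, hr, hrS⟩ := hn.exists_mem_edge hF hF' hne hzb.2.2.1 hzF
      (ball_subset_closedBall hzb.2.2.2.1) (ball_subset_closedBall hzb.1)
    have hrS' := Seg_subset_right (G_mem_Seg w z ht) hrS
    have := abs_le.1 hr
    rcases le_total r s with h | h
    · exact Or.inl ⟨_, hrS', he.mem_Seg_of_le iR' hs (by linarith) h⟩
    · exact Or.inr ⟨_, hrS', he.mem_Seg_of_le hs iR h (by linarith)⟩
  obtain ⟨z, hz, ⟨x, hx, hxL⟩, ⟨y, hy, hyR⟩⟩ := isPreconnected_closed_iff.1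
    (isPreconnected_Seg z₁ z₂) _ _
    (isClosed_Seg_meets w (isCompact_Seg (ε (s - R)) (ε s)).isClosed)
    (isClosed_Seg_meets w (isCompact_Seg (ε s) (ε (s + R))).isClosed) hcov
    ⟨z₁, left_mem_Seg _ _, (hcov (left_mem_Seg _ _)).resolve_right hz₁⟩
    ⟨z₂, right_mem_Seg _ _, (hcov (right_mem_Seg _ _)).resolve_left hz₂⟩
  refine ⟨z, hf'.Seg_subset_face hκ hz₁F hz₂F hz,
    (hgood z (Seg_subset_ball hz₁b hz₂b hz)).2.1, Seg_subset_of_mem hx hy ?_⟩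
  rw [he.Seg_eq iR' hs (by linarith)] at hxL
  rw [he.Seg_eq hs iR (by linarith)] at hyR
  obtain ⟨r, hr, rfl⟩ := hxL
  obtain ⟨r', hr', rfl⟩ := hyR
  exact he.mem_Seg_of_le ⟨iR'.1.trans_le hr.1, hr.2.trans_lt hs.2⟩
    ⟨hs.1.trans_le hr'.1, hr'.2.trans_lt iR.2⟩ hr.2 hr'.1

end EdgeParam

end EdgeCrossing

end

section

section EdgeFunctions

variable {κ : ℝ} {X : Type*} [MetricSpace X]

lemma mU_line (ρ : ℝ) (hκ : κ ≤ 0) (hρ : 0 < ρ) (a : ℝ) : mU κ ρ (a + ρ) (ρ - a) = mR κ a := by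
  unfold mU mR
  split_ifs with h
  · field_simp; ring
  · have hk : 0 < Real.sqrt (-κ) := Real.sqrt_pos.2 (by linarith [hκ.lt_of_ne h])
    have hs : Real.sinh (Real.sqrt (-κ) * ρ) ≠ 0 := (Real.sinh_pos_iff.2 (by positivity)).ne'
    rw [mul_add, mul_sub, Real.cosh_add, Real.cosh_sub]
    field_simp; ring

lemma mR_neg (a : ℝ) : mR κ (-a) = - mR κ a := by
  unfold mR
  split_ifs
  · rfl
  · rw [mul_neg, Real.sinh_neg]

lemma mR_abs_sq (a : ℝ) : mR κ |a| ^ 2 = mR κ a ^ 2 := by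
  rcases abs_choice a with h | h <;> rw [h]
  rw [mR_neg, neg_sq]

/-- The half-plane coordinate around the point `ε s₀` of an edge parametrized by `ε`. -/
def halfCoord (κ : ℝ) (ε : ℝ → X) (s₀ ρ : ℝ) (x : X) : ℂ :=
  ⟨mU κ ρ (dist x (ε (s₀ - ρ))) (dist x (ε (s₀ + ρ))),
    Real.sqrt (mR κ (dist x (ε s₀)) ^ 2 -
      mU κ ρ (dist x (ε (s₀ - ρ))) (dist x (ε (s₀ + ρ))) ^ 2)⟩

lemma halfCoord_im_nonneg (ε : ℝ → X) (s₀ ρ : ℝ) (x : X) : 0 ≤ (halfCoord κ ε s₀ ρ x).im :=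
  Real.sqrt_nonneg _

lemma continuous_halfCoord (ε : ℝ → X) (s₀ ρ : ℝ) : Continuous (halfCoord κ ε s₀ ρ) := by
  have hU : Continuous fun x => mU κ ρ (dist x (ε (s₀ - ρ))) (dist x (ε (s₀ + ρ))) :=
    (continuous_mU ρ).comp (by fun_prop : Continuous fun x =>
      (dist x (ε (s₀ - ρ)), dist x (ε (s₀ + ρ))))
  have hR : Continuous fun x => mR κ (dist x (ε s₀)) := continuous_mR.comp (by fun_prop)
  have h : halfCoord κ ε s₀ ρ = fun x => Complex.equivRealProdCLM.symm
      (mU κ ρ (dist x (ε (s₀ - ρ))) (dist x (ε (s₀ + ρ))),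
        Real.sqrt (mR κ (dist x (ε s₀)) ^ 2 -
          mU κ ρ (dist x (ε (s₀ - ρ))) (dist x (ε (s₀ + ρ))) ^ 2)) := by
    funext x; apply Complex.ext <;> simp [halfCoord]
  rw [h]
  exact Complex.equivRealProdCLM.symm.continuous.comp
    (hU.prodMk (Real.continuous_sqrt.comp ((hR.pow 2).sub (hU.pow 2))))

variable [Cat0 X] {PC : PolyComplex2 κ X} {e : Set X} {ε : ℝ → X} {L s₀ ρ : ℝ}

namespace EdgeNbhd

variable (hn : EdgeNbhd PC e ε L s₀ ρ) (hκ : κ ≤ 0)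
include hn

lemma dist_eq {s t : ℝ} (hs : |s - s₀| ≤ ρ) (ht : |t - s₀| ≤ ρ) : dist (ε s) (ε t) = |s - t| :=
  hn.param.dist_eq (hn.mem_Ioo hs) (hn.mem_Ioo ht)

lemma abs_left : |s₀ - ρ - s₀| ≤ ρ := by simp [abs_of_pos hn.pos]
lemma abs_right : |s₀ + ρ - s₀| ≤ ρ := by simp [abs_of_pos hn.pos]
lemma abs_base : |s₀ - s₀| ≤ ρ := by simpa using hn.pos.le

include hκ

lemma coord_line {s : ℝ} (hs : |s - s₀| ≤ ρ) :
    mU κ ρ (dist (ε s) (ε (s₀ - ρ))) (dist (ε s) (ε (s₀ + ρ))) = mR κ (s - s₀) := by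
  have h := abs_le.1 hs
  rw [hn.dist_eq hs hn.abs_left, hn.dist_eq hs hn.abs_right, abs_of_nonneg (by linarith),
    abs_of_nonpos (by linarith), ← mU_line ρ hκ hn.pos (s - s₀)]
  congr 1 <;> ring

lemma halfCoord_edge {s : ℝ} (hs : |s - s₀| ≤ ρ) :
    halfCoord κ ε s₀ ρ (ε s) = (mR κ (s - s₀) : ℝ) := by
  unfold halfCoord
  rw [hn.coord_line hκ hs, hn.dist_eq hs hn.abs_base, mR_abs_sq, sub_self, Real.sqrt_zero]
  rfl

/-- In a page, the half-plane coordinate is the modulus of a planar chart. -/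
lemma exists_page_frame {F : Set X} (hF : F ∈ PC.faces) (hb : ε s₀ ∈ closure F) {f : X → ℝ × ℝ}
    (hf : FaceChart κ F f) : ∃ Θ : (ℝ × ℝ) ≃ₜ ℂ, ∀ x ∈ closure F,
      (Θ (f x)).re = mU κ ρ (dist x (ε (s₀ - ρ))) (dist x (ε (s₀ + ρ))) ∧
      ‖Θ (f x)‖ = mR κ (dist x (ε s₀)) := by
  have hl := hn.pages F hF hb _ hn.abs_left
  have hr := hn.pages F hF hb _ hn.abs_right
  obtain ⟨Θ, hΘ⟩ := exists_frame hκ hn.pos (c₀ := f (ε s₀)) (c₁ := f (ε (s₀ - ρ)))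
    (c₂ := f (ε (s₀ + ρ)))
    (by rw [hf.isom _ hl _ hb, hn.dist_eq hn.abs_left hn.abs_base]; simp [hn.pos.le])
    (by rw [hf.isom _ hr _ hb, hn.dist_eq hn.abs_right hn.abs_base]; simp [hn.pos.le])
    (by
      rw [hf.isom _ hl _ hr, hn.dist_eq hn.abs_left hn.abs_right, abs_of_nonpos (by linarith [hn.pos])]
      ring)
  refine ⟨Θ, fun x hx => ?_⟩
  obtain ⟨h1, h2⟩ := hΘ (f x)
  rw [hf.isom x hx _ hl, hf.isom x hx _ hr] at h1
  rw [hf.isom x hx _ hb] at h2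
  exact ⟨h1, h2⟩

/-- In a page, the half-plane coordinate is a planar chart. -/
lemma exists_page_chart {F : Set X} (hF : F ∈ PC.faces) (hb : ε s₀ ∈ closure F) {f : X → ℝ × ℝ}
    (hf : FaceChart κ F f) : ∃ Θ : (ℝ × ℝ) ≃ₜ ℂ,
      (∀ x ∈ F ∩ closedBall (ε s₀) ρ, halfCoord κ ε s₀ ρ x = Θ (f x) ∧ 0 < (Θ (f x)).im) ∧
      (∀ x ∈ closure F, ‖Θ (f x)‖ = mR κ (dist x (ε s₀))) ∧
      ∀ s, |s - s₀| ≤ ρ → Θ (f (ε s)) = (mR κ (s - s₀) : ℝ) := by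
  obtain ⟨Θ, hΘ⟩ := hn.exists_page_frame hκ hF hb hf
  have hnorm : ∀ x ∈ closure F, mR κ (dist x (ε s₀)) ^ 2 -
      mU κ ρ (dist x (ε (s₀ - ρ))) (dist x (ε (s₀ + ρ))) ^ 2 = (Θ (f x)).im ^ 2 := by
    intro x hx
    obtain ⟨h1, h2⟩ := hΘ x hx
    rw [← h1, ← h2, Complex.sq_norm, Complex.normSq_apply]; ring
  have habs : ∀ x ∈ closure F, halfCoord κ ε s₀ ρ x = ⟨(Θ (f x)).re, |(Θ (f x)).im|⟩ := by
    intro x hx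
    unfold halfCoord
    rw [hnorm x hx, Real.sqrt_sq_eq_abs, (hΘ x hx).1]
  have hedge : ∀ s, |s - s₀| ≤ ρ → Θ (f (ε s)) = (mR κ (s - s₀) : ℝ) := by
    intro s hs
    have h1 := hn.halfCoord_edge hκ hs
    rw [habs _ (hn.pages F hF hb s hs)] at h1
    have h2 := congrArg Complex.re h1
    have h3 := congrArg Complex.im h1
    simp only [Complex.ofReal_im, abs_eq_zero, Complex.ofReal_re] at h2 h3
    exact Complex.ext h2 (by rw [h3, Complex.ofReal_im])
  have hne : ∀ x ∈ F ∩ closedBall (ε s₀) ρ, (Θ (f x)).im ≠ 0 := by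
    rintro x ⟨hxF, hxb⟩ h0
    have hx := subset_closure hxF
    have h1 := (hΘ x hx).2
    have h2 : Θ (f x) = ((Θ (f x)).re : ℂ) := Complex.ext rfl (by simp [h0])
    rw [h2, Complex.norm_real, Real.norm_eq_abs] at h1
    have hd : dist x (ε s₀) ≤ ρ := hxb
    obtain ⟨s, hs, hse⟩ : ∃ s, |s - s₀| ≤ ρ ∧ mR κ (s - s₀) = (Θ (f x)).re := by
      rcases abs_choice (Θ (f x)).re with h3 | h3
      · refine ⟨s₀ + dist x (ε s₀), by simpa, ?_⟩
        rw [add_sub_cancel_left, ← h1, h3]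
      · refine ⟨s₀ - dist x (ε s₀), by simpa, ?_⟩
        rw [sub_sub_cancel_left, mR_neg, ← h1, h3, neg_neg]
    have h3 : Θ (f (ε s)) = Θ (f x) := by rw [hedge s hs, hse, ← h2]
    have h4 := hf.injOn hκ (hn.pages F hF hb s hs) hx (Θ.injective h3)
    exact hn.param.not_mem_face hκ hF (hn.param.mem_edge (hn.mem_Ioo hs)) (h4 ▸ hxF)
  have hsign : (∀ x ∈ F ∩ closedBall (ε s₀) ρ, 0 < (Θ (f x)).im) ∨
      ∀ x ∈ F ∩ closedBall (ε s₀) ρ, (Θ (f x)).im < 0 := by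
    by_contra hcon
    push Not at hcon
    obtain ⟨⟨x, hx, hx0⟩, y, hy, hy0⟩ := hcon
    have hsub : Seg x y ⊆ F ∩ closedBall (ε s₀) ρ :=
      subset_inter (hf.Seg_subset_face hκ hx.1 hy.1) (Seg_subset_closedBall hx.2 hy.2)
    have hc : ContinuousOn (fun x => (Θ (f x)).im) (Seg x y) :=
      (Complex.continuous_im.comp Θ.continuous).comp_continuousOn
        ((hf.continuousOn hκ).mono (hsub.trans (inter_subset_left.trans subset_closure)))
    obtain ⟨z, hz, hz0⟩ := (isPreconnected_Seg x y).intermediate_value (left_mem_Seg _ _)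
      (right_mem_Seg _ _) hc ⟨hx0, hy0⟩
    exact hne z (hsub hz) hz0
  rcases hsign with h | h
  · refine ⟨Θ, fun x hx => ⟨?_, h x hx⟩, fun x hx => (hΘ x hx).2, hedge⟩
    rw [habs x (subset_closure hx.1), abs_of_pos (h x hx)]
  · refine ⟨Θ.trans Complex.conjCLE.toHomeomorph, fun x hx => ⟨?_, ?_⟩, fun x hx => ?_,
      fun s hs => ?_⟩
    · rw [habs x (subset_closure hx.1), abs_of_neg (h x hx)]
      exact Complex.ext (by simp) (by simp)
    · simpa using h x hx
    · simpa using (hΘ x hx).2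
    · simp [hedge s hs]

lemma norm_halfCoord {x : X} (hx : x ∈ closedBall (ε s₀) ρ) :
    ‖halfCoord κ ε s₀ ρ x‖ = mR κ (dist x (ε s₀)) := by
  rcases hn.cases x hx with h | ⟨F, hF, hb, hxF⟩
  · obtain ⟨s, hs, rfl⟩ := hn.exists_param h hx
    have h0 := (mR_strictMono hκ).monotone (abs_nonneg (s - s₀))
    rw [mR_zero] at h0
    rw [hn.halfCoord_edge hκ hs, Complex.norm_real, hn.dist_eq hs hn.abs_base, Real.norm_eq_abs,
      ← abs_of_nonneg h0]
    exact (sq_eq_sq_iff_abs_eq_abs _ _).1 (mR_abs_sq _).symm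
  · obtain ⟨f, hf⟩ := PC.exists_faceChart hκ hF
    obtain ⟨Θ, h1, h2, -⟩ := hn.exists_page_chart hκ hF hb hf
    rw [(h1 x ⟨hxF, hx⟩).1, h2 x (subset_closure hxF)]

end EdgeNbhd

/-- The half-plane coordinate, extended to `X` by radial projection. -/
def edgeCoord (κ : ℝ) (ε : ℝ → X) (s₀ ρ : ℝ) (x : X) : ℂ :=
  halfCoord κ ε s₀ ρ (clamp (ε s₀) ρ x)

open Classical in
/-- The planar coordinate unfolding the page `F` to a half-plane and all other pages to the
opposite half-plane. -/
def pageCoord (κ : ℝ) (ε : ℝ → X) (s₀ ρ : ℝ) (F : Set X) (x : X) : ℂ :=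
  if clamp (ε s₀) ρ x ∈ F then edgeCoord κ ε s₀ ρ x
  else (starRingEnd ℂ) (edgeCoord κ ε s₀ ρ x)

lemma edgeCoord_im_nonneg (ε : ℝ → X) (s₀ ρ : ℝ) (x : X) : 0 ≤ (edgeCoord κ ε s₀ ρ x).im :=
  halfCoord_im_nonneg _ _ _ _

namespace EdgeNbhd

variable (hn : EdgeNbhd PC e ε L s₀ ρ) (hκ : κ ≤ 0)
include hn

lemma continuous_edgeCoord : Continuous (edgeCoord κ ε s₀ ρ) :=
  (continuous_halfCoord _ _ _).comp (continuous_clamp hn.pos)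

include hκ

lemma edgeCoord_eq_zero {x : X} : edgeCoord κ ε s₀ ρ x = 0 ↔ x = ε s₀ := by
  rw [edgeCoord, ← norm_eq_zero, hn.norm_halfCoord hκ (clamp_mem_closedBall hn.pos),
    ← mR_zero (κ := κ), (mR_strictMono hκ).injective.eq_iff, dist_eq_zero,
    clamp_eq_self_iff hn.pos]

lemma edgeCoord_edge {s : ℝ} (hs : |s - s₀| ≤ ρ) :
    edgeCoord κ ε s₀ ρ (ε s) = (mR κ (s - s₀) : ℝ) := by
  rw [edgeCoord, clamp_of_dist_le hn.pos, hn.halfCoord_edge hκ hs]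
  rwa [dist_comm, hn.dist_eq hs hn.abs_base]

lemma edgeCoord_im_eq_zero {x : X} (hx : clamp (ε s₀) ρ x ∈ e) :
    (edgeCoord κ ε s₀ ρ x).im = 0 := by
  obtain ⟨s, hs, h⟩ := hn.exists_param hx (clamp_mem_closedBall hn.pos)
  rw [edgeCoord, ← h, hn.halfCoord_edge hκ hs, Complex.ofReal_im]

lemma continuous_pageCoord {F : Set X} (hF : F ∈ PC.faces) :
    Continuous (pageCoord κ ε s₀ ρ F) := by
  classical
  unfold pageCoord
  refine Continuous.if ?_ hn.continuous_edgeCoord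
    (Complex.continuous_conj.comp hn.continuous_edgeCoord)
  intro x hx
  have hc := continuous_clamp (o := ε s₀) hn.pos
  have hopen : IsOpen {x | clamp (ε s₀) ρ x ∈ F} := (PC.faces_open F hF).preimage hc
  rw [hopen.frontier_eq] at hx
  have h1 : clamp (ε s₀) ρ x ∈ closure F := by
    have := hc.closure_preimage_subset F hx.1
    exact this
  rw [eq_comm, Complex.conj_eq_iff_im]
  rcases hn.cases _ (clamp_mem_closedBall hn.pos (x := x)) with h | ⟨F', hF', -, hxF'⟩
  · exact hn.edgeCoord_im_eq_zero hκ h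
  · obtain ⟨z, hz, hzF⟩ := mem_closure_iff.1 h1 F' (PC.faces_open F' hF') hxF'
    exact (hx.2 (PolyComplex2.face_eq hF hF' hzF hz ▸ hxF')).elim

lemma pageCoord_of_mem {F : Set X} {x : X} (hx : x ∈ F) (hxb : x ∈ closedBall (ε s₀) ρ) :
    pageCoord κ ε s₀ ρ F x = halfCoord κ ε s₀ ρ x := by
  have h : clamp (ε s₀) ρ x = x := clamp_of_dist_le hn.pos (mem_closedBall'.1 hxb)
  rw [pageCoord, edgeCoord, h, if_pos hx]

lemma isDisc_pageCoord {F : Set X} (hF : F ∈ PC.faces) (hb : ε s₀ ∈ closure F) :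
    IsDisc (pageCoord κ ε s₀ ρ F) (F ∩ ball (ε s₀) ρ) := by
  obtain ⟨f, hf⟩ := PC.exists_faceChart hκ hF
  obtain ⟨Θ, h1, h2, -⟩ := hn.exists_page_chart hκ hF hb hf
  have hsub : F ∩ ball (ε s₀) ρ ⊆ F ∩ closedBall (ε s₀) ρ :=
    inter_subset_inter_right _ ball_subset_closedBall
  refine ⟨hn.continuous_pageCoord hκ hF, (PC.faces_open F hF).inter isOpen_ball, ?_, ?_⟩
  · intro z hz x hx
    obtain ⟨hz1, hz2⟩ := h1 z (hsub hz)
    rw [hn.pageCoord_of_mem hκ hz.1 (hsub hz).2, hz1] at hx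
    have hxF : clamp (ε s₀) ρ x ∈ F := by
      by_contra h
      rw [pageCoord, if_neg h] at hx
      have h3 := congrArg Complex.im hx
      rw [Complex.conj_im] at h3
      linarith [edgeCoord_im_nonneg (κ := κ) ε s₀ ρ x]
    have hxc : clamp (ε s₀) ρ x ∈ closedBall (ε s₀) ρ := clamp_mem_closedBall hn.pos
    rw [pageCoord, if_pos hxF, edgeCoord, (h1 _ ⟨hxF, hxc⟩).1] at hx
    have h3 := hf.injOn hκ (subset_closure hxF) (subset_closure hz.1) (Θ.injective hx)
    have h4 := dist_clamp (o := ε s₀) (x := x) hn.pos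
    have h5 : dist (ε s₀) z < ρ := mem_ball'.1 hz.2
    rw [h3] at h4
    rw [clamp_of_dist_le hn.pos] at h3
    · exact h3
    · by_contra h6
      rw [min_eq_left (not_le.1 h6).le] at h4
      linarith
  · intro V hV hVo
    have : pageCoord κ ε s₀ ρ F '' V = Θ '' (f '' V) := by
      rw [image_image]
      exact image_congr fun x hx => by
        rw [hn.pageCoord_of_mem hκ (hV hx).1 (hsub (hV hx)).2, (h1 x (hsub (hV hx))).1]
    rw [this]
    exact Θ.isOpenMap _ (hf.isOpen_image hκ (hV.trans inter_subset_left) hVo)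

/-- A page covers a whole half-disc. -/
lemma exists_pageCoord_eq {F : Set X} (hF : F ∈ PC.faces) (hb : ε s₀ ∈ closure F) {ζ : ℂ}
    (hζ : 0 < ζ.im) (hζρ : ‖ζ‖ < mR κ ρ) :
    ∃ z ∈ F, dist z (ε s₀) < ρ ∧ mR κ (dist z (ε s₀)) = ‖ζ‖ ∧ pageCoord κ ε s₀ ρ F z = ζ := by
  obtain ⟨f, hf⟩ := PC.exists_faceChart hκ hF
  obtain ⟨Θ, h1, h2, h3⟩ := hn.exists_page_chart hκ hF hb hf
  have hsub : F ∩ ball (ε s₀) ρ ⊆ F ∩ closedBall (ε s₀) ρ :=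
    inter_subset_inter_right _ ball_subset_closedBall
  set H : Set ℂ := {ζ | 0 < ζ.im} ∩ ball 0 (mR κ ρ) with hH
  have hHc : IsPreconnected H := ((convex_halfSpace_im_gt 0).inter (convex_ball _ _)).isPreconnected
  have hfc : IsClosed (f '' closure F) := by
    have : f '' closure F = kl κ ⁻¹' ((fun x => kl κ (f x)) '' closure F) := by
      rw [← image_image (kl κ) f, preimage_image_eq _ isOpenEmbedding_kl.injective]
    rw [this]; exact hf.closed.preimage isOpenEmbedding_kl.continuous
  have hUo : IsOpen (Θ '' (f '' (F ∩ ball (ε s₀) ρ))) := Θ.isOpenMap _ (hf.isOpen_image hκ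
    inter_subset_left ((PC.faces_open F hF).inter isOpen_ball))
  have hmem : ∀ x ∈ closure F, Θ (f x) ∈ H → x ∈ F ∩ ball (ε s₀) ρ := by
    intro x hx hxH
    have hxb : x ∈ ball (ε s₀) ρ := by
      have := hxH.2
      rw [mem_ball_zero_iff, h2 x hx] at this
      exact (mR_strictMono hκ).lt_iff_lt.1 this
    refine ⟨?_, hxb⟩
    rcases hn.cases x (ball_subset_closedBall hxb) with h | ⟨F', hF', -, hxF'⟩
    · obtain ⟨s, hs, rfl⟩ := hn.exists_param h (ball_subset_closedBall hxb)
      have := hxH.1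
      rw [h3 s hs, mem_ofPred_eq, Complex.ofReal_im] at this
      exact (lt_irrefl _ this).elim
    · obtain ⟨z, hz, hzF⟩ := mem_closure_iff.1 hx F' (PC.faces_open F' hF') hxF'
      exact PolyComplex2.face_eq hF hF' hzF hz ▸ hxF'
  have hcov : H ⊆ Θ '' (f '' (F ∩ ball (ε s₀) ρ)) ∪ (Θ '' (f '' closure F))ᶜ := by
    intro ζ hζ
    by_cases h : ζ ∈ Θ '' (f '' closure F)
    · obtain ⟨_, ⟨x, hx, rfl⟩, rfl⟩ := h
      exact Or.inl ⟨_, ⟨x, hmem x hx hζ, rfl⟩, rfl⟩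
    · exact Or.inr h
  have hζH : ζ ∈ H := ⟨hζ, mem_ball_zero_iff.2 hζρ⟩
  obtain ⟨x₀, hx₀, hx₀F⟩ := mem_closure_iff.1 hb _ isOpen_ball (mem_ball_self hn.pos)
  have hx₀H : Θ (f x₀) ∈ H := ⟨(h1 x₀ (hsub ⟨hx₀F, hx₀⟩)).2, by
    rw [mem_ball_zero_iff, h2 x₀ (subset_closure hx₀F)]
    exact mR_strictMono hκ hx₀⟩
  have hζU : ζ ∈ Θ '' (f '' (F ∩ ball (ε s₀) ρ)) := by
    by_contra hcon
    obtain ⟨ξ, -, ⟨_, ⟨x, hx, rfl⟩, rfl⟩, hξ⟩ := hHc _ _ hUo (Θ.isClosedMap _ hfc).isOpen_compl hcov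
      ⟨_, hx₀H, _, ⟨x₀, ⟨hx₀F, hx₀⟩, rfl⟩, rfl⟩ ⟨ζ, hζH, (hcov hζH).resolve_left hcon⟩
    exact hξ ⟨_, ⟨x, subset_closure hx.1, rfl⟩, rfl⟩
  obtain ⟨_, ⟨z, hz, rfl⟩, rfl⟩ := hζU
  refine ⟨z, hz.1, hz.2, (h2 z (subset_closure hz.1)).symm, ?_⟩
  rw [hn.pageCoord_of_mem hκ hz.1 (hsub hz).2, (h1 z (hsub hz)).1]

/-- The multiplicative relation between the page coordinates. -/
lemma prod_pageCoord (δ : ℝ) (x : X) :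
    ((starRingEnd ℂ) (edgeCoord κ ε s₀ ρ x) + δ * Complex.I) *
      (∏ F ∈ (PC.finite_pages (ε s₀)).toFinset, (pageCoord κ ε s₀ ρ F x - δ * Complex.I)) *
      ((starRingEnd ℂ) (edgeCoord κ ε s₀ ρ x) - δ * Complex.I) =
    (Complex.normSq (edgeCoord κ ε s₀ ρ x - δ * Complex.I) : ℂ) *
      ((starRingEnd ℂ) (edgeCoord κ ε s₀ ρ x) - δ * Complex.I) ^
        (PC.finite_pages (ε s₀)).toFinset.card := by
  classical
  set A := edgeCoord κ ε s₀ ρ x with hA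
  have hns : (Complex.normSq (A - δ * Complex.I) : ℂ) =
      ((starRingEnd ℂ) A + δ * Complex.I) * (A - δ * Complex.I) := by
    rw [Complex.normSq_eq_conj_mul_self]
    congr 1
    simp
  rw [hns]
  set S := (PC.finite_pages (ε s₀)).toFinset with hS
  rcases hn.cases _ (clamp_mem_closedBall hn.pos (x := x)) with h | ⟨F', hF', hb, hxF'⟩
  · have hconj : (starRingEnd ℂ) A = A := Complex.conj_eq_iff_im.2 (hn.edgeCoord_im_eq_zero hκ h)
    have : ∀ F ∈ S, pageCoord κ ε s₀ ρ F x - δ * Complex.I = A - δ * Complex.I := by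
      intro F _
      rw [pageCoord, ← hA, hconj, ite_self]
    rw [Finset.prod_congr rfl this, Finset.prod_const, hconj]
    ring
  · have hmem : F' ∈ S := by rw [hS, Set.Finite.mem_toFinset]; exact ⟨hF', hb⟩
    have : ∀ F ∈ S.erase F', pageCoord κ ε s₀ ρ F x - δ * Complex.I =
        (starRingEnd ℂ) A - δ * Complex.I := by
      intro F hF
      rw [Finset.mem_erase, hS, Set.Finite.mem_toFinset] at hF
      rw [pageCoord, if_neg]
      exact fun h => hF.1 (PolyComplex2.face_eq hF.2.1 hF' h hxF')
    rw [← Finset.mul_prod_erase S _ hmem, Finset.prod_congr rfl this, Finset.prod_const,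
      ← Finset.card_erase_add_one hmem, pow_succ, pageCoord, if_pos hxF']
    ring

variable {T : Type*} [TopologicalSpace T] {J : C(T, X)}

/-- If all page coordinates have logarithms along `J`, so does the folded coordinate. -/
lemma hasLog_edgeCoord {δ : ℝ} (hδ : 0 < δ)
    (h0 : ∀ t, edgeCoord κ ε s₀ ρ (J t) ≠ δ * Complex.I)
    (h : ∀ F ∈ PC.faces, ε s₀ ∈ closure F →
      HasLog fun t => pageCoord κ ε s₀ ρ F (J t) - δ * Complex.I) :
    HasLog fun t => (starRingEnd ℂ) (edgeCoord κ ε s₀ ρ (J t)) + δ * Complex.I := by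
  have hA := hn.continuous_edgeCoord.comp J.continuous
  simp only [Function.comp_def] at hA
  have hAc := Complex.continuous_conj.comp hA
  simp only [Function.comp_def] at hAc
  have h1 : HasLog fun t => (starRingEnd ℂ) (edgeCoord κ ε s₀ ρ (J t)) - δ * Complex.I := by
    have him : ∀ t, ((starRingEnd ℂ) (edgeCoord κ ε s₀ ρ (J t)) - δ * Complex.I).im < 0 := by
      intro t
      have := edgeCoord_im_nonneg (κ := κ) ε s₀ ρ (J t)
      simp; linarith
    refine hasLog_of_im_nonpos (hAc.sub continuous_const) (fun t h => ?_) fun t => (him t).le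
    have := him t
    rw [h] at this; simp at this
  have h2 : HasLog fun t => (Complex.normSq (edgeCoord κ ε s₀ ρ (J t) - δ * Complex.I) : ℂ) := by
    refine hasLog_of_slitPlane ?_ fun t => ?_
    · exact Complex.continuous_ofReal.comp (Complex.continuous_normSq.comp
        (hA.sub continuous_const))
    · exact Complex.ofReal_mem_slitPlane.2 (Complex.normSq_pos.2 (sub_ne_zero.2 (h0 t)))
  have h3 : HasLog fun t => ∏ F ∈ (PC.finite_pages (ε s₀)).toFinset,
      (pageCoord κ ε s₀ ρ F (J t) - δ * Complex.I) :=
    HasLog.prod _ fun F hF => by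
      rw [Set.Finite.mem_toFinset] at hF
      exact h F hF.1 hF.2
  have h4 := (h2.mul (h1.pow (PC.finite_pages (ε s₀)).toFinset.card)).congr fun t =>
    hn.prod_pageCoord hκ δ (J t)
  refine HasLog.of_mul_left ?_ (h3.mul h1)
  exact h4.congr fun t => by ring

/-- If one page coordinate has no logarithm along a curve avoiding the edge point, there is another
such page. -/
lemma exists_not_hasLog (hJ : ε s₀ ∉ range J) {F : Set X} (hF : F ∈ PC.faces)
    (hb : ε s₀ ∈ closure F) (h : ¬ HasLog fun t => pageCoord κ ε s₀ ρ F (J t)) :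
    ∃ F' ∈ PC.faces, ε s₀ ∈ closure F' ∧ F' ≠ F ∧
      ¬ HasLog fun t => pageCoord κ ε s₀ ρ F' (J t) := by
  classical
  by_contra hcon
  push Not at hcon
  apply h
  have h0 : ∀ t, edgeCoord κ ε s₀ ρ (J t) ≠ 0 := fun t ht =>
    hJ ⟨t, (hn.edgeCoord_eq_zero hκ).1 ht⟩
  have hA := hn.continuous_edgeCoord.comp J.continuous
  simp only [Function.comp_def] at hA
  have hAc := Complex.continuous_conj.comp hA
  simp only [Function.comp_def] at hAc
  have h1 : HasLog fun t => (starRingEnd ℂ) (edgeCoord κ ε s₀ ρ (J t)) := by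
    refine hasLog_of_im_nonpos hAc (fun t h => h0 t ?_) fun t => ?_
    · simpa using h
    · simpa using edgeCoord_im_nonneg (κ := κ) ε s₀ ρ (J t)
  have h2 : HasLog fun t => (Complex.normSq (edgeCoord κ ε s₀ ρ (J t)) : ℂ) := by
    refine hasLog_of_slitPlane ?_ fun t => ?_
    · exact Complex.continuous_ofReal.comp (Complex.continuous_normSq.comp hA)
    · exact Complex.ofReal_mem_slitPlane.2 (Complex.normSq_pos.2 (h0 t))
  have hmem : F ∈ (PC.finite_pages (ε s₀)).toFinset := by
    rw [Set.Finite.mem_toFinset]; exact ⟨hF, hb⟩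
  have h3 : HasLog fun t => ∏ F ∈ ((PC.finite_pages (ε s₀)).toFinset).erase F,
      (pageCoord κ ε s₀ ρ F (J t)) :=
    HasLog.prod _ fun F' hF' => by
      rw [Finset.mem_erase, Set.Finite.mem_toFinset] at hF'
      exact hcon F' hF'.2.1 hF'.2.2 hF'.1
  have h4 := h2.mul (h1.pow (PC.finite_pages (ε s₀)).toFinset.card)
  refine HasLog.of_mul_left ?_ ((h1.mul h3).mul h1)
  refine h4.congr fun t => ?_
  have h5 := hn.prod_pageCoord hκ 0 (J t)
  simp only [Complex.ofReal_zero, zero_mul, add_zero, sub_zero] at h5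
  rw [← h5, ← Finset.mul_prod_erase _ _ hmem]
  ring

/-- Near an edge point off the curve, winding is constant on each page. -/
lemma exists_winds_iff [CompactSpace T] (hJ : ε s₀ ∉ range J) {F : Set X} (hF : F ∈ PC.faces)
    (hb : ε s₀ ∈ closure F) : ∃ r > 0, ∀ z ∈ F, z ∈ ball (ε s₀) r →
      (Winds J z ↔ ¬ HasLog fun t => pageCoord κ ε s₀ ρ F (J t)) := by
  have hd := hn.isDisc_pageCoord hκ hF hb
  have hP0 : ∀ x, pageCoord κ ε s₀ ρ F x = 0 ↔ x = ε s₀ := by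
    intro x
    rw [← hn.edgeCoord_eq_zero hκ, pageCoord]
    split_ifs
    · rfl
    · simp
  have hcJ := hd.cont.comp J.continuous
  simp only [Function.comp_def] at hcJ
  obtain ⟨δ, hδ, h⟩ := hasLog_sub_iff hcJ fun t ht => hJ ⟨t, (hP0 _).1 ht⟩
  have h1 : ∀ᶠ z in nhds (ε s₀), z ∉ range J ∧ z ∈ ball (ε s₀) ρ ∧
      ‖pageCoord κ ε s₀ ρ F z‖ < δ := by
    have hcl : IsClosed (range J) := (isCompact_range J.continuous).isClosed
    have hz : ‖pageCoord κ ε s₀ ρ F (ε s₀)‖ < δ := by rw [(hP0 _).2 rfl]; simpa using hδ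
    filter_upwards [hcl.isOpen_compl.mem_nhds hJ, ball_mem_nhds _ hn.pos,
      hd.cont.norm.continuousAt.eventually_mem (Iio_mem_nhds hz)] with z h1 h2 h3
    exact ⟨h1, h2, h3⟩
  obtain ⟨r, hr, hr'⟩ := Metric.eventually_nhds_iff_ball.1 h1
  refine ⟨r, hr, fun z hzF hz => ?_⟩
  obtain ⟨h2, h3, h4⟩ := hr' z hz
  rw [hd.winds_iff ⟨hzF, h3⟩ h2, ← h _ h4]

end EdgeNbhd

/-- If points of faces winding around `J` accumulate at an edge point off `J`, then for any face
`F` there is another face consisting of such points near the edge point. -/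
lemma EdgeParam.exists_winding_page (hκ : κ ≤ 0) (he : EdgeParam PC e ε L) {T : Type*}
    [TopologicalSpace T] [CompactSpace T] {J : C(T, X)} {b : X} (hbe : b ∈ e) (hbJ : b ∉ range J)
    (hb : b ∈ closure {z | z ∈ ⋃₀ PC.faces ∧ Winds J z}) (F : Set X) :
    ∃ F' ∈ PC.faces, b ∈ closure F' ∧ F' ≠ F ∧
      ∃ r > 0, ∀ z ∈ F', z ∈ ball b r → Winds J z := by
  obtain ⟨s, hs, rfl⟩ := he.image.symm ▸ hbe
  obtain ⟨ρ, hρ, hn⟩ := he.exists_edgeNbhd hκ hs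
  replace hn := hn ρ hρ le_rfl
  obtain ⟨F₁, hF₁, hbF₁, hlog⟩ : ∃ F₁ ∈ PC.faces, ε s ∈ closure F₁ ∧
      ¬ HasLog fun t => pageCoord κ ε s ρ F₁ (J t) := by
    have h1 : ∀ F : Set X, ∃ r > 0, F ∈ {F | F ∈ PC.faces ∧ ε s ∈ closure F} → ∀ z ∈ F,
        z ∈ ball (ε s) r → (Winds J z ↔ ¬ HasLog fun t => pageCoord κ ε s ρ F (J t)) := by
      intro F
      by_cases hF : F ∈ {F | F ∈ PC.faces ∧ ε s ∈ closure F}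
      · obtain ⟨r, hr, h⟩ := hn.exists_winds_iff hκ hbJ hF.1 hF.2
        exact ⟨r, hr, fun _ => h⟩
      · exact ⟨1, one_pos, fun h => (hF h).elim⟩
    choose r hr hrF using h1
    obtain ⟨R, hR, h⟩ : ∃ R > 0, ∀ F ∈ {F | F ∈ PC.faces ∧ ε s ∈ closure F}, R ≤ r F := by
      rcases {F | F ∈ PC.faces ∧ ε s ∈ closure F}.eq_empty_or_nonempty with h | h
      · exact ⟨1, one_pos, fun F hF => by rw [h] at hF; exact hF.elim⟩
      · obtain ⟨F₀, -, h0⟩ := exists_min_image _ r (PC.finite_pages _) h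
        exact ⟨r F₀, hr _, h0⟩
    obtain ⟨z, ⟨hzR, hzρ⟩, ⟨F₁, hF₁, hzF⟩, hzw⟩ := mem_closure_iff.1 hb _
      (isOpen_ball.inter isOpen_ball) ⟨mem_ball_self hR, mem_ball_self hρ⟩
    have hbF₁ := hn.page hF₁ hκ hzF (ball_subset_closedBall hzρ)
    exact ⟨F₁, hF₁, hbF₁, (hrF F₁ ⟨hF₁, hbF₁⟩ z hzF
      (ball_subset_ball (h F₁ ⟨hF₁, hbF₁⟩) hzR)).1 hzw⟩
  obtain ⟨F₂, hF₂, hbF₂, hne, hlog₂⟩ : ∃ F₁ ∈ PC.faces, ε s ∈ closure F₁ ∧ F₁ ≠ F ∧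
      ¬ HasLog fun t => pageCoord κ ε s ρ F₁ (J t) := by
    by_cases h : F₁ = F
    · obtain ⟨F₂, h1, h2, h3, h4⟩ := hn.exists_not_hasLog hκ hbJ hF₁ hbF₁ hlog
      exact ⟨F₂, h1, h2, h ▸ h3, h4⟩
    · exact ⟨F₁, hF₁, hbF₁, h, hlog⟩
  obtain ⟨r, hr, h⟩ := hn.exists_winds_iff hκ hbJ hF₂ hbF₂
  exact ⟨F₂, hF₂, hbF₂, hne, r, hr, fun z hzF hz => (h z hzF hz).2 hlog₂⟩

end EdgeFunctions

end

section

section Rays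

variable {κ : ℝ} {X : Type*} [MetricSpace X]

/-- The points of the open faces, off the curve `J`, around which `J` winds. -/
def windingSet (PC : PolyComplex2 κ X) {T : Type*} [TopologicalSpace T] (J : C(T, X)) : Set X :=
  {z | z ∉ range J ∧ z ∈ ⋃₀ PC.faces ∧ Winds J z}

variable [Cat0 X] {PC : PolyComplex2 κ X} {T : Type*} [TopologicalSpace T] [CompactSpace T]
  {J : C(T, X)}

lemma Seg_cases {q r m y : X} (hm : m ∈ Seg q r) (hy : y ∈ Seg q r) :
    y ∈ Seg q m ∨ y ∈ Seg m r := by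
  rcases le_total (dist q y) (dist q m) with h | h
  · exact Or.inl (mem_Seg_of_dist_le hm hy h)
  · exact Or.inr (Seg_trans hy (mem_Seg_of_dist_le hy hm h)).2

lemma isClosed_Seg_subset (w : X) {D : Set X} (hD : IsClosed D) : IsClosed {z | Seg w z ⊆ D} := by
  have : {z | Seg w z ⊆ D} = ⋂ t ∈ Icc (0 : ℝ) 1, {z | G w z t ∈ D} := by
    ext z
    simp only [mem_iInter, mem_ofPred_eq, Seg_eq_image, image_subset_iff]
    rfl
  rw [this]
  exact isClosed_biInter fun t _ => hD.preimage
    (continuous_G_comp continuous_const continuous_id continuous_const)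

lemma isCompact_fan (w : X) : IsCompact {z | ∃ t, z ∈ Seg w (J t)} := by
  have : {z | ∃ t, z ∈ Seg w (J t)} = (fun x : Icc (0 : ℝ) 1 × T => G w (J x.2) x.1) '' univ := by
    ext z
    constructor
    · rintro ⟨t, ht⟩
      rw [Seg_eq_image] at ht
      obtain ⟨s, hs, rfl⟩ := ht
      exact ⟨(⟨s, hs⟩, t), trivial, rfl⟩
    · rintro ⟨⟨⟨s, hs⟩, t⟩, -, rfl⟩
      exact ⟨t, G_mem_Seg _ _ hs⟩
  rw [this]
  exact isCompact_univ.image (continuous_G_comp continuous_const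
    (J.continuous.comp continuous_snd) (continuous_subtype_val.comp continuous_fst))

lemma isOpen_windingSet (hκ : κ ≤ 0) : IsOpen (windingSet PC J) := by
  rw [isOpen_iff_mem_nhds]
  rintro z ⟨hzJ, ⟨F, hF, hzF⟩, hzw⟩
  obtain ⟨f, hf⟩ := PC.exists_faceChart hκ hF
  filter_upwards [hf.eventually_winds_iff hκ hzF hzJ, (PC.faces_open F hF).mem_nhds hzF,
    (isCompact_range J.continuous).isClosed.isOpen_compl.mem_nhds hzJ] with z' h1 h2 h3
  exact ⟨h3, ⟨F, hF, h2⟩, h1.2 hzw⟩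

/-- From every point of the winding set, in every generic direction, there is a segment inside the
closure of the winding set which ends on the curve. -/
lemma exists_ray (hκ : κ ≤ 0) {w c : X} {F : Set X} (hF : F ∈ PC.faces)
    (hballF : closedBall w (dist w c) ⊆ F) (hball : closedBall w (dist w c) ⊆ windingSet PC J)
    (hgen : ∀ v ∈ PC.vertices, (∃ t, v ∈ Seg w (J t)) → c ∉ Seg w v) :
    ∃ t, c ∈ Seg w (J t) ∧ Seg w (J t) ⊆ closure (windingSet PC J) := by
  set Ω := windingSet PC J with hΩ
  have hΩo : IsOpen Ω := isOpen_windingSet hκ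
  have hwF : w ∈ F := hballF (mem_closedBall_self dist_nonneg)
  have hcb : c ∈ closedBall w (dist w c) := mem_closedBall'.2 le_rfl
  set Z : Set X := {z | z ∈ Ω ∧ c ∈ Seg w z ∧ Seg w z ⊆ closure Ω} with hZ
  have hcZ : c ∈ Z := ⟨hball hcb, right_mem_Seg _ _,
    (Seg_subset_closedBall (mem_closedBall_self dist_nonneg) hcb).trans
      (hball.trans subset_closure)⟩
  have hZfan : closure Z ⊆ {z | ∃ t, z ∈ Seg w (J t)} :=
    closure_minimal (fun z hz => hz.1.2.2.exists_mem_Seg w) (isCompact_fan w).isClosed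
  have hZcl : closure Z ⊆ {z | c ∈ Seg w z} ∩ {z | Seg w z ⊆ closure Ω} := by
    refine closure_minimal (fun z hz => ⟨hz.2.1, hz.2.2⟩) (IsClosed.inter ?_ ?_)
    · have : {z | c ∈ Seg w z} = {z | dist w c + dist c z = dist w z} := rfl
      rw [this]
      exact isClosed_eq (by fun_prop) (by fun_prop)
    · exact isClosed_Seg_subset w isClosed_closure
  obtain ⟨b, hbZ, hbmax⟩ := ((isCompact_fan w).of_isClosed_subset isClosed_closure hZfan).exists_isMaxOn
    ⟨c, subset_closure hcZ⟩ (f := fun z => dist w z) (by fun_prop)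
  obtain ⟨hcb', hbcl⟩ := hZcl hbZ
  have hmax : ∀ z ∈ Z, dist w z ≤ dist w b := fun z hz => hbmax (subset_closure hz)
  by_cases hmeet : ∃ u ∈ Seg w b, u ∈ range J
  · obtain ⟨u, hu, t, rfl⟩ := hmeet
    refine ⟨t, mem_Seg_of_dist_le hu hcb' ?_, (Seg_subset_left hu).trans hbcl⟩
    by_contra h
    exact (hball (mem_closedBall'.2 (not_le.1 h).le)).1 ⟨t, rfl⟩
  push Not at hmeet
  have hbJ := hmeet b (right_mem_Seg _ _)
  obtain ⟨t₀, ht₀⟩ := hZfan hbZ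
  have hvf : ∀ x ∈ Seg w b, x ∉ PC.vertices := by
    intro v hv hvv
    refine hgen v hvv ⟨t₀, Seg_subset_left ht₀ hv⟩ (mem_Seg_of_dist_le hv hcb' ?_)
    by_contra h
    exact PolyComplex2.not_mem_vertices (.inl hF)
      (hballF (mem_closedBall'.2 (not_le.1 h).le)) hvv
  have hbΩ : b ∈ closure Ω := hbcl (right_mem_Seg _ _)
  have hΩW : Ω ⊆ {z | z ∈ ⋃₀ PC.faces ∧ Winds J z} := fun z hz => hz.2
  have hbW : b ∈ closure {z | z ∈ ⋃₀ PC.faces ∧ Winds J z} := closure_mono hΩW hbΩ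
  have hext : ∀ z ∈ Ω, z ≠ b → b ∈ Seg w z → Seg b z ⊆ closure Ω → False := by
    intro z hz hzb hbz hsub
    have h1 := hmax z ⟨hz, Seg_subset_left hbz hcb', fun y hy =>
      (Seg_cases hbz hy).elim (fun h => hbcl h) fun h => hsub h⟩
    have h2 := dist_pos.2 hzb
    rw [mem_Seg] at hbz
    rw [dist_comm] at h2
    linarith
  exfalso
  rcases PC.cases b with ⟨F', hF', hbF'⟩ | ⟨e, he, hbe⟩ | hv
  · obtain ⟨f, hf⟩ := PC.exists_faceChart hκ hF'
    have hbw : b ∈ Ω := by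
      obtain ⟨z, hz1, hz2⟩ := (mem_closure_iff_frequently.1 hbΩ).and_eventually
        (hf.eventually_winds_iff hκ hbF' hbJ) |>.exists
      exact ⟨hbJ, ⟨F', hF', hbF'⟩, hz2.1 hz1.2.2⟩
    obtain ⟨r, hr, hrΩ⟩ := Metric.isOpen_iff.1 hΩo b hbw
    have hne : b ≠ J t₀ := fun h => hbJ ⟨t₀, h.symm⟩
    have hD := dist_pos.2 hne
    set τ := min 1 (r / (2 * dist b (J t₀))) with hτ
    have hτ0 : 0 < τ := by positivity
    have hτI : τ ∈ Icc (0 : ℝ) 1 := ⟨hτ0.le, min_le_left _ _⟩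
    have hd := dist_left_G b (J t₀) hτI
    have hzr : G b (J t₀) τ ∈ ball b r := by
      rw [mem_ball', hd]
      calc τ * dist b (J t₀) ≤ r / (2 * dist b (J t₀)) * dist b (J t₀) := by
            gcongr; exact min_le_right _ _
        _ = r / 2 := by field_simp
        _ < r := by linarith
    refine hext _ (hrΩ hzr) (fun h => ?_) ?_
      ((Seg_subset_ball (mem_ball_self hr) hzr).trans (hrΩ.trans subset_closure))
    · rw [h, dist_self] at hd
      exact (mul_pos hτ0 hD).ne hd
    · have h1 := G_mem_Seg b (J t₀) hτI
      rw [Seg_comm] at ht₀ h1 ⊢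
      exact (Seg_trans ht₀ h1).2
  · obtain ⟨ε, L, hp⟩ := PC.exists_edgeParam he
    have hwe : w ∉ e := fun h => hp.not_mem_face hκ hF h hwF
    obtain ⟨-, Fi, hFi, hbFi, w', hw', hw'b, hw'F⟩ := hp.arrival hκ hwe hbe hvf
    obtain ⟨Fj, hFj, hbFj, hne, r, hr, hwind⟩ := hp.exists_winding_page hκ hbe hbJ hbW Fi
    obtain ⟨r', hr', hr'J⟩ := Metric.isOpen_iff.1
      (isCompact_range J.continuous).isClosed.isOpen_compl b hbJ
    obtain ⟨z, hzF, hzb, hbz⟩ := hp.exists_continuation hκ hwe hbe hvf hFi hFj hne.symm hbFi hbFj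
      hw' hw'b hw'F (lt_min hr hr')
    obtain ⟨f, hf⟩ := PC.exists_faceChart hκ hFj
    have hΩmem : ∀ y ∈ Fj, y ∈ ball b (min r r') → y ∈ Ω := fun y hy hyb =>
      ⟨hr'J (ball_subset_ball (min_le_right _ _) hyb), ⟨Fj, hFj, hy⟩,
        hwind y hy (ball_subset_ball (min_le_left _ _) hyb)⟩
    refine hext z (hΩmem z hzF hzb) (fun h => hp.not_mem_face hκ hFj hbe (h ▸ hzF)) hbz ?_
    intro y hy
    by_cases hyb : y = b
    · rw [hyb]; exact hbΩ
    · refine subset_closure (hΩmem y ?_ (Seg_subset_ball (mem_ball_self (lt_min hr hr')) hzb hy))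
      rw [Seg_comm] at hy
      exact hf.mem_of_mem_Seg hκ hzF hbFj hy hyb
  · exact hvf b (right_mem_Seg _ _) hv

/-- Small geodesic circles about points of faces. -/
lemma exists_circle (hκ : κ ≤ 0) {F : Set X} (hF : F ∈ PC.faces) {w : X} (hw : w ∈ F) {U : Set X}
    (hU : U ∈ nhds w) : ∃ (r : ℝ) (C : ℝ → X), 0 < r ∧ closedBall w r ⊆ U ∧ Continuous C ∧
      (∀ θ, dist w (C θ) = r) ∧ (∀ θ, w ∈ Seg (C θ) (C (θ + Real.pi))) ∧
      ∀ x, {θ | C θ = x}.Countable := by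
  obtain ⟨f, hf⟩ := PC.exists_faceChart hκ hF
  obtain ⟨Θ, h0, h1, h2⟩ := exists_polar hκ (f w)
  obtain ⟨R, hR, hRU⟩ := Metric.nhds_basis_closedBall.mem_iff.1
    (inter_mem hU ((PC.faces_open F hF).mem_nhds hw))
  have hop : IsOpen (Θ '' (f '' ball w R)) := Θ.isOpenMap _
    (hf.isOpen_image hκ (ball_subset_closedBall.trans (hRU.trans inter_subset_right)) isOpen_ball)
  obtain ⟨η, hη, hηU⟩ := Metric.nhds_basis_closedBall.mem_iff.1
    (hop.mem_nhds ⟨_, ⟨w, mem_ball_self hR, rfl⟩, h0⟩)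
  have hex : ∀ θ : ℝ, ∃ x ∈ ball w R, Θ (f x) = η * Complex.exp (θ * Complex.I) := by
    intro θ
    obtain ⟨_, ⟨x, hx, rfl⟩, h⟩ := hηU (a := η * Complex.exp (θ * Complex.I)) (by
      rw [mem_closedBall_zero_iff, norm_mul, Complex.norm_exp_ofReal_mul_I, Complex.norm_real,
        Real.norm_of_nonneg hη.le, mul_one])
    exact ⟨x, hx, h⟩
  choose C hCb hC using hex
  have hCF : ∀ θ, C θ ∈ F := fun θ => (hRU (ball_subset_closedBall (hCb θ))).2
  have hwc := subset_closure hw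
  have hCc := fun θ => subset_closure (hCF θ)
  have hnorm : ∀ θ, mR κ (dist (C θ) w) = η := fun θ => by
    rw [← hf.isom _ (hCc θ) _ hwc, ← h1, hC, norm_mul, Complex.norm_exp_ofReal_mul_I,
      Complex.norm_real, Real.norm_of_nonneg hη.le, mul_one]
  have hdist : ∀ θ, dist w (C θ) = dist w (C 0) := fun θ => by
    rw [dist_comm w, dist_comm w]
    exact (mR_strictMono hκ).injective ((hnorm θ).trans (hnorm 0).symm)
  have hpos : 0 < dist w (C 0) := by
    rw [dist_comm, ← (mR_strictMono hκ).lt_iff_lt, hnorm, mR_zero]; exact hη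
  refine ⟨dist w (C 0), C, hpos, ?_, ?_, hdist, ?_, ?_⟩
  · exact (closedBall_subset_closedBall (mem_ball'.1 (hCb 0)).le).trans
      (hRU.trans inter_subset_left)
  · rw [continuous_iff_continuousAt]
    intro θ
    rw [ContinuousAt, Metric.tendsto_nhds]
    intro δ hδ
    obtain ⟨V, hV, hxV, h⟩ := hf.exists_dist_lt hκ (hCc θ) hδ
    have hcont : Continuous fun θ => f (C θ) := by
      have : (fun θ => f (C θ)) = fun θ : ℝ => Θ.symm (η * Complex.exp (θ * Complex.I)) := by
        funext θ; rw [← hC, Homeomorph.symm_apply_apply]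
      rw [this]
      exact Θ.symm.continuous.comp (by fun_prop)
    filter_upwards [hcont.continuousAt.eventually_mem (hV.mem_nhds hxV)] with θ' hθ'
    exact h _ (hCc θ') hθ'
  · intro θ
    have h3 := h2 (Θ (f (C θ)))
    have h4 : -Θ (f (C θ)) = Θ (f (C (θ + Real.pi))) := by
      rw [hC, hC]
      push_cast
      rw [add_mul, Complex.exp_add, Complex.exp_pi_mul_I]
      ring
    rw [h4, Homeomorph.symm_apply_apply, Homeomorph.symm_apply_apply,
      hf.isom _ (hCc _) _ (hCc _), hf.isom _ (hCc _) _ hwc] at h3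
    rw [mem_Seg, h3, hdist, dist_comm, hdist]; ring
  · intro x
    by_cases hx : ∃ θ₀, C θ₀ = x
    · obtain ⟨θ₀, rfl⟩ := hx
      refine (countable_range fun n : ℤ => θ₀ + n * (2 * Real.pi)).mono ?_
      intro θ hθ
      have h3 := hC θ
      rw [show C θ = C θ₀ from hθ, hC] at h3
      have h4 := mul_left_cancel₀ (by exact_mod_cast hη.ne' : (η : ℂ) ≠ 0) h3
      obtain ⟨n, hn⟩ := Complex.exp_eq_exp_iff_exists_int.1 h4
      refine ⟨-n, ?_⟩
      have h5 : (θ₀ : ℂ) = θ + n * (2 * Real.pi) := by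
        apply mul_right_cancel₀ Complex.I_ne_zero
        rw [hn]; ring
      have h6 : θ₀ = θ + n * (2 * Real.pi) := by exact_mod_cast h5
      simp only [h6]; push_cast; ring
    · have : {θ | C θ = x} = ∅ := eq_empty_of_forall_notMem fun θ h => hx ⟨θ, h⟩
      rw [this]; exact countable_empty

/-- If the range of `J` is the union of two compact sets, then every point of the winding set lies
on a segment in the closure of the winding set with both endpoints in one of these sets. -/
lemma exists_chord (hκ : κ ≤ 0) {α β : Set X} (hα : IsCompact α) (hβ : IsCompact β)
    (hJ : range J ⊆ α ∪ β) {w : X} (hw : w ∈ windingSet PC J) :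
    ∃ u v, (u ∈ α ∧ v ∈ α ∨ u ∈ β ∧ v ∈ β) ∧ w ∈ Seg u v ∧
      Seg u v ⊆ closure (windingSet PC J) := by
  set Ω := windingSet PC J with hΩ
  obtain ⟨F, hF, hwF⟩ := hw.2.1
  obtain ⟨r, C, hr, hrU, hCc, hCd, hCopp, hCcount⟩ := exists_circle hκ hF hwF
    (inter_mem ((isOpen_windingSet hκ).mem_nhds hw) ((PC.faces_open F hF).mem_nhds hwF))
  let A : Set X → Set ℝ := fun S => {θ | ∃ u ∈ S, C θ ∈ Seg w u ∧ Seg w u ⊆ closure Ω}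
  have hAcl : ∀ S, IsCompact S → IsClosed (A S) := by
    intro S hS
    have : A S = Prod.fst '' {x : ℝ × S | C x.1 ∈ Seg w x.2 ∧ Seg w (x.2 : X) ⊆ closure Ω} := by
      ext θ
      constructor
      · rintro ⟨u, hu, h⟩
        exact ⟨(θ, ⟨u, hu⟩), h, rfl⟩
      · rintro ⟨⟨θ', u⟩, h, rfl⟩
        exact ⟨u, u.2, h⟩
    rw [this]
    have : CompactSpace S := isCompact_iff_compactSpace.1 hS
    have hc₁ : IsClosed {x : ℝ × S |
        dist w (C x.1) + dist (C x.1) (x.2 : X) = dist w (x.2 : X)} :=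
      isClosed_eq (by fun_prop) (by fun_prop)
    have hc₂ : IsClosed {x : ℝ × S | Seg w (x.2 : X) ⊆ closure Ω} :=
      (isClosed_Seg_subset w isClosed_closure).preimage
        (continuous_subtype_val.comp continuous_snd)
    exact isClosedMap_fst_of_compactSpace _ (hc₁.inter hc₂)
  have hcov : A α ∪ A β = univ := by
    have hcount : {θ | ∃ v ∈ PC.vertices ∩ {z | ∃ t, z ∈ Seg w (J t)}, C θ ∈ Seg w v}.Countable := by
      have : {θ | ∃ v ∈ PC.vertices ∩ {z | ∃ t, z ∈ Seg w (J t)}, C θ ∈ Seg w v} =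
          ⋃ v ∈ PC.vertices ∩ {z | ∃ t, z ∈ Seg w (J t)}, {θ | C θ ∈ Seg w v} := by
        ext θ; simp only [mem_iUnion, exists_prop, mem_ofPred_eq]
      rw [this]
      refine (PC.finite_vertices_inter (isCompact_fan w)).countable.biUnion fun v _ => ?_
      by_cases hx : ∃ θ₀, C θ₀ ∈ Seg w v
      · obtain ⟨θ₀, hθ₀⟩ := hx
        exact (hCcount (C θ₀)).mono fun θ hθ =>
          eq_of_mem_Seg_of_dist_eq hθ hθ₀ ((hCd θ).trans (hCd θ₀).symm)
      · have : {θ | C θ ∈ Seg w v} = ∅ := eq_empty_of_forall_notMem fun θ h => hx ⟨θ, h⟩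
        rw [this]; exact countable_empty
    have hdense := hcount.dense_compl ℝ
    rw [← ((hAcl α hα).union (hAcl β hβ)).closure_eq]
    refine (hdense.mono ?_).closure_eq
    intro θ hθ
    obtain ⟨t, ht, hts⟩ := exists_ray hκ (J := J) (w := w) (c := C θ) hF
      (by rw [hCd]; exact hrU.trans inter_subset_right)
      (by rw [hCd]; exact hrU.trans inter_subset_left)
      (fun v hv hvt hc => hθ ⟨v, ⟨hv, hvt⟩, hc⟩)
    rcases hJ ⟨t, rfl⟩ with h | h
    · exact Or.inl ⟨_, h, ht, hts⟩
    · exact Or.inr ⟨_, h, ht, hts⟩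
  have hopp : ∀ S θ, θ ∈ A S → θ + Real.pi ∈ A S → ∃ u ∈ S, ∃ v ∈ S, w ∈ Seg u v ∧
      Seg u v ⊆ closure Ω := by
    rintro S θ ⟨u, hu, hCu, hsu⟩ ⟨v, hv, hCv, hsv⟩
    have hne : ∀ θ, C θ ≠ w := fun θ h => by
      have := hCd θ; rw [h, dist_self] at this; exact hr.ne this
    have hwuv := mem_Seg_of_local hCu (hne _) hCv (hne _) (hCopp θ)
    refine ⟨u, hu, v, hv, hwuv, fun y hy => ?_⟩
    rcases Seg_cases hwuv hy with h | h
    · rw [Seg_comm] at h; exact hsu h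
    · exact hsv h
  by_contra hcon
  have hnot : ∀ θ, ¬ (θ ∈ A α ∧ θ + Real.pi ∈ A α) ∧ ¬ (θ ∈ A β ∧ θ + Real.pi ∈ A β) := by
    refine fun θ => ⟨fun h => ?_, fun h => ?_⟩
    · obtain ⟨u, hu, v, hv, h1, h2⟩ := hopp α θ h.1 h.2
      exact hcon ⟨u, v, Or.inl ⟨hu, hv⟩, h1, h2⟩
    · obtain ⟨u, hu, v, hv, h1, h2⟩ := hopp β θ h.1 h.2
      exact hcon ⟨u, v, Or.inr ⟨hu, hv⟩, h1, h2⟩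
  have hmem : ∀ θ, θ ∈ A α ∨ θ ∈ A β := fun θ => by
    have : θ ∈ A α ∪ A β := hcov ▸ mem_univ θ
    exact this
  obtain ⟨h0, h0'⟩ := hnot 0
  have hα' : ∃ θ, θ ∈ A α := by
    rcases hmem 0 with h | h
    · exact ⟨_, h⟩
    · rcases hmem (0 + Real.pi) with h' | h'
      · exact ⟨_, h'⟩
      · exact (h0' ⟨h, h'⟩).elim
  have hβ' : ∃ θ, θ ∈ A β := by
    rcases hmem 0 with h | h
    · rcases hmem (0 + Real.pi) with h' | h'
      · exact (h0 ⟨h, h'⟩).elim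
      · exact ⟨_, h'⟩
    · exact ⟨_, h⟩
  obtain ⟨θ, -, h1, h2⟩ := isPreconnected_closed_iff.1 isPreconnected_univ _ _ (hAcl α hα)
    (hAcl β hβ) hcov.ge (by simpa [Set.Nonempty] using hα') (by simpa [Set.Nonempty] using hβ')
  rcases hmem (θ + Real.pi) with h | h
  · exact (hnot θ).1 ⟨h1, h⟩
  · exact (hnot θ).2 ⟨h2, h⟩

end Rays

end

section

/-! ### Crossing a segment -/

lemma exists_deriv_ne_zero {u : ℝ → ℝ} {a b : ℝ} (hab : a ≤ b) {K : NNReal}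
    (hu : LipschitzOnWith K u (Icc a b)) (hne : u a ≠ u b) : ∃ t ∈ Ioo a b, deriv u t ≠ 0 := by
  by_contra hcon
  push Not at hcon
  rw [← uIcc_of_le hab] at hu
  have h := hu.absolutelyContinuousOnInterval.integral_deriv_eq_sub
  rw [intervalIntegral.integral_of_le hab, MeasureTheory.integral_Ioc_eq_integral_Ioo,
    MeasureTheory.setIntegral_eq_zero_of_forall_eq_zero hcon] at h
  exact hne (by linarith)

/-- Along a curve crossing the axis `re = 0` from the left to the right, the principal logarithm
of the Möbius quotient below jumps. -/
lemma tendsto_log_quotient {l : Filter ℝ} {d : ℝ → ℂ} (hd : Tendsto d l (nhds 0)) {δ : ℝ}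
    (hδ : 0 < δ) :
    ((∀ᶠ t in l, 0 < (d t).re) → Tendsto (fun t => Complex.log
      ((d t - δ * Complex.I) / (d t + δ * Complex.I))) l (nhds (-(Real.pi * Complex.I)))) ∧
    ((∀ᶠ t in l, (d t).re < 0) → Tendsto (fun t => Complex.log
      ((d t - δ * Complex.I) / (d t + δ * Complex.I))) l (nhds (Real.pi * Complex.I))) := by
  have hδ' : (δ : ℂ) * Complex.I ≠ 0 := by simp [hδ.ne']
  have hlim : Tendsto (fun t => (d t - δ * Complex.I) / (d t + δ * Complex.I)) l (nhds (-1)) := by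
    have := (hd.sub_const (δ * Complex.I)).div (hd.add_const (δ * Complex.I)) (by simpa using hδ.ne')
    rwa [show (0 - δ * Complex.I) / (0 + δ * Complex.I) = (-1 : ℂ) by
      rw [zero_sub, zero_add, neg_div, div_self hδ']] at this
  have hne : ∀ᶠ t in l, d t + δ * Complex.I ≠ 0 :=
    (hd.add_const (δ * Complex.I)).eventually_ne (by simpa using hδ.ne')
  have him : ∀ z : ℂ, ((z - δ * Complex.I) / (z + δ * Complex.I)).im =
      -(2 * δ * z.re) / Complex.normSq (z + δ * Complex.I) := by
    intro z
    rw [Complex.div_im]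
    simp
    ring
  constructor
  · intro hre
    have h1 := Complex.tendsto_log_nhdsWithin_im_neg_of_re_neg_of_im_zero (z := -1) (by simp)
      (by simp)
    have h2 := h1.comp (tendsto_nhdsWithin_iff.2 ⟨hlim, by
      filter_upwards [hre, hne] with t ht hn
      rw [him]
      exact div_neg_of_neg_of_pos (by have := mul_pos hδ ht; linarith) (Complex.normSq_pos.2 hn)⟩)
    simpa [Function.comp_def] using h2
  · intro hre
    have h1 := (Complex.continuousWithinAt_log_of_re_neg_of_im_zero (z := -1) (by simp)
      (by simp)).tendsto
    have h2 := h1.comp (tendsto_nhdsWithin_iff.2 ⟨hlim, by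
      filter_upwards [hre, hne] with t ht hn
      rw [him]
      exact (div_pos (by have := mul_neg_of_pos_of_neg hδ ht; linarith)
        (Complex.normSq_pos.2 hn)).le⟩)
    simpa [Function.comp_def, Complex.log_neg_one] using h2

lemma quotient_mem_slitPlane {z : ℂ} {δ : ℝ} (hδ : 0 < δ) (hz : z.re = 0 → δ < |z.im|) :
    (z - δ * Complex.I) / (z + δ * Complex.I) ∈ Complex.slitPlane := by
  have hne : z + δ * Complex.I ≠ 0 := by
    intro h
    have h1 : z.re = 0 := by simpa using congrArg Complex.re h
    have h2 : z.im = -δ := by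
      have : z.im + δ = 0 := by simpa using congrArg Complex.im h
      linarith
    have := hz h1
    rw [h2, abs_neg, abs_of_pos hδ] at this
    exact this.false
  have hN := Complex.normSq_pos.2 hne
  rw [Complex.mem_slitPlane_iff]
  by_cases h : z.re = 0
  · left
    have h1 := sq_lt_sq' (by linarith [abs_nonneg z.im]) (hz h)
    rw [sq_abs] at h1
    rw [Complex.div_re, ← add_div]
    refine div_pos ?_ hN
    simp [h]
    nlinarith
  · right
    rw [Complex.div_im, ← sub_div]
    refine div_ne_zero ?_ hN.ne'
    simp
    have := mul_ne_zero hδ.ne' h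
    intro h'
    exact this (by linarith)

variable {p : ℝ} [hp : Fact (0 < p)]

lemma not_hasLog_quotient {d : AddCircle p → ℂ} (hd : Continuous d) {t₁ : ℝ} (h0 : d t₁ = 0)
    {δ : ℝ} (hδ : 0 < δ)
    (hseg : ∀ t, (d t).re = 0 → |(d t).im| ≤ δ → t = t₁)
    (hpos : ∀ᶠ t : ℝ in nhdsWithin t₁ (Ioi t₁), 0 < (d t).re)
    (hneg : ∀ᶠ t : ℝ in nhdsWithin t₁ (Iio t₁), (d t).re < 0) :
    ¬ HasLog fun t => (d t - δ * Complex.I) / (d t + δ * Complex.I) := by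
  rintro ⟨M, hM, hMe⟩
  have hp0 : (0 : ℝ) < p := hp.out
  have hcoe : Continuous fun t : ℝ => (t : AddCircle p) := AddCircle.continuous_mk' p
  have hdc : Continuous fun t : ℝ => d t := hd.comp hcoe
  have hMc : Continuous fun t : ℝ => M t := hM.comp hcoe
  set q : ℝ → ℂ := fun t => (d t - δ * Complex.I) / (d t + δ * Complex.I) with hq
  have hslit : ∀ t ∈ Ioo t₁ (t₁ + p), d t + δ * Complex.I ≠ 0 ∧ q t ∈ Complex.slitPlane := by
    intro t ht
    have h1 : (t : AddCircle p) ≠ t₁ := fun h => ht.1.ne'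
      ((AddCircle.coe_eq_coe_iff_of_mem_Ico (a := t₁) ⟨ht.1.le, ht.2⟩
        ⟨le_rfl, by linarith⟩).1 h)
    have h2 := quotient_mem_slitPlane hδ (z := d t)
      fun h => not_le.1 fun h' => h1 (hseg _ h h')
    refine ⟨fun h => ?_, h2⟩
    rw [h, div_zero] at h2
    exact Complex.slitPlane_ne_zero h2 rfl
  have : PreconnectedSpace (Ioo t₁ (t₁ + p)) :=
    isPreconnected_iff_preconnectedSpace.1 isPreconnected_Ioo
  have hincr := log_increment_eq (T := Ioo t₁ (t₁ + p)) (L := fun t => M (t : ℝ))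
    (L' := fun t => Complex.log (q t)) (hMc.comp continuous_subtype_val)
    (by
      have hq' : Continuous fun t : Ioo t₁ (t₁ + p) => q t :=
        Continuous.div (by fun_prop) (by fun_prop) fun t => (hslit t t.2).1
      exact hq'.clog fun t => (hslit t t.2).2)
    (fun t => by rw [Complex.exp_log (Complex.slitPlane_ne_zero (hslit t t.2).2), ← hMe])
  let m : Ioo t₁ (t₁ + p) := ⟨t₁ + p / 2, by constructor <;> linarith⟩
  have hd0 : Tendsto (fun t : ℝ => d t) (nhds t₁) (nhds 0) := h0 ▸ hdc.tendsto t₁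
  have e1 : M t₁ - M (m : ℝ) = -(Real.pi * Complex.I) - Complex.log (q m) := by
    refine tendsto_nhds_unique (f := fun t : ℝ => M t - M (m : ℝ)) (l := nhdsWithin t₁ (Ioi t₁))
      ((hMc.tendsto t₁).mono_left nhdsWithin_le_nhds |>.sub_const _) ?_
    have := ((tendsto_log_quotient (hd0.mono_left nhdsWithin_le_nhds) hδ).1 hpos).sub_const
      (Complex.log (q m))
    refine this.congr' ?_
    filter_upwards [Ioo_mem_nhdsGT (show t₁ < t₁ + p by linarith)] with t ht
    exact (hincr ⟨t, ht⟩ m).symm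
  have e2 : M t₁ - M (m : ℝ) = Real.pi * Complex.I - Complex.log (q m) := by
    refine tendsto_nhds_unique (f := fun t : ℝ => M t - M (m : ℝ)) (l := nhdsWithin t₁ (Iio t₁))
      ((hMc.tendsto t₁).mono_left nhdsWithin_le_nhds |>.sub_const _) ?_
    have := ((tendsto_log_quotient (hd0.mono_left nhdsWithin_le_nhds) hδ).2 hneg).sub_const
      (Complex.log (q m))
    refine this.congr' ?_
    filter_upwards [Ioo_mem_nhdsLT (show t₁ - p < t₁ by linarith)] with t ht
    have h1 := hincr ⟨t + p, by constructor <;> linarith [ht.1, ht.2]⟩ m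
    simp only [hq, AddCircle.coe_add_period] at h1
    exact h1.symm
  have h3 : (Real.pi : ℂ) * Complex.I = 0 := by linear_combination (e1 - e2) / 2
  simp [Real.pi_ne_zero] at h3

/-- A loop which crosses a short vertical segment once winds around one of its endpoints. -/
lemma exists_not_hasLog_of_crossing {c : AddCircle p → ℂ} (hc : Continuous c) {t₁ : ℝ}
    (hinj : ∀ t, c t = c t₁ → t = t₁) {σ : ℝ} (hσ : σ ≠ 0)
    (hcr : ∀ᶠ t : ℝ in nhdsWithin t₁ {t₁}ᶜ, 0 < σ * ((c t).re - (c t₁).re) * (t - t₁)) :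
    ∃ δ₀ > 0, ∀ δ : ℝ, 0 < δ → δ < δ₀ →
      (∀ t, c t ≠ c t₁ + δ * Complex.I ∧ c t ≠ c t₁ - δ * Complex.I) ∧
      ¬ ((HasLog fun t => c t - (c t₁ + δ * Complex.I)) ∧
        HasLog fun t => c t - (c t₁ - δ * Complex.I)) := by
  have hcoe : Continuous fun t : ℝ => (t : AddCircle p) := AddCircle.continuous_mk' p
  obtain ⟨η, hη, hηcr⟩ := Metric.mem_nhdsWithin_iff.1 hcr
  have hopen : IsOpen ((fun t : ℝ => (t : AddCircle p)) '' ball t₁ η) :=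
    QuotientAddGroup.isOpenMap_coe _ isOpen_ball
  obtain ⟨δ₀, hδ₀, hfar⟩ : ∃ δ₀ > 0, ∀ t ∈ ((fun t : ℝ => (t : AddCircle p)) '' ball t₁ η)ᶜ,
      δ₀ ≤ ‖c t - c t₁‖ := by
    rcases (((fun t : ℝ => (t : AddCircle p)) '' ball t₁ η)ᶜ).eq_empty_or_nonempty with h | h
    · exact ⟨1, one_pos, fun t ht => by rw [h] at ht; exact ht.elim⟩
    · obtain ⟨t, ht, hmin⟩ := (hopen.isClosed_compl.isCompact).exists_isMinOn h
        (f := fun t => ‖c t - c t₁‖) (by fun_prop)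
      refine ⟨_, norm_pos_iff.2 (sub_ne_zero.2 fun h' => ht ?_), hmin⟩
      exact ⟨t₁, mem_ball_self hη, (hinj t h').symm⟩
  have hseg : ∀ δ < δ₀, ∀ t, (c t - c t₁).re = 0 → |(c t - c t₁).im| ≤ δ → t = t₁ := by
    intro δ hδ t hre him
    by_cases ht : t ∈ ((fun t : ℝ => (t : AddCircle p)) '' ball t₁ η)
    · obtain ⟨s, hs, rfl⟩ := ht
      by_contra hne
      have := hηcr ⟨hs, fun h => hne (by rw [h])⟩
      rw [mem_ofPred_eq, ← Complex.sub_re, hre] at this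
      simp at this
    · have h1 := hfar t ht
      have h2 : ‖c t - c t₁‖ ≤ |(c t - c t₁).re| + |(c t - c t₁).im| :=
        Complex.norm_le_abs_re_add_abs_im _
      rw [hre, abs_zero] at h2
      linarith
  refine ⟨δ₀, hδ₀, fun δ hδ hδδ => ⟨fun t => ⟨fun h => ?_, fun h => ?_⟩, ?_⟩⟩
  · have := hseg δ hδδ t (by rw [h]; simp) (by rw [h]; simp [abs_of_pos hδ])
    rw [this] at h
    simp [hδ.ne'] at h
  · have := hseg δ hδδ t (by rw [h]; simp) (by rw [h]; simp [abs_of_pos hδ])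
    rw [this] at h
    simp [sub_eq_add_neg, hδ.ne'] at h
  rintro ⟨hl1, hl2⟩
  have hq : HasLog fun t => (c t - c t₁ - δ * Complex.I) / (c t - c t₁ + δ * Complex.I) :=
    (hl1.mul hl2.inv).congr fun t => by
      rw [div_eq_mul_inv, show c t - c t₁ - δ * Complex.I = c t - (c t₁ + δ * Complex.I) by ring,
        show c t - c t₁ + δ * Complex.I = c t - (c t₁ - δ * Complex.I) by ring]
  have hR : ∀ᶠ t : ℝ in nhdsWithin t₁ (Ioi t₁), 0 < σ * ((c t).re - (c t₁).re) := by
    filter_upwards [hcr.filter_mono (nhdsWithin_mono _ fun t ht => ne_of_gt ht),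
      self_mem_nhdsWithin] with t h1 h2
    exact (pos_iff_pos_of_mul_pos h1).2 (sub_pos.2 h2)
  have hL : ∀ᶠ t : ℝ in nhdsWithin t₁ (Iio t₁), σ * ((c t).re - (c t₁).re) < 0 := by
    filter_upwards [hcr.filter_mono (nhdsWithin_mono _ fun t ht => ne_of_lt ht),
      self_mem_nhdsWithin] with t h1 h2
    exact (neg_iff_neg_of_mul_pos h1).2 (sub_neg.2 h2)
  rcases lt_or_gt_of_ne hσ with hs | hs
  · refine not_hasLog_quotient (d := fun t => -(starRingEnd ℂ) (c t - c t₁)) (t₁ := t₁) ?_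
      (by simp) hδ ?_ ?_ ?_ (hq.conj.congr fun t => ?_)
    · exact (Complex.continuous_conj.comp (hc.sub continuous_const)).neg
    · intro t h1 h2
      simp only [Complex.neg_re, Complex.conj_re, neg_eq_zero] at h1
      simp only [Complex.neg_im, Complex.conj_im, neg_neg] at h2
      exact hseg δ hδδ t h1 h2
    · filter_upwards [hR] with t ht
      simp only [Complex.neg_re, Complex.conj_re, Complex.sub_re]
      have := neg_of_mul_pos_right ht hs.le
      linarith
    · filter_upwards [hL] with t ht
      simp only [Complex.neg_re, Complex.conj_re, Complex.sub_re]
      have := pos_of_mul_neg_right ht hs.le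
      linarith
    · simp only [map_div₀, map_sub, map_add, map_mul, Complex.conj_I, Complex.conj_ofReal]
      rw [← neg_div_neg_eq]
      congr 1 <;> ring
  · refine not_hasLog_quotient (d := fun t => c t - c t₁) (t₁ := t₁) (by fun_prop)
      (by simp) hδ (fun t h1 h2 => hseg δ hδδ t h1 h2) ?_ ?_ hq
    · filter_upwards [hR] with t ht
      rw [Complex.sub_re]
      exact pos_of_mul_pos_right ht hs.le
    · filter_upwards [hL] with t ht
      rw [Complex.sub_re]
      exact neg_of_mul_neg_right ht hs.le

end

section

/-! ### Loops wind around points near their free arcs -/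

section Cross

lemma exists_lipschitzOnWith_mU (κ ρ R : ℝ) :
    ∃ K, LipschitzOnWith K (fun x : ℝ × ℝ => mU κ ρ x.1 x.2) (Icc 0 R ×ˢ Icc 0 R) := by
  have h : ContDiff ℝ 1 fun x : ℝ × ℝ => mU κ ρ x.1 x.2 := by
    unfold mU
    split_ifs
    · fun_prop
    · exact (((Real.contDiff_cosh.comp (contDiff_const.mul contDiff_fst)).sub
        (Real.contDiff_cosh.comp (contDiff_const.mul contDiff_snd))).div_const _)
  exact h.locallyLipschitz.locallyLipschitzOn.exists_lipschitzOnWith_of_compact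
    (isCompact_Icc.prod isCompact_Icc)

lemma mU_swap_ne {κ : ℝ} (hκ : κ ≤ 0) {ρ d : ℝ} (hρ : 0 < ρ) (hd : 0 < d) :
    mU κ ρ 0 d ≠ mU κ ρ d 0 := by
  have key : mU κ ρ 0 d < mU κ ρ d 0 := by
    unfold mU
    split_ifs with h
    · gcongr
    · have hk : 0 < Real.sqrt (-κ) := Real.sqrt_pos.2 (by have := lt_of_le_of_ne hκ h; linarith)
      have h1 : 0 < Real.sinh (Real.sqrt (-κ) * ρ) := Real.sinh_pos_iff.2 (by positivity)
      have h2 : 1 < Real.cosh (Real.sqrt (-κ) * d) := Real.one_lt_cosh.2 (by positivity)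
      rw [mul_zero, Real.cosh_zero]
      gcongr
  exact key.ne

lemma crossing_of_deriv_ne_zero {u : ℝ → ℝ} {t₁ : ℝ} (h : deriv u t₁ ≠ 0) :
    ∀ᶠ t in nhdsWithin t₁ {t₁}ᶜ, 0 < deriv u t₁ * (u t - u t₁) * (t - t₁) := by
  have h1 := hasDerivAt_iff_tendsto_slope.1 (differentiableAt_of_deriv_ne_zero h).hasDerivAt
  have h2 := (h1.const_mul (deriv u t₁)).eventually (lt_mem_nhds (mul_self_pos.2 h))
  filter_upwards [h2, self_mem_nhdsWithin] with t h3 h4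
  have h5 : t - t₁ ≠ 0 := sub_ne_zero.2 h4
  have h6 := mul_pos h3 (mul_self_pos.2 h5)
  rw [slope_def_field] at h6
  have : deriv u t₁ * ((u t - u t₁) / (t - t₁)) * ((t - t₁) * (t - t₁)) =
    deriv u t₁ * (u t - u t₁) * (t - t₁) := by field_simp
  rwa [this] at h6

variable {κ : ℝ} {X : Type*} [MetricSpace X] [Cat0 X] {PC : PolyComplex2 κ X}
  {p : ℝ} [hp : Fact (0 < p)] {J : C(AddCircle p, X)} {V : Set X}

lemma continuous_coe_circle (J : C(AddCircle p, X)) : Continuous fun t : ℝ => J t :=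
  J.continuous.comp (AddCircle.continuous_mk' p)

lemma exists_mem_windingSet_face (hκ : κ ≤ 0) (hV : IsOpen V)
    (hinj : ∀ s t, J s ∈ V → J t = J s → t = s) {a b : ℝ} (hab : b ≤ a + p) {M : NNReal}
    (hlip : LipschitzOnWith M (fun t : ℝ => J t) (Icc a b)) {t₀ : ℝ} (ht₀ : t₀ ∈ Ioo a b)
    (htV : J t₀ ∈ V) {F : Set X} (hF : F ∈ PC.faces) (htF : J t₀ ∈ F) :
    (V ∩ windingSet PC J).Nonempty := by
  obtain ⟨f, hf⟩ := PC.exists_faceChart hκ hF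
  obtain ⟨r, hr, hrVF⟩ := Metric.nhds_basis_closedBall.mem_iff.1
    ((hV.inter (PC.faces_open F hF)).mem_nhds ⟨htV, htF⟩)
  have hJc := continuous_coe_circle J
  obtain ⟨η, hη, hηsub⟩ := Metric.isOpen_iff.1
    (isOpen_Ioo.inter (isOpen_ball.preimage hJc)) t₀ ⟨ht₀, mem_ball_self hr⟩
  set z₀ := J t₀ with hz₀
  set t₂ := t₀ + η / 2 with ht₂
  have hsub : Icc t₀ t₂ ⊆ ball t₀ η := by
    intro t ht
    rw [Real.ball_eq_Ioo]
    constructor <;> linarith [ht.1, ht.2]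
  have h02 : t₀ < t₂ := by linarith
  have hcoe : ∀ s ∈ Ioo a b, ∀ t ∈ Ioo a b, (s : AddCircle p) = t → s = t := fun s hs t ht h =>
    (AddCircle.coe_eq_coe_iff_of_mem_Ico (a := a) ⟨hs.1.le, hs.2.trans_le hab⟩
      ⟨ht.1.le, ht.2.trans_le hab⟩).1 h
  set z₂ := J t₂ with hz₂
  have hb₂ : z₂ ∈ ball z₀ r := (hηsub (hsub ⟨h02.le, le_rfl⟩)).2
  have hne : z₀ ≠ z₂ := fun h => h02.ne' (hcoe _ (hηsub (hsub ⟨h02.le, le_rfl⟩)).1 _ ht₀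
    (hinj _ _ htV h.symm))
  have hd₂ : 0 < dist z₀ z₂ := dist_pos.2 hne
  have hclF : ∀ x ∈ closedBall z₀ r, x ∈ closure F := fun x hx => subset_closure (hrVF hx).2
  have h₂F := hclF z₂ (ball_subset_closedBall hb₂)
  have h₀F := hclF z₀ (mem_closedBall_self hr.le)
  have hmS : G z₀ z₂ (1 / 2) ∈ Seg z₀ z₂ := G_mem_Seg _ _ (by norm_num)
  have hmF : G z₀ z₂ (1 / 2) ∈ closure F := hf.Seg_subset hκ h₀F h₂F hmS
  have hρ : 0 < dist z₀ z₂ / 2 := by linarith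
  obtain ⟨Θ, hΘ⟩ := exists_frame hκ (c₁ := f z₀) (c₂ := f z₂) (c₀ := f (G z₀ z₂ (1 / 2))) hρ
    (by rw [hf.isom _ h₀F _ hmF, dist_left_G z₀ z₂ (by norm_num)]; ring)
    (by rw [hf.isom _ h₂F _ hmF, dist_comm, dist_G_right z₀ z₂ (by norm_num)]; ring)
    (by rw [hf.isom _ h₀F _ h₂F]; ring)
  set ρ := dist z₀ z₂ / 2 with hρd
  have hd := hf.exists_isDisc hκ Θ hr (hrVF.trans inter_subset_right)
  set Φ : X → ℂ := fun x => Θ (f (clamp z₀ r x)) with hΦ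
  have hu : ∀ t ∈ Icc t₀ t₂, (Φ (J t)).re = mU κ ρ (dist (J t) z₀) (dist (J t) z₂) := by
    intro t ht
    have htb : J t ∈ ball z₀ r := (hηsub (hsub ht)).2
    have htc := hclF _ (ball_subset_closedBall htb)
    rw [hΦ]
    dsimp only
    rw [(hΘ _).1, clamp_of_dist_le hr (mem_ball'.1 htb).le, hf.isom _ htc _ h₀F,
      hf.isom _ htc _ h₂F]
  obtain ⟨K, hK⟩ := exists_lipschitzOnWith_mU κ ρ (2 * r)
  have hlu : LipschitzOnWith (K * M) (fun t : ℝ => (Φ (J t)).re) (Icc t₀ t₂) := by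
    have hin : LipschitzOnWith M (fun t : ℝ => (dist (J t) z₀, dist (J t) z₂)) (Icc t₀ t₂) := by
      refine LipschitzOnWith.of_dist_le_mul fun s hs t ht => ?_
      have h1 := hlip.dist_le_mul s (Ioo_subset_Icc_self (hηsub (hsub hs)).1) t
        (Ioo_subset_Icc_self (hηsub (hsub ht)).1)
      rw [Prod.dist_eq, max_le_iff]
      exact ⟨(dist_dist_dist_le_left _ _ _).trans h1, (dist_dist_dist_le_left _ _ _).trans h1⟩
    have hcomp := hK.comp hin fun t ht => by
      have h1 : J t ∈ ball z₀ r := (hηsub (hsub ht)).2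
      have h2 := dist_triangle_right (J t) z₂ z₀
      rw [mem_ball] at h1 hb₂
      exact ⟨⟨dist_nonneg, by linarith⟩, ⟨dist_nonneg, by linarith⟩⟩
    intro s hs t ht
    have := hcomp hs ht
    simp only [Function.comp_def] at this
    rwa [← hu s hs, ← hu t ht] at this
  obtain ⟨t₁, ht₁, hderiv⟩ := exists_deriv_ne_zero h02.le hlu (by
    rw [hu t₀ ⟨le_rfl, h02.le⟩, hu t₂ ⟨h02.le, le_rfl⟩, ← hz₀, ← hz₂, dist_self, dist_self,
      dist_comm z₂ z₀]
    exact mU_swap_ne hκ hρ hd₂)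
  have ht₁b : J t₁ ∈ ball z₀ r := (hηsub (hsub (Ioo_subset_Icc_self ht₁))).2
  obtain ⟨δ₀, hδ₀, hcross⟩ := exists_not_hasLog_of_crossing (c := fun t => Φ (J t)) (t₁ := t₁)
    (hd.cont.comp J.continuous) (fun t h => hinj _ _ (hrVF (ball_subset_closedBall ht₁b)).1
      (hd.inj _ ht₁b _ h)) hderiv (crossing_of_deriv_ne_zero hderiv)
  obtain ⟨ε, hε, hεsub⟩ := Metric.isOpen_iff.1 (hd.openMap _ Subset.rfl isOpen_ball)
    (Φ (J t₁)) ⟨_, ht₁b, rfl⟩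
  obtain ⟨δ, hδ, hδ'⟩ := exists_between (lt_min hδ₀ hε)
  obtain ⟨hmiss, hlog⟩ := hcross δ hδ (hδ'.trans_le (min_le_left _ _))
  have hδε : δ < ε := hδ'.trans_le (min_le_right _ _)
  have hfin : ∀ ζ, ζ ∈ ball (Φ (J t₁)) ε → (∀ t, Φ (J t) ≠ ζ) →
      (¬ HasLog fun t => Φ (J t) - ζ) → (V ∩ windingSet PC J).Nonempty := by
    intro ζ hζ hm hl
    obtain ⟨z, hz, rfl⟩ := hεsub hζ
    have hzJ : z ∉ range J := by
      rintro ⟨t, rfl⟩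
      exact hm t rfl
    have hzVF := hrVF (ball_subset_closedBall hz)
    exact ⟨z, hzVF.1, hzJ, ⟨F, hF, hzVF.2⟩, (hd.winds_iff hz hzJ).2 hl⟩
  rcases not_and_or.1 hlog with hl | hl
  · exact hfin _ (by simpa [mem_ball, dist_eq_norm, abs_of_pos hδ] using hδε)
      (fun t => (hmiss t).1) hl
  · exact hfin _ (by simpa [mem_ball, dist_eq_norm, abs_of_pos hδ] using hδε)
      (fun t => (hmiss t).2) hl

lemma exists_mem_windingSet_edge (hκ : κ ≤ 0) (hV : IsOpen V)
    (hinj : ∀ s t, J s ∈ V → J t = J s → t = s) {a b : ℝ} (hab : b ≤ a + p)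
    {e : Set X} (he : e ∈ PC.edges) {t₀ : ℝ} (ht₀ : t₀ ∈ Ioo a b)
    (htV : ∀ t : ℝ, t ∈ Ioo a b → J t ∈ V) (hte : ∀ t : ℝ, t ∈ Ioo a b → J t ∈ e) :
    (V ∩ windingSet PC J).Nonempty := by
  obtain ⟨ε, L, he⟩ := PC.exists_edgeParam he
  obtain ⟨s₀, hs₀, hs₀t⟩ : ∃ s ∈ Ioo 0 L, ε s = J t₀ := by
    have := hte t₀ ht₀
    rw [← he.image] at this
    exact this
  obtain ⟨R, hR, hn⟩ := he.exists_edgeNbhd hκ hs₀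
  obtain ⟨r, hr, hrV⟩ := Metric.isOpen_iff.1 hV _ (htV t₀ ht₀)
  replace hn := hn (min R r) (lt_min hR hr) (min_le_left _ _)
  set ρ := min R r with hρ
  have hρV : ball (ε s₀) ρ ⊆ V := by
    rw [hs₀t]; exact (ball_subset_ball (min_le_right _ _)).trans hrV
  have hJc := continuous_coe_circle J
  obtain ⟨η, hη, hηsub⟩ := Metric.isOpen_iff.1
    (isOpen_Ioo.inter (isOpen_ball.preimage hJc)) t₀
      ⟨ht₀, show J t₀ ∈ ball (ε s₀) ρ by rw [hs₀t]; exact mem_ball_self hn.pos⟩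
  set A := edgeCoord κ ε s₀ ρ with hA
  have hIcc : Icc (t₀ - η / 2) (t₀ + η / 2) ⊆ ball t₀ η := by
    intro t ht
    rw [Real.ball_eq_Ioo]
    constructor <;> linarith [ht.1, ht.2]
  have hpar : ∀ t : ℝ, t ∈ ball t₀ η → ∃ s, ε s = J t ∧ A (J t) = (mR κ (s - s₀) : ℝ) := by
    intro t ht
    obtain ⟨s, hs, hst⟩ := hn.exists_param (hte t (hηsub ht).1)
      (ball_subset_closedBall (hηsub ht).2)
    exact ⟨s, hst, by rw [← hst, hA, hn.edgeCoord_edge hκ hs]⟩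
  have hAc : Continuous A := hn.continuous_edgeCoord
  have hAJ : Continuous fun t => (starRingEnd ℂ) (A (J t)) :=
    Complex.continuous_conj.comp (hAc.comp J.continuous)
  have hA0 : A (J t₀) = 0 := by rw [← hs₀t]; exact (hn.edgeCoord_eq_zero hκ).2 rfl
  have hinjA : InjOn (fun t : ℝ => (A (J t)).re) (Icc (t₀ - η / 2) (t₀ + η / 2)) := by
    intro s hs t ht h
    obtain ⟨x, hx, hx'⟩ := hpar s (hIcc hs)
    obtain ⟨y, hy, hy'⟩ := hpar t (hIcc ht)
    simp only [hx', hy', Complex.ofReal_re] at h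
    have hxy : x = y := by have := (mR_strictMono hκ).injective h; linarith
    have h1 := hinj _ _ (htV t (hηsub (hIcc ht)).1) (hx.symm.trans (hxy ▸ hy))
    have h2 := (hηsub (hIcc hs)).1
    have h3 := (hηsub (hIcc ht)).1
    exact (AddCircle.coe_eq_coe_iff_of_mem_Ico (a := a) ⟨h2.1.le, h2.2.trans_le hab⟩
      ⟨h3.1.le, h3.2.trans_le hab⟩).1 h1
  have hcontA : Continuous fun t : ℝ => (A (J t)).re :=
    Complex.continuous_re.comp (hAc.comp hJc)
  have hnear : ∀ᶠ t in nhdsWithin t₀ {t₀}ᶜ, t ∈ Icc (t₀ - η / 2) (t₀ + η / 2) ∧ t ≠ t₀ := by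
    filter_upwards [nhdsWithin_le_nhds (Icc_mem_nhds (show t₀ - η / 2 < t₀ by linarith)
      (show t₀ < t₀ + η / 2 by linarith)), self_mem_nhdsWithin] with t h1 h2
    exact ⟨h1, h2⟩
  have ht₀I : t₀ ∈ Icc (t₀ - η / 2) (t₀ + η / 2) := ⟨by linarith, by linarith⟩
  have hcr : ∃ σ : ℝ, σ ≠ 0 ∧ ∀ᶠ t : ℝ in nhdsWithin t₀ {t₀}ᶜ,
      0 < σ * ((A (J t)).re - (A (J t₀)).re) * (t - t₀) := by
    rcases hcontA.continuousOn.strictMonoOn_of_injOn_Icc' (by linarith) hinjA with hm | hm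
    · refine ⟨1, one_ne_zero, ?_⟩
      filter_upwards [hnear] with t ⟨h1, h2⟩
      rw [one_mul]
      rcases lt_or_gt_of_ne h2 with h | h
      · exact mul_pos_of_neg_of_neg (sub_neg.2 (hm h1 ht₀I h)) (sub_neg.2 h)
      · exact mul_pos (sub_pos.2 (hm ht₀I h1 h)) (sub_pos.2 h)
    · refine ⟨-1, by norm_num, ?_⟩
      filter_upwards [hnear] with t ⟨h1, h2⟩
      rw [neg_one_mul, neg_sub]
      rcases lt_or_gt_of_ne h2 with h | h
      · exact mul_pos_of_neg_of_neg (sub_neg.2 (hm h1 ht₀I h)) (sub_neg.2 h)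
      · exact mul_pos (sub_pos.2 (hm ht₀I h1 h)) (sub_pos.2 h)
  obtain ⟨σ, hσ, hcr⟩ := hcr
  obtain ⟨δ₀, hδ₀, hcross⟩ := exists_not_hasLog_of_crossing
    (c := fun t => (starRingEnd ℂ) (A (J t))) (t₁ := t₀) hAJ
    (fun t h => hinj _ _ (htV t₀ ht₀) (by
      have h' := (starRingEnd ℂ).injective h
      rw [hA0] at h'
      exact ((hn.edgeCoord_eq_zero hκ).1 h').trans hs₀t)) hσ (by simpa only [Complex.conj_re] using hcr)
  obtain ⟨δ, hδ, hδ'⟩ := exists_between (lt_min hδ₀ (mR_pos hκ hn.pos))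
  obtain ⟨hmiss, hlog⟩ := hcross δ hδ (hδ'.trans_le (min_le_left _ _))
  simp only [hA0, map_zero, zero_add, zero_sub, sub_neg_eq_add] at hmiss hlog
  have hδρ : δ < mR κ ρ := hδ'.trans_le (min_le_right _ _)
  have hmissA : ∀ t, A (J t) ≠ δ * Complex.I := fun t h => (hmiss t).2 (by rw [h]; simp)
  by_contra hcon
  refine hlog ⟨hasLog_of_im_nonpos (by fun_prop) (fun t => sub_ne_zero.2 (hmiss t).1) fun t => ?_,
    hn.hasLog_edgeCoord hκ hδ hmissA fun F hF hbF => ?_⟩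
  · have : 0 ≤ (A (J t)).im := edgeCoord_im_nonneg _ _ _ _
    simp
    linarith
  · obtain ⟨z, hzF, hzd, -, hz⟩ := hn.exists_pageCoord_eq hκ hF hbF (ζ := δ * Complex.I)
      (by simpa using hδ) (by simpa [abs_of_pos hδ] using hδρ)
    have hd := hn.isDisc_pageCoord hκ hF hbF
    have hzJ : z ∉ range J := by
      rintro ⟨t, rfl⟩
      rw [pageCoord] at hz
      split_ifs at hz
      · exact hmissA t hz
      · exact (hmiss t).1 hz
    by_contra hl
    refine hcon ⟨z, hρV hzd, hzJ, ⟨F, hF, hzF⟩, (hd.winds_iff ⟨hzF, hzd⟩ hzJ).2 ?_⟩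
    rwa [hz]

/-- If a loop passes through the open set `V` injectively, along a Lipschitz arc, then it winds
around points of `V`. -/
theorem exists_mem_windingSet (hκ : κ ≤ 0) (hV : IsOpen V)
    (hinj : ∀ s t, J s ∈ V → J t = J s → t = s) {a b : ℝ} (hab : b ≤ a + p) {M : NNReal}
    (hlip : LipschitzOnWith M (fun t : ℝ => J t) (Icc a b)) {t₀ : ℝ} (ht₀ : t₀ ∈ Ioo a b)
    (htV : J t₀ ∈ V) : (V ∩ windingSet PC J).Nonempty := by
  have hJc := continuous_coe_circle J
  obtain ⟨η, hη, hηsub⟩ := Metric.isOpen_iff.1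
    (isOpen_Ioo.inter (hV.preimage hJc)) t₀ ⟨ht₀, htV⟩
  by_cases hface : ∃ t : ℝ, t ∈ ball t₀ η ∧ ∃ F ∈ PC.faces, J t ∈ F
  · obtain ⟨t, ht, F, hF, htF⟩ := hface
    exact exists_mem_windingSet_face hκ hV hinj hab hlip (hηsub ht).1 (hηsub ht).2 hF htF
  push Not at hface
  have hcoe : ∀ s ∈ Ioo a b, ∀ t ∈ Ioo a b, (s : AddCircle p) = t → s = t := fun s hs t ht h =>
    (AddCircle.coe_eq_coe_iff_of_mem_Ico (a := a) ⟨hs.1.le, hs.2.trans_le hab⟩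
      ⟨ht.1.le, ht.2.trans_le hab⟩).1 h
  obtain ⟨t₁, ht₁, hv⟩ : ∃ t : ℝ, t ∈ ball t₀ η ∧ J t ∉ PC.vertices := by
    by_contra hcon
    push Not at hcon
    have hfin := PC.finite_vertices_inter (isCompact_range J.continuous)
    have hinf : (ball t₀ η).Infinite := by
      rw [Real.ball_eq_Ioo]; exact Ioo_infinite (by linarith)
    refine hinf (Set.Finite.of_finite_image (f := fun t : ℝ => J t)
      (hfin.subset ?_) ?_)
    · rintro _ ⟨t, ht, rfl⟩
      exact ⟨hcon t ht, ⟨_, rfl⟩⟩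
    · intro s hs t ht h
      exact hcoe _ (hηsub hs).1 _ (hηsub ht).1 (hinj _ _ (hηsub ht).2 h)
  obtain ⟨e, he, hte⟩ : ∃ e ∈ PC.edges, J t₁ ∈ e := by
    rcases PC.cases (J t₁) with ⟨F, hF, h⟩ | h | h
    · exact (hface t₁ ht₁ F hF h).elim
    · exact h
    · exact (hv h).elim
  obtain ⟨ε, L, hep⟩ := PC.exists_edgeParam he
  obtain ⟨s₁, hs₁, hs₁t⟩ : ∃ s ∈ Ioo 0 L, ε s = J t₁ := by
    rw [← hep.image] at hte
    exact hte
  obtain ⟨R, hR, hn⟩ := hep.exists_edgeNbhd hκ hs₁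
  replace hn := hn R hR le_rfl
  obtain ⟨η', hη', hsub'⟩ := Metric.isOpen_iff.1
    (isOpen_ball.inter (isOpen_ball.preimage hJc)) t₁
      ⟨ht₁, show J t₁ ∈ ball (ε s₁) R by rw [hs₁t]; exact mem_ball_self hR⟩
  rw [Real.ball_eq_Ioo] at hsub'
  have h1 : Ioo (t₁ - η') (t₁ + η') ⊆ Ioo a b := fun t ht => (hηsub (hsub' ht).1).1
  have h2 := (Ioo_subset_Ioo_iff (show t₁ - η' < t₁ + η' by linarith)).1 h1
  refine exists_mem_windingSet_edge hκ hV hinj (a := t₁ - η') (b := t₁ + η') (by linarith) he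
    (t₀ := t₁) ⟨by linarith, by linarith⟩ (fun t ht => (hηsub (hsub' ht).1).2) fun t ht => ?_
  rcases hn.cases _ (ball_subset_closedBall (hsub' ht).2) with h | ⟨F, hF, -, h⟩
  · exact h
  · exact (hface t (hsub' ht).1 F hF h).elim

end Cross

end

section

/-! ### Paths parametrized with speed at most one -/

section LipJoin

variable {X : Type*} [MetricSpace X] {C E : Set X} {x y z : X} {M N : ℝ}

/-- The points `x` and `y` are joined in `C` by a `1`-Lipschitz path defined on `[0, M]`. -/
def LipJoin (C : Set X) (x y : X) (M : ℝ) : Prop :=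
  0 ≤ M ∧ ∃ β : ℝ → X, LipschitzWith 1 β ∧ β 0 = x ∧ β M = y ∧ ∀ t, β t ∈ C

lemma dist_le_abs_of_lipschitz {β : ℝ → X} (hβ : LipschitzWith 1 β) (s t : ℝ) :
    dist (β s) (β t) ≤ |s - t| := by
  simpa [Real.dist_eq] using hβ.dist_le_mul s t

/-- A `1`-Lipschitz path on `[0, M]` extends to a `1`-Lipschitz path on the line. -/
lemma exists_lipschitzWith_eqOn {β : ℝ → X} (hM : 0 ≤ M)
    (h : ∀ s ∈ Icc 0 M, ∀ t ∈ Icc 0 M, s ≤ t → dist (β s) (β t) ≤ t - s) :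
    ∃ γ : ℝ → X, LipschitzWith 1 γ ∧ EqOn γ β (Icc 0 M) ∧ ∀ t, γ t ∈ β '' Icc 0 M := by
  refine ⟨fun t => β (projIcc 0 M hM t), ?_, fun t ht => by simp [projIcc_of_mem hM ht],
    fun t => ⟨_, (projIcc 0 M hM t).2, rfl⟩⟩
  refine LipschitzWith.of_dist_le_mul fun s t => ?_
  have h2 : dist (β (projIcc 0 M hM s)) (β (projIcc 0 M hM t)) ≤
      dist (projIcc 0 M hM s) (projIcc 0 M hM t) := by
    rw [Subtype.dist_eq, Real.dist_eq]
    rcases le_total (projIcc 0 M hM s : ℝ) (projIcc 0 M hM t) with hst | hst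
    · rw [abs_sub_comm, abs_of_nonneg (sub_nonneg.2 hst)]
      exact h _ (projIcc 0 M hM s).2 _ (projIcc 0 M hM t).2 hst
    · rw [abs_of_nonneg (sub_nonneg.2 hst), dist_comm]
      exact h _ (projIcc 0 M hM t).2 _ (projIcc 0 M hM s).2 hst
  exact h2.trans ((LipschitzWith.projIcc hM).dist_le_mul s t)

lemma LipJoin.of_on {β : ℝ → X} (hM : 0 ≤ M)
    (h : ∀ s ∈ Icc 0 M, ∀ t ∈ Icc 0 M, s ≤ t → dist (β s) (β t) ≤ t - s) (h0 : β 0 = x)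
    (h1 : β M = y) (hC : ∀ t ∈ Icc 0 M, β t ∈ C) : LipJoin C x y M := by
  obtain ⟨γ, hγ, heq, hmem⟩ := exists_lipschitzWith_eqOn hM h
  refine ⟨hM, γ, hγ, (heq (left_mem_Icc.2 hM)).trans h0, (heq (right_mem_Icc.2 hM)).trans h1,
    fun t => ?_⟩
  obtain ⟨s, hs, hst⟩ := hmem t
  exact hst ▸ hC s hs

lemma LipJoin.nonneg (h : LipJoin C x y M) : 0 ≤ M := h.1

lemma LipJoin.dist_le (h : LipJoin C x y M) : dist x y ≤ M := by
  obtain ⟨hM, β, hβ, rfl, rfl, -⟩ := h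
  simpa [abs_of_nonneg hM] using dist_le_abs_of_lipschitz hβ 0 M

lemma LipJoin.mono_set (h : LipJoin C x y M) (hC : C ⊆ E) : LipJoin E x y M :=
  ⟨h.1, h.2.imp fun _ hβ => ⟨hβ.1, hβ.2.1, hβ.2.2.1, fun t => hC (hβ.2.2.2 t)⟩⟩

lemma LipJoin.trans (h : LipJoin C x y M) (h' : LipJoin C y z N) : LipJoin C x z (M + N) := by
  obtain ⟨hM, β, hβ, h0, h1, hC⟩ := h
  obtain ⟨hN, γ, hγ, h0', h1', hC'⟩ := h'
  refine LipJoin.of_on (β := fun r => if r ≤ M then β r else γ (r - M)) (by linarith) ?_ ?_ ?_ ?_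
  · intro s _ t _ hst
    split_ifs with h2 h3 h3
    · have := dist_le_abs_of_lipschitz hβ s t
      rwa [abs_sub_comm, abs_of_nonneg (sub_nonneg.2 hst)] at this
    · have h4 := dist_le_abs_of_lipschitz hβ s M
      have h5 := dist_le_abs_of_lipschitz hγ 0 (t - M)
      rw [abs_sub_comm, abs_of_nonneg (by linarith)] at h4 h5
      rw [h1] at h4
      rw [h0'] at h5
      linarith [dist_triangle (β s) y (γ (t - M))]
    · linarith
    · have := dist_le_abs_of_lipschitz hγ (s - M) (t - M)
      rw [abs_sub_comm, abs_of_nonneg (by linarith)] at this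
      linarith
  · simp [hM, h0]
  · by_cases hN0 : N = 0
    · subst hN0; simp [h1, ← h0', h1']
    · have : ¬ M + N ≤ M := by
        have := lt_of_le_of_ne hN (Ne.symm hN0)
        linarith
      simp [this, h1']
  · intro t _
    split_ifs
    exacts [hC _, hC' _]

lemma LipJoin.subpath {β : ℝ → X} (hβ : LipschitzWith 1 β) {s t : ℝ} (hst : s ≤ t)
    (hC : ∀ t, β t ∈ C) : LipJoin C (β s) (β t) (t - s) := by
  refine LipJoin.of_on (β := fun r => β (s + r)) (by linarith) ?_ (by simp) (by simp) fun _ _ => hC _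
  intro a _ b _ hab
  have := dist_le_abs_of_lipschitz hβ (s + a) (s + b)
  rw [abs_sub_comm, abs_of_nonneg (by linarith)] at this
  linarith

lemma LipJoin.symm (h : LipJoin C x y M) : LipJoin C y x M := by
  obtain ⟨hM, β, hβ, h0, h1, hC⟩ := h
  refine ⟨hM, fun t => β (M - t), ?_, by simpa, by simpa, fun _ => hC _⟩
  refine LipschitzWith.of_dist_le_mul fun s t => ?_
  have := dist_le_abs_of_lipschitz hβ (M - s) (M - t)
  rw [show M - s - (M - t) = t - s by ring, abs_sub_comm] at this
  simpa [Real.dist_eq] using this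

/-- In a compact set, the length of `1`-Lipschitz paths between two points attains its minimum. -/
lemma LipJoin.exists_min (hC : IsCompact C) (h : LipJoin C x y M) :
    ∃ I, LipJoin C x y I ∧ ∀ N, LipJoin C x y N → I ≤ N := by
  set S := {N | LipJoin C x y N} with hS
  have hbdd : BddBelow S := ⟨0, fun N hN => LipJoin.nonneg hN⟩
  have hne : S.Nonempty := ⟨M, h⟩
  refine ⟨sInf S, ?_, fun N hN => csInf_le hbdd hN⟩
  set A : Set (ℝ → X) := (univ.pi fun _ => C) ∩
    ({β | β 0 = x} ∩ ⋂ s, ⋂ t, {β | dist (β s) (β t) ≤ |s - t|}) with hA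
  have hAc : IsCompact A := by
    refine (isCompact_univ_pi fun _ => hC).inter_right ?_
    refine (isClosed_eq (continuous_apply 0) continuous_const).inter ?_
    exact isClosed_iInter fun s => isClosed_iInter fun t =>
      isClosed_le ((continuous_apply s).dist (continuous_apply t)) continuous_const
  have hmem : ∀ N ∈ S, ∃ β ∈ A, dist (β (sInf S)) y ≤ N - sInf S := by
    rintro N ⟨hN, β, hβ, h0, h1, hβC⟩
    refine ⟨β, ⟨fun t _ => hβC t, h0, ?_⟩, ?_⟩
    · simp only [mem_iInter]
      exact fun s t => dist_le_abs_of_lipschitz hβ s t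
    · have hle : sInf S ≤ N := csInf_le hbdd ⟨hN, β, hβ, h0, h1, hβC⟩
      have := dist_le_abs_of_lipschitz hβ (sInf S) N
      rwa [h1, abs_sub_comm, abs_of_nonneg (sub_nonneg.2 hle)] at this
  obtain ⟨β₀, hβ₀, -⟩ := hmem M h
  obtain ⟨β, hβ, hmin⟩ := hAc.exists_isMinOn ⟨β₀, hβ₀⟩
    ((continuous_apply (sInf S)).dist continuous_const : Continuous fun β : ℝ → X =>
      dist (β (sInf S)) y).continuousOn
  refine ⟨le_csInf hne fun N hN => LipJoin.nonneg hN, β, ?_, hβ.2.1, ?_, fun t => hβ.1 t trivial⟩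
  · refine LipschitzWith.of_dist_le_mul fun s t => ?_
    have := hβ.2.2
    simp only [mem_iInter] at this
    simpa [Real.dist_eq] using this s t
  · rw [← dist_le_zero]
    refine le_of_forall_pos_lt_add fun ε hε => ?_
    obtain ⟨N, hN, hlt⟩ := exists_lt_of_csInf_lt hne (show sInf S < sInf S + ε by linarith)
    obtain ⟨γ, hγ, hγd⟩ := hmem N hN
    have := hmin hγ
    simp only [mem_ofPred_eq] at this
    linarith

lemma LipJoin.pathDistIn_le (h : LipJoin E x y M) : pathDistIn E x y ≤ M := by
  obtain ⟨hM, β, hβ, h0, h1, hE⟩ := h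
  have hp : IsPathIn E (fun t => β (M * t)) x y :=
    ⟨(hβ.continuous.comp (continuous_const.mul continuous_id)).continuousOn, by simpa, by simpa,
      fun t _ => hE _⟩
  have h2 : eVariationOn (fun t => β (M * t)) (Icc 0 1) ≤ ENNReal.ofReal M := by
    have h3 := (hβ.lipschitzOnWith (s := univ)).comp_eVariationOn_le (g := fun t : ℝ => M * t)
      (s := Icc (0 : ℝ) 1) (fun _ _ => mem_univ _)
    have h4 : MonotoneOn (fun t : ℝ => M * t) (Icc 0 1) := fun a _ b _ hab =>
      mul_le_mul_of_nonneg_left hab hM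
    have h5 := (h4.eVariationOn_eq (a := 0) (b := 1) (by simp) (by simp)).le
    simp only [inter_self, mul_one, mul_zero, sub_zero] at h5
    simp only [ENNReal.coe_one, one_mul, Function.comp_def] at h3
    exact h3.trans h5
  refine ENNReal.toReal_le_of_le_ofReal hM ?_
  exact (iInf_le (fun g : {g : ℝ → X // IsPathIn E g x y} => eVariationOn g.1 (Icc 0 1))
    ⟨_, hp⟩).trans h2

/-- A rectifiable path can be parametrized by arc length. -/
lemma LipJoin.of_eVariationOn {g : ℝ → X} (hg : IsPathIn E g x y)
    (hfin : eVariationOn g (Icc 0 1) ≠ ⊤) :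
    LipJoin E x y (eVariationOn g (Icc 0 1)).toReal := by
  obtain ⟨hc, h0, h1, hE⟩ := hg
  set f : ℝ → X := fun t => g (projIcc 0 1 zero_le_one t) with hf
  have hfc : Continuous f := by
    have : Continuous (IccExtend (zero_le_one (α := ℝ)) ((Icc (0 : ℝ) 1).domRestrict g)) :=
      (continuousOn_iff_continuous_domRestrict.1 hc).Icc_extend'
    exact this
  have hbv : BoundedVariationOn f univ := by
    refine ne_top_of_le_ne_top hfin ?_
    exact eVariationOn.comp_le_of_monotoneOn g (fun t : ℝ => (projIcc 0 1 zero_le_one t : ℝ))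
      (fun _ _ _ _ hst => monotone_projIcc zero_le_one hst) (fun t _ => (projIcc 0 1 zero_le_one t).2)
  have hlbv := hbv.locallyBoundedVariationOn
  set V := variationOnFromTo f univ 0 with hV
  have hVc : Continuous V := by
    rw [continuous_iff_continuousAt]
    intro t
    rw [continuousAt_iff_continuous_left'_right']
    constructor
    · have := variationOnFromTo.tendsto_left (f := f) (l := f t) (mem_univ 0) (mem_univ t) hlbv
        (hfc.continuousAt.mono_left nhdsWithin_le_nhds)
      simpa [ContinuousWithinAt] using this
    · have := variationOnFromTo.tendsto_right (f := f) (l := f t) (mem_univ 0) (mem_univ t) hlbv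
        (hfc.continuousAt.mono_left nhdsWithin_le_nhds)
      simpa [ContinuousWithinAt] using this
  have hV0 : V 0 = 0 := variationOnFromTo.self _ _ _
  have hfg : EqOn f g (Icc 0 1) := fun t ht => by simp [hf, projIcc_of_mem _ ht]
  have hV1 : V 1 = (eVariationOn g (Icc 0 1)).toReal := by
    rw [hV, variationOnFromTo.eq_of_le _ _ zero_le_one, univ_inter, eVariationOn.congr hfg]
  have hdist : ∀ s t, dist (f s) (f t) ≤ |V s - V t| := by
    have key : ∀ s t, s ≤ t → dist (f s) (f t) ≤ V t - V s := by
      intro s t hst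
      have h2 : V t - V s = variationOnFromTo f univ s t := by
        have := variationOnFromTo.add hlbv (mem_univ 0) (mem_univ s) (mem_univ t)
        simp only [hV]; linarith
      rw [h2, variationOnFromTo.eq_of_le _ _ hst, univ_inter, dist_edist]
      exact ENNReal.toReal_mono (ne_top_of_le_ne_top hbv (eVariationOn.mono f (subset_univ _)))
        (eVariationOn.edist_le f (left_mem_Icc.2 hst) (right_mem_Icc.2 hst))
    intro s t
    rcases le_total s t with hst | hst
    · rw [abs_sub_comm]; exact (key s t hst).trans (le_abs_self _)
    · rw [dist_comm]; exact (key t s hst).trans (le_abs_self _)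
  rw [← hV1]
  have hV1n : 0 ≤ V 1 := by rw [hV1]; exact ENNReal.toReal_nonneg
  have hsurj : ∀ r ∈ Icc 0 (V 1), ∃ t, V t = r := fun r hr => by
    have := intermediate_value_Icc (zero_le_one (α := ℝ)) hVc.continuousOn (by rwa [hV0])
    obtain ⟨t, -, ht⟩ := this
    exact ⟨t, ht⟩
  choose! τ hτ using hsurj
  have hm0 : (0 : ℝ) ∈ Icc 0 (V 1) := ⟨le_rfl, hV1n⟩
  have hm1 : V 1 ∈ Icc 0 (V 1) := ⟨hV1n, le_rfl⟩
  refine LipJoin.of_on (β := fun r => f (τ r)) hV1n ?_ ?_ ?_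
    fun t _ => hE (projIcc 0 1 zero_le_one _).2
  · intro s hs t ht hst
    have := hdist (τ s) (τ t)
    rwa [hτ s hs, hτ t ht, abs_sub_comm, abs_of_nonneg (sub_nonneg.2 hst)] at this
  · have := hdist (τ 0) 0
    rw [hτ 0 hm0, hV0, sub_self, abs_zero, dist_le_zero] at this
    simpa [hf, h0] using this
  · have := hdist (τ (V 1)) 1
    rw [hτ _ hm1, sub_self, abs_zero, dist_le_zero] at this
    simpa [hf, h1] using this

lemma exists_lipJoin (hE : RectConnected E) (hx : x ∈ E) (hy : y ∈ E) {ε : ℝ} (hε : 0 < ε) :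
    ∃ M < pathDistIn E x y + ε, LipJoin E x y M := by
  obtain ⟨g₀, hg₀, hfin₀⟩ := hE x hx y hy
  set I := ⨅ g : {g : ℝ → X // IsPathIn E g x y}, eVariationOn g.1 (Icc 0 1) with hI
  have hIfin : I ≠ ⊤ := ne_top_of_le_ne_top hfin₀ (iInf_le _ (⟨g₀, hg₀⟩ : {g // IsPathIn E g x y}))
  have hlt : I < I + ENNReal.ofReal ε := ENNReal.lt_add_right hIfin (by simpa using hε)
  obtain ⟨⟨g, hg⟩, hgl⟩ := iInf_lt_iff.1 hlt
  have hgt : eVariationOn g (Icc 0 1) ≠ ⊤ := hgl.ne_top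
  refine ⟨_, ?_, LipJoin.of_eVariationOn hg hgt⟩
  have := (ENNReal.toReal_lt_toReal hgt (by simp [hIfin])).2 hgl
  rwa [ENNReal.toReal_add hIfin (by simp), ENNReal.toReal_ofReal hε.le] at this

lemma dist_le_pathDistIn (hE : RectConnected E) (hx : x ∈ E) (hy : y ∈ E) :
    dist x y ≤ pathDistIn E x y :=
  le_of_forall_pos_lt_add fun _ hε =>
    let ⟨_, hM, h⟩ := exists_lipJoin hE hx hy hε
    h.dist_le.trans_lt hM

lemma pathDistIn_triangle (hE : RectConnected E) (hx : x ∈ E) (hy : y ∈ E) (hz : z ∈ E) :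
    pathDistIn E x z ≤ pathDistIn E x y + pathDistIn E y z := by
  refine le_of_forall_pos_le_add fun ε hε => ?_
  obtain ⟨M, hM, h⟩ := exists_lipJoin hE hx hy (half_pos hε)
  obtain ⟨N, hN, h'⟩ := exists_lipJoin hE hy hz (half_pos hε)
  linarith [(h.trans h').pathDistIn_le]

lemma pathDistIn_comm (hE : RectConnected E) (hx : x ∈ E) (hy : y ∈ E) :
    pathDistIn E x y = pathDistIn E y x := by
  have key : ∀ {x y}, x ∈ E → y ∈ E → pathDistIn E x y ≤ pathDistIn E y x := fun hx hy =>
    le_of_forall_pos_le_add fun ε hε => by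
      obtain ⟨M, hM, h⟩ := exists_lipJoin hE hy hx hε
      exact h.symm.pathDistIn_le.trans hM.le
  exact le_antisymm (key hx hy) (key hy hx)

variable [Cat0 X]

lemma LipJoin.of_Seg (h : Seg x y ⊆ C) : LipJoin C x y (dist x y) := by
  rcases eq_or_ne x y with rfl | hxy
  · refine LipJoin.of_on (β := fun _ => x) (by simp) ?_ rfl rfl fun _ _ => h (left_mem_Seg _ _)
    intro s _ t _ hst
    simpa using hst
  have hd : 0 < dist x y := dist_pos.2 hxy
  have hmem : ∀ t ∈ Icc 0 (dist x y), t / dist x y ∈ Icc (0 : ℝ) 1 := fun t ht =>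
    ⟨div_nonneg ht.1 hd.le, (div_le_one hd).2 ht.2⟩
  refine LipJoin.of_on (β := fun t => G x y (t / dist x y)) hd.le ?_ (by simp)
    (by simp [hd.ne']) fun t ht => h (G_mem_Seg x y (hmem t ht))
  intro s hs t ht hst
  rw [dist_G_G x y (hmem s hs) (hmem t ht), ← sub_div, abs_div, abs_of_pos hd,
    div_mul_cancel₀ _ hd.ne', abs_sub_comm, abs_of_nonneg (sub_nonneg.2 hst)]

/-- A `1`-Lipschitz path whose endpoints are at distance equal to its length traverses the segment
between its endpoints. -/
lemma Seg_subset_image {h : ℝ → X} {s t : ℝ} (hst : s ≤ t)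
    (hl : ∀ a ∈ Icc s t, ∀ b ∈ Icc s t, a ≤ b → dist (h a) (h b) ≤ b - a)
    (hd : t - s ≤ dist (h s) (h t)) : Seg (h s) (h t) ⊆ h '' Icc s t := by
  intro m hm
  have hs := left_mem_Icc.2 hst
  have ht := right_mem_Icc.2 hst
  have hle : dist (h s) m ≤ t - s := by
    have := mem_Seg.1 hm
    linarith [hl s hs t ht hst, dist_nonneg (x := m) (y := h t)]
  have hr : s + dist (h s) m ∈ Icc s t := ⟨by linarith [dist_nonneg (x := h s) (y := m)], by linarith⟩
  have h1 := hl s hs _ hr hr.1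
  have h2 := hl _ hr t ht hr.2
  have h3 := dist_triangle (h s) (h (s + dist (h s) m)) (h t)
  refine ⟨_, hr, eq_of_mem_Seg_of_dist_eq (q := h s) (r := h t) ?_ hm ?_⟩
  · rw [mem_Seg]; linarith
  · linarith

end LipJoin

end

section

/-! ### Bigons in a closed set with trivial first homology -/

section Bigon

variable {κ : ℝ} {X : Type*} [MetricSpace X]

/-- Two paths with the same endpoints form a loop. -/
lemma exists_loop {α β : ℝ → X} {M N : ℝ} (hM : 0 ≤ M) (hN : 0 ≤ N) (hα : Continuous α)
    (hβ : Continuous β) (h0 : α 0 = β 0) (h1 : α N = β M) [hp : Fact (0 < M + N)] :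
    ∃ J : C(AddCircle (M + N), X), (∀ t ∈ Icc 0 M, J t = β t) ∧
      ∀ t ∈ Icc M (M + N), J t = α (M + N - t) := by
  set φ : ℝ → X := fun t => if t ≤ M then β t else α (M + N - t) with hφ
  have hφc : Continuous φ := Continuous.if_le hβ (hα.comp (continuous_const.sub continuous_id))
    continuous_id continuous_const fun t ht => by
      have : t = M := ht
      simp [this, h1]
  have hφβ : ∀ t ≤ M, φ t = β t := fun t ht => if_pos ht
  have hφα : ∀ t, M ≤ t → φ t = α (M + N - t) := fun t ht => by
    rcases ht.eq_or_lt with rfl | ht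
    · simp [hφ, h1]
    · exact if_neg (not_le.2 ht)
  have hend : φ 0 = φ (M + N) := by
    rw [hφβ 0 hM, hφα _ (by linarith), sub_self, h0]
  have hJ : ∀ t ∈ Icc 0 (M + N), AddCircle.liftIco (M + N) 0 φ t = φ t := by
    intro t ht
    rcases ht.2.eq_or_lt with rfl | ht2
    · have h2 : ((M + N : ℝ) : AddCircle (M + N)) = ((0 : ℝ) : AddCircle (M + N)) := by
        simpa using AddCircle.coe_period (M + N)
      rw [h2, AddCircle.liftIco_zero_coe_apply (left_mem_Ico.2 hp.out), hend]
    · exact AddCircle.liftIco_zero_coe_apply ⟨ht.1, ht2⟩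
  refine ⟨⟨AddCircle.liftIco (M + N) 0 φ, AddCircle.liftIco_zero_continuous hend
    hφc.continuousOn⟩, fun t ht => ?_, fun t ht => ?_⟩
  · exact (hJ t ⟨ht.1, by linarith [ht.2]⟩).trans (hφβ t ht.2)
  · exact (hJ t ⟨hM.trans ht.1, ht.2⟩).trans (hφα t ht.1)

variable [Cat0 X] {PC : PolyComplex2 κ X} {E V : Set X}

/-- If an injective path leaves another path with the same endpoints, then some point off the
former and near it lies on a segment contained in `E` with both endpoints on one of the paths. -/
lemma exists_chord_of_bigon (PC : PolyComplex2 κ X) (hκ : κ ≤ 0) (hEc : IsClosed E)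
    (hE : H1Trivial E) {α β : ℝ → X} {M N : ℝ} (hM : 0 ≤ M) (hN : 0 ≤ N)
    (hα : Continuous α) (hβ : LipschitzWith 1 β) (h0 : α 0 = β 0) (h1 : α N = β M)
    (hαE : ∀ t ∈ Icc 0 N, α t ∈ E) (hβE : ∀ t ∈ Icc 0 M, β t ∈ E) (hinj : InjOn β (Icc 0 M))
    (hV : IsOpen V) (hαV : ∀ t ∈ Icc 0 N, α t ∉ V) {t₀ : ℝ} (ht₀ : t₀ ∈ Icc 0 M)
    (htV : β t₀ ∈ V) :
    ∃ w ∈ V, w ∉ β '' Icc 0 M ∧ ∃ u v,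
      (u ∈ α '' Icc 0 N ∧ v ∈ α '' Icc 0 N ∨ u ∈ β '' Icc 0 M ∧ v ∈ β '' Icc 0 M) ∧
      w ∈ Seg u v ∧ Seg u v ⊆ E ∧
      ∀ o, ∀ z ∈ Seg u v, ∃ q ∈ α '' Icc 0 N ∪ β '' Icc 0 M, z ∈ Seg o q := by
  have hne0 : t₀ ≠ 0 := by
    rintro rfl
    exact hαV 0 (left_mem_Icc.2 hN) (h0 ▸ htV)
  have hneM : t₀ ≠ M := by
    rintro rfl
    exact hαV N (right_mem_Icc.2 hN) (h1 ▸ htV)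
  have ht₀' : t₀ ∈ Ioo 0 M := ⟨ht₀.1.lt_of_ne hne0.symm, ht₀.2.lt_of_ne hneM⟩
  have : Fact (0 < M + N) := ⟨by linarith [ht₀'.1, ht₀'.2]⟩
  obtain ⟨J, hJβ, hJα⟩ := exists_loop hM hN hα hβ.continuous h0 h1
  have hmem : ∀ t : AddCircle (M + N), (∃ s ∈ Icc 0 M, (s : AddCircle (M + N)) = t) ∨
      ∃ s ∈ Icc 0 N, J t = α s := by
    intro t
    obtain ⟨s, hs, rfl⟩ := AddCircle.exists_coe t
    rcases le_total s M with h | h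
    · exact Or.inl ⟨s, ⟨hs.1, h⟩, rfl⟩
    · exact Or.inr ⟨M + N - s, ⟨by linarith [hs.2], by linarith⟩, hJα s ⟨h, hs.2.le⟩⟩
  have hJE : ∀ t, J t ∈ E := by
    intro t
    rcases hmem t with ⟨s, hs, rfl⟩ | ⟨s, hs, h⟩
    · rw [hJβ s hs]; exact hβE s hs
    · rw [h]; exact hαE s hs
  have hJr : range J ⊆ α '' Icc 0 N ∪ β '' Icc 0 M := by
    rintro _ ⟨t, rfl⟩
    rcases hmem t with ⟨s, hs, rfl⟩ | ⟨s, hs, h⟩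
    · exact Or.inr ⟨s, hs, (hJβ s hs).symm⟩
    · exact Or.inl ⟨s, hs, h.symm⟩
  have hΩE : closure (windingSet PC J) ⊆ E := closure_minimal (fun z hz => by
    by_contra hzE
    exact not_winds_of_H1Trivial hJE hE hzE hz.2.2) hEc
  have hJinj : ∀ s t, J s ∈ V → J t = J s → t = s := by
    intro s t hs hst
    rcases hmem s with ⟨a, ha, rfl⟩ | ⟨a, ha, h⟩
    · rcases hmem t with ⟨b, hb, rfl⟩ | ⟨b, hb, h⟩
      · rw [hJβ a ha, hJβ b hb] at hst
        rw [hinj hb ha hst]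
      · exact (hαV b hb (h ▸ hst ▸ hs)).elim
    · exact (hαV a ha (h ▸ hs)).elim
  obtain ⟨w, hwV, hwΩ⟩ := exists_mem_windingSet (PC := PC) (J := J) hκ hV hJinj (a := 0) (b := M)
    (by linarith) (M := 1) (fun a ha b hb => by
      simp only [hJβ a ha, hJβ b hb]; exact hβ a b) ht₀' (by rwa [hJβ t₀ ht₀])
  obtain ⟨u, v, huv, hw, hsub⟩ := exists_chord hκ
    ((isCompact_Icc (a := 0) (b := N)).image hα)
    ((isCompact_Icc (a := 0) (b := M)).image hβ.continuous) hJr hwΩ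
  refine ⟨w, hwV, ?_, u, v, huv, hw, hsub.trans hΩE, fun o z hz => ?_⟩
  · rintro ⟨t, ht, rfl⟩
    exact hwΩ.1 ⟨t, hJβ t ht⟩
  · have hfan : closure (windingSet PC J) ⊆ {z | ∃ t, z ∈ Seg o (J t)} :=
      closure_minimal (fun z hz => hz.2.2.exists_mem_Seg o) (isCompact_fan o).isClosed
    obtain ⟨t, ht⟩ := hfan (hsub hz)
    exact ⟨_, hJr ⟨t, rfl⟩, ht⟩

/-- Geodesics of the path metric are unique. -/
theorem eqOn_of_isGeodesicFromTo (PC : PolyComplex2 κ X) (hκ : κ ≤ 0) (hEc : IsClosed E)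
    (hErc : RectConnected E) (hE : H1Trivial E) {x y : X} {f g : ℝ → X}
    (hf : IsGeodesicFromTo (pathDistIn E) E f x y) (hg : IsGeodesicFromTo (pathDistIn E) E g x y) :
    EqOn f g (Icc 0 (pathDistIn E x y)) := by
  have hlip : ∀ h : ℝ → X, IsGeodesicFromTo (pathDistIn E) E h x y →
      ∀ s ∈ Icc 0 (pathDistIn E x y), ∀ t ∈ Icc 0 (pathDistIn E x y), s ≤ t →
        dist (h s) (h t) ≤ t - s := by
    intro h hh s hs t ht hst
    have := dist_le_pathDistIn hErc (hh.2.2.2 hs) (hh.2.2.2 ht)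
    rwa [hh.2.2.1.2 s hs t ht, abs_sub_comm, abs_of_nonneg (sub_nonneg.2 hst)] at this
  have hd := hf.2.2.1.1
  have hchord : ∀ h : ℝ → X, IsGeodesicFromTo (pathDistIn E) E h x y →
      ∀ u ∈ h '' Icc 0 (pathDistIn E x y), ∀ v ∈ h '' Icc 0 (pathDistIn E x y), Seg u v ⊆ E →
        Seg u v ⊆ h '' Icc 0 (pathDistIn E x y) := by
    have key : ∀ h : ℝ → X, IsGeodesicFromTo (pathDistIn E) E h x y →
        ∀ s ∈ Icc 0 (pathDistIn E x y), ∀ t ∈ Icc 0 (pathDistIn E x y), s ≤ t →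
          Seg (h s) (h t) ⊆ E → Seg (h s) (h t) ⊆ h '' Icc 0 (pathDistIn E x y) := by
      intro h hh s hs t ht hst hsub
      have h1 : Icc s t ⊆ Icc 0 (pathDistIn E x y) := Icc_subset_Icc hs.1 ht.2
      refine (Seg_subset_image hst (fun a ha b hb => hlip h hh a (h1 ha) b (h1 hb)) ?_).trans
        (image_mono h1)
      have := (LipJoin.of_Seg hsub).pathDistIn_le
      rwa [hh.2.2.1.2 s hs t ht, abs_sub_comm, abs_of_nonneg (sub_nonneg.2 hst)] at this
    rintro h hh _ ⟨s, hs, rfl⟩ _ ⟨t, ht, rfl⟩ hsub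
    rcases le_total s t with hst | hst
    · exact key h hh s hs t ht hst hsub
    · rw [Seg_comm] at hsub ⊢
      exact key h hh t ht s hs hst hsub
  obtain ⟨α, hα, hαg, -⟩ := exists_lipschitzWith_eqOn hd (hlip g hg)
  obtain ⟨β, hβ, hβf, -⟩ := exists_lipschitzWith_eqOn hd (hlip f hf)
  set D := pathDistIn E x y with hD
  have hdist : ∀ h : ℝ → X, IsGeodesicFromTo (pathDistIn E) E h x y → ∀ t ∈ Icc 0 D,
      pathDistIn E x (h t) = t := by
    intro h hh t ht
    have := hh.2.2.1.2 0 (left_mem_Icc.2 hd) t ht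
    rwa [hh.1, zero_sub, abs_neg, abs_of_nonneg ht.1] at this
  by_contra hne
  obtain ⟨t₀, ht₀, hne⟩ : ∃ t ∈ Icc 0 D, f t ≠ g t := by
    by_contra hcon
    push Not at hcon
    exact hne hcon
  have hcg : IsClosed (g '' Icc 0 D) := by
    rw [← hαg.image_eq]
    exact (isCompact_Icc.image hα.continuous).isClosed
  have hm0 : (0 : ℝ) ∈ Icc 0 D := left_mem_Icc.2 hd
  have hm1 : D ∈ Icc 0 D := right_mem_Icc.2 hd
  obtain ⟨w, hwV, hwf, u, v, huv, hw, hsub, -⟩ := exists_chord_of_bigon PC hκ hEc hE hd hd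
    hα.continuous hβ (by rw [hαg hm0, hβf hm0, hf.1, hg.1])
    (by rw [hαg hm1, hβf hm1, hf.2.1, hg.2.1])
    (fun t ht => by rw [hαg ht]; exact hg.2.2.2 ht) (fun t ht => by rw [hβf ht]; exact hf.2.2.2 ht)
    (fun s hs t ht hst => by
      rw [hβf hs, hβf ht] at hst
      rw [← hdist f hf s hs, hst, hdist f hf t ht]) hcg.isOpen_compl
    (fun t ht h => h ⟨t, ht, (hαg ht).symm⟩) ht₀ (by
      rintro ⟨s, hs, hst⟩
      rw [hβf ht₀] at hst
      have : s = t₀ := by rw [← hdist g hg s hs, hst, hdist f hf t₀ ht₀]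
      exact hne (this ▸ hst).symm)
  rw [hαg.image_eq, hβf.image_eq] at huv
  rw [hβf.image_eq] at hwf
  rcases huv with ⟨hu, hv⟩ | ⟨hu, hv⟩
  · exact hwV (hchord g hg u hu v hv hsub hw)
  · exact hwf (hchord f hf u hu v hv hsub hw)

end Bigon

end

section

/-! ### Existence of geodesics -/

section Existence

variable {κ : ℝ} {X : Type*} [MetricSpace X] [Cat0 X] {E : Set X}

/-- The union of the segments from a point of `A` to a point of `B`. -/
def segJoin (A B : Set X) : Set X := {z | ∃ u ∈ A, ∃ v ∈ B, z ∈ Seg u v}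

lemma isCompact_segJoin {A B : Set X} (hA : IsCompact A) (hB : IsCompact B) :
    IsCompact (segJoin A B) := by
  have h := (hA.prod (hB.prod (isCompact_Icc (a := (0 : ℝ)) (b := 1)))).image
    (f := fun q : X × X × ℝ => G q.1 q.2.1 q.2.2)
    (continuous_G_comp continuous_fst (continuous_fst.comp continuous_snd)
      (continuous_snd.comp continuous_snd))
  convert h using 1
  ext z
  constructor
  · rintro ⟨u, hu, v, hv, hz⟩
    rw [Seg_eq_image] at hz
    obtain ⟨t, ht, rfl⟩ := hz
    exact ⟨(u, v, t), ⟨hu, hv, ht⟩, rfl⟩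
  · rintro ⟨⟨u, v, t⟩, ⟨hu, hv, ht⟩, rfl⟩
    exact ⟨u, hu, v, hv, G_mem_Seg u v ht⟩

/-- Pieces of a shortest path are shortest. -/
lemma le_of_lipJoin_of_min {C : Set X} {β : ℝ → X} {x y : X} {I L s t : ℝ}
    (hβ : LipschitzWith 1 β) (h0 : β 0 = x) (h1 : β I = y) (hC : ∀ t, β t ∈ C)
    (hmin : ∀ N, LipJoin C x y N → I ≤ N) (hs : s ∈ Icc 0 I) (ht : t ∈ Icc 0 I)
    (h : LipJoin C (β s) (β t) L) : t - s ≤ L := by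
  have h2 := LipJoin.subpath hβ hs.1 hC
  have h3 := LipJoin.subpath hβ ht.2 hC
  rw [h0] at h2
  rw [h1] at h3
  linarith [hmin _ ((h2.trans h).trans h3)]

lemma exists_lipJoin_inter (PC : PolyComplex2 κ X) (hκ : κ ≤ 0) (hEc : IsClosed E)
    (hE : H1Trivial E) {x y : X} {α : ℝ → X} {N : ℝ} (hN : 0 ≤ N) (hα : LipschitzWith 1 α)
    (h0 : α 0 = x) (h1 : α N = y) (hαE : ∀ t, α t ∈ E) {M : ℝ} (h : LipJoin E x y M) :
    ∃ I ≤ M, LipJoin (E ∩ segJoin (α '' Icc 0 N) (α '' Icc 0 N)) x y I := by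
  have hA : IsCompact (α '' Icc 0 N) := isCompact_Icc.image hα.continuous
  set K := segJoin (α '' Icc 0 N) (α '' Icc 0 N) with hK
  obtain ⟨hM, γ, hγ, hγ0, hγ1, hγE⟩ := h
  set D := segJoin {x} (α '' Icc 0 N ∪ γ '' Icc 0 M) with hD
  have hDc : IsCompact D :=
    isCompact_segJoin isCompact_singleton (hA.union (isCompact_Icc.image hγ.continuous))
  have hjoin : LipJoin (E ∩ D) x y M := by
    refine LipJoin.of_on hM (fun s _ t _ hst => ?_) hγ0 hγ1
      fun t ht => ⟨hγE t, x, rfl, γ t, Or.inr ⟨t, ht, rfl⟩, right_mem_Seg _ _⟩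
    have := dist_le_abs_of_lipschitz hγ s t
    rwa [abs_sub_comm, abs_of_nonneg (sub_nonneg.2 hst)] at this
  obtain ⟨I, ⟨hI, β, hβ, hβ0, hβ1, hβC⟩, hmin⟩ := hjoin.exists_min (hDc.inter_left hEc)
  have hlip : ∀ s t, s ≤ t → dist (β s) (β t) ≤ t - s := fun s t hst => by
    have := dist_le_abs_of_lipschitz hβ s t
    rwa [abs_sub_comm, abs_of_nonneg (sub_nonneg.2 hst)] at this
  have hle : ∀ {s t L}, s ∈ Icc 0 I → t ∈ Icc 0 I → LipJoin (E ∩ D) (β s) (β t) L → t - s ≤ L :=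
    fun hs ht h => le_of_lipJoin_of_min hβ hβ0 hβ1 hβC hmin hs ht h
  have hinj : InjOn β (Icc 0 I) := by
    intro s hs t ht hst
    have h2 := LipJoin.subpath hβ le_rfl hβC (s := s)
    have h3 := hle (L := s - s) hs ht (by rwa [← hst])
    have h4 := hle (L := s - s) ht hs (by rwa [← hst])
    linarith
  have hchord : ∀ s ∈ Icc 0 I, ∀ t ∈ Icc 0 I, s ≤ t → Seg (β s) (β t) ⊆ E ∩ D →
      Seg (β s) (β t) ⊆ β '' Icc 0 I := fun s hs t ht hst hsub =>
    (Seg_subset_image hst (fun a _ b _ hab => hlip a b hab)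
      (hle hs ht (LipJoin.of_Seg hsub))).trans (image_mono (Icc_subset_Icc hs.1 ht.2))
  refine ⟨I, hmin M hjoin, LipJoin.of_on hI (fun s _ t _ => hlip s t) hβ0 hβ1
    fun t₀ ht₀ => ⟨(hβC t₀).1, ?_⟩⟩
  by_contra htK
  obtain ⟨w, hwV, hwβ, u, v, huv, hw, hsub, hfan⟩ := exists_chord_of_bigon PC hκ hEc hE hI hN
    hα.continuous hβ (h0.trans hβ0.symm) (h1.trans hβ1.symm) (fun t _ => hαE t)
    (fun t _ => (hβC t).1) hinj (isCompact_segJoin hA hA).isClosed.isOpen_compl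
    (fun t ht h => h ⟨α t, ⟨t, ht, rfl⟩, α t, ⟨t, ht, rfl⟩, left_mem_Seg _ _⟩) ht₀ htK
  have hsubD : Seg u v ⊆ E ∩ D := by
    refine fun z hz => ⟨hsub hz, ?_⟩
    obtain ⟨q, hq | ⟨t, ht, rfl⟩, hzq⟩ := hfan x z hz
    · exact ⟨x, rfl, q, Or.inl hq, hzq⟩
    · obtain ⟨x', rfl, q', hq', hqq'⟩ := (hβC t).2
      exact ⟨_, rfl, q', hq', (Seg_trans hqq' hzq).1⟩
  rcases huv with ⟨hu, hv⟩ | ⟨⟨s, hs, rfl⟩, ⟨t, ht, rfl⟩⟩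
  · exact hwV ⟨u, hu, v, hv, hw⟩
  · rcases le_total s t with hst | hst
    · exact hwβ (hchord s hs t ht hst hsubD hw)
    · rw [Seg_comm] at hsubD hw
      exact hwβ (hchord t ht s hs hst hsubD hw)

/-- Any two points are joined by a geodesic of the path metric. -/
theorem exists_isGeodesicFromTo (PC : PolyComplex2 κ X) (hκ : κ ≤ 0) (hEc : IsClosed E)
    (hErc : RectConnected E) (hE : H1Trivial E) {x y : X} (hx : x ∈ E) (hy : y ∈ E) :
    ∃ f, IsGeodesicFromTo (pathDistIn E) E f x y := by
  obtain ⟨N, -, hjoin⟩ := exists_lipJoin hErc hx hy one_pos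
  have hjoin' := hjoin
  obtain ⟨hN, α, hα, h0, h1, hαE⟩ := hjoin'
  have hA : IsCompact (α '' Icc 0 N) := isCompact_Icc.image hα.continuous
  have key : ∀ {M}, LipJoin E x y M → _ := fun h =>
    exists_lipJoin_inter PC hκ hEc hE hN hα h0 h1 hαE h
  obtain ⟨M, -, hM⟩ := key hjoin
  obtain ⟨I, hI, hmin⟩ := hM.exists_min ((isCompact_segJoin hA hA).inter_left hEc)
  have hIeq : I = pathDistIn E x y := by
    refine le_antisymm (le_of_forall_pos_le_add fun ε hε => ?_)
      (hI.mono_set inter_subset_left).pathDistIn_le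
    obtain ⟨L, hL, hLj⟩ := exists_lipJoin hErc hx hy hε
    obtain ⟨L', hL', hLj'⟩ := key hLj
    linarith [hmin _ hLj']
  obtain ⟨hI0, f, hf, hf0, hf1, hfC⟩ := hI
  have hfE : ∀ t, f t ∈ E := fun t => (hfC t).1
  have hdist : ∀ s ∈ Icc 0 I, ∀ t ∈ Icc 0 I, s ≤ t → pathDistIn E (f s) (f t) = t - s := by
    intro s hs t ht hst
    refine le_antisymm (LipJoin.subpath hf hst hfE).pathDistIn_le ?_
    have h2 := (LipJoin.subpath hf hs.1 hfE).pathDistIn_le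
    have h3 := (LipJoin.subpath hf ht.2 hfE).pathDistIn_le
    rw [hf0] at h2
    rw [hf1] at h3
    have h4 := pathDistIn_triangle hErc hx (hfE s) hy
    have h5 := pathDistIn_triangle hErc (hfE s) (hfE t) hy
    linarith
  refine ⟨f, hf0, hIeq ▸ hf1, ⟨hIeq ▸ hI0, ?_⟩, fun t _ => hfE t⟩
  rw [← hIeq]
  intro s hs t ht
  rcases le_total s t with hst | hst
  · rw [hdist s hs t ht hst, abs_sub_comm, abs_of_nonneg (sub_nonneg.2 hst)]
  · rw [pathDistIn_comm hErc (hfE s) (hfE t), hdist t ht s hs hst, abs_of_nonneg (sub_nonneg.2 hst)]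

end Existence

end

end Cat2Cx

end

open Cat2Cx in
/-- **Corollary.**  `Y` is uniquely geodesic: every pair of points of `Y` is joined by
exactly one geodesic in `Y`. -/
theorem Y_uniquely_geodesic
    {κ : ℝ} (hκ : κ ≤ 0) {X : Type*} [MetricSpace X]
    (PC : PolyComplex2 κ X) (hX : IsCATSpace κ X)
    (E : Set X) (hEclosed : IsClosed E) (hErc : RectConnected E) (hH1 : H1Trivial ↥E) :
    ∀ x ∈ E, ∀ y ∈ E,
      (∃ f, IsGeodesicFromTo (pathDistIn E) E f x y) ∧
      ∀ f g : ℝ → X, IsGeodesicFromTo (pathDistIn E) E f x y →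
        IsGeodesicFromTo (pathDistIn E) E g x y →
        Set.EqOn f g (Set.Icc 0 (pathDistIn E x y)) := by
  have := hX.cat0 hκ
  exact fun x hx y hy => ⟨exists_isGeodesicFromTo PC hκ hEclosed hErc hH1 hx hy,
    fun f g hf hg => eqOn_of_isGeodesicFromTo PC hκ hEclosed hErc hH1 hf hg⟩
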